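/- For every ε > 0 and a ≥ 0, there exists v ∈ H¹(ℝ²,ℝ²) such that E(v) = min over H¹(ℝ²,ℝ²) of E. Moreover any such global minimizer v is a C^∞ classical solution of the Euler–Lagrange equation ε²Δv + μ(x)v − |v|²v + εa f(x) = 0 on ℝ², and v(x) → 0 as |x| → ∞. -/

import Mathlib

open MeasureTheory Filter Real Set
open scoped Topology ENNReal

noncomputable section

/-- We identify the plane with the Euclidean space `ℝ²`. -/
abbrev E2 : Type := EuclideanSpace ℝ (Fin 2)

/-- The standard basis vectors of `ℝ²`. -/
def e2basis (i : Fin 2) : E2 := EuclideanSpace.single i 1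

/-- Rotation of a vector by `π/2` (multiplication by `i` in complex notation). -/
def perp (e : E2) : E2 := EuclideanSpace.single 0 (-(e 1)) + EuclideanSpace.single 1 (e 0)

/-- The unit vector `e^{iθ}`. -/
def uvec (θ : ℝ) : E2 := EuclideanSpace.single 0 (Real.cos θ) + EuclideanSpace.single 1 (Real.sin θ)

/-- The Laplacian of a map `u : ℝ² → ℝ²`. -/
def lap (u : E2 → E2) (x : E2) : E2 :=
  ∑ i : Fin 2, fderiv ℝ (fun y => fderiv ℝ u y (e2basis i)) x (e2basis i)

/-- `|∇u|²`, the squared Hilbert-Schmidt norm of the full gradient of `u : ℝ² → ℝ²`. -/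
def gradSq (u : E2 → E2) (x : E2) : ℝ := ∑ i : Fin 2, ‖fderiv ℝ u x (e2basis i)‖ ^ 2

/-- `∑_j ∇u_j · ∇ψ_j`, the Hilbert-Schmidt inner product of the gradients. -/
def gradInner (u ψ : E2 → E2) (x : E2) : ℝ :=
  ∑ i : Fin 2, (inner ℝ (fderiv ℝ u x (e2basis i)) (fderiv ℝ ψ x (e2basis i)) : ℝ)

/-- Membership in `H¹(ℝ²,ℝ²)`: `u ∈ L²` together with its gradient. -/
def MemH1 (u : E2 → E2) : Prop :=
  Differentiable ℝ u ∧ MemLp u 2 (volume : Measure E2) ∧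
    MemLp (fun x => fderiv ℝ u x) 2 (volume : Measure E2)

/-- The Ginzburg–Landau energy
`E(u) = ∫ (1/2)|∇u|² − (1/(2ε²))μ|u|² + (1/(4ε²))|u|⁴ − (a/ε) f·u`. -/
def energy (ε a : ℝ) (μ : E2 → ℝ) (f : E2 → E2) (u : E2 → E2) : ℝ :=
  ∫ x : E2, ((1/2) * gradSq u x - (1/(2*ε^2)) * μ x * ‖u x‖^2
    + (1/(4*ε^2)) * ‖u x‖^4 - (a/ε) * (inner ℝ (f x) (u x) : ℝ))

/-- `v` is a global minimizer of `E` over `H¹(ℝ²,ℝ²)`. -/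
def IsMinimizer (ε a : ℝ) (μ : E2 → ℝ) (f : E2 → E2) (v : E2 → E2) : Prop :=
  MemH1 v ∧ ∀ u : E2 → E2, MemH1 u → energy ε a μ f v ≤ energy ε a μ f u

/-- `u` is a smooth classical solution of the Euler–Lagrange equation
`ε²Δu + μu − |u|²u + εa f = 0` on `ℝ²`. -/
def IsSolution (ε a : ℝ) (μ : E2 → ℝ) (f : E2 → E2) (u : E2 → E2) : Prop :=
  ContDiff ℝ (⊤ : ℕ∞) u ∧ ∀ x : E2, ε^2 • lap u x + μ x • u x - ‖u x‖^2 • u x + (ε*a) • f x = 0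

/-- Hypotheses on the radial coefficient `μ`. -/
structure MuHyp (μ : E2 → ℝ) (μrad : ℝ → ℝ) (ρ : ℝ) : Prop where
  smooth : ContDiff ℝ (⊤ : ℕ∞) μ
  smooth_rad : ContDiff ℝ (⊤ : ℕ∞) μrad
  even_rad : ∀ r : ℝ, μrad (-r) = μrad r
  radial : ∀ x : E2, μ x = μrad ‖x‖
  bdd : ∃ C : ℝ, ∀ x : E2, |μ x| ≤ C
  deriv_neg : ∀ r : ℝ, 0 < r → deriv μrad r < 0
  rho_pos : 0 < ρ
  rho_root : μrad ρ = 0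
  rho_unique : ∀ r : ℝ, 0 < r → μrad r = 0 → r = ρ

/-- Hypotheses on the radial vector field `f`. -/
structure FHyp (f : E2 → E2) (frad : ℝ → ℝ) : Prop where
  smooth : ContDiff ℝ (⊤ : ℕ∞) f
  smooth_rad : ContDiff ℝ (⊤ : ℕ∞) frad
  odd_rad : ∀ r : ℝ, frad (-r) = -frad r
  radial : ∀ x : E2, x ≠ 0 → f x = (frad ‖x‖ / ‖x‖) • x
  integrable : Integrable f (volume : Measure E2)
  bdd : ∃ C : ℝ, ∀ x : E2, ‖f x‖ ≤ C
  pos_rad : ∀ r : ℝ, 0 < r → 0 < frad r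

/-- Convergence in `C²_loc(ℝ²,ℝ²)` of a sequence of maps. -/
def TendstoC2LocSeq (F : ℕ → E2 → E2) (g : E2 → E2) : Prop :=
  TendstoLocallyUniformly F g atTop ∧
  TendstoLocallyUniformly (fun n x => fderiv ℝ (F n) x) (fun x => fderiv ℝ g x) atTop ∧
  TendstoLocallyUniformly (fun n x => fderiv ℝ (fderiv ℝ (F n)) x)
    (fun x => fderiv ℝ (fderiv ℝ g) x) atTop

/-- `l` is a limit point (as `ε → 0`) of the set of zeros of the family `v ε`. -/
def IsZeroLimitPoint (v : ℝ → E2 → E2) (l : E2) : Prop :=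
  ∃ (εs : ℕ → ℝ) (xs : ℕ → E2), (∀ n, 0 < εs n) ∧ Tendsto εs atTop (𝓝 (0:ℝ)) ∧
    (∀ n, v (εs n) (xs n) = 0) ∧ Tendsto xs atTop (𝓝 l)

section

open scoped SchwartzMap FourierTransform LineDeriv Laplacian

/-- The operator `1 - Δ/(4π²)` on Schwartz functions. -/
def Lop (φ : 𝓢(E2, ℂ)) : 𝓢(E2, ℂ) := φ - ((1 / (4 * π ^ 2) : ℝ) : ℂ) • Δ φ

/-- Weighted Wiener algebra. -/
def WK (k : ℕ) (w : E2 → ℂ) : Prop :=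
  ∃ h : E2 → ℂ, Integrable h ∧ Integrable (fun ξ => (1 + ‖ξ‖) ^ k * ‖h ξ‖) ∧ w = 𝓕 h

lemma fourier_pair (h : E2 → ℂ) (hh : Integrable h) (φ : 𝓢(E2, ℂ)) :
    ∫ x, 𝓕 h x * φ x = ∫ ξ, h ξ * 𝓕 φ ξ := by
  have := VectorFourier.integral_fourierIntegral_smul_eq_flip (L := innerₗ E2)
    (μ := volume) (ν := volume) Real.continuous_fourierChar continuous_inner hh φ.integrable
  simp only [smul_eq_mul, flip_innerₗ] at this
  exact this

lemma fourier_lap (φ : 𝓢(E2, ℂ)) (ξ : E2) :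
    𝓕 (Δ φ) ξ = -((2 * π) ^ 2 * ‖ξ‖ ^ 2 : ℝ) * 𝓕 φ ξ := by
  rw [SchwartzMap.laplacian_eq_fourierMultiplierCLM, SchwartzMap.fourierMultiplierCLM_apply]
  have : 𝓕 (-(2 * π) ^ 2 • 𝓕⁻ (SchwartzMap.smulLeftCLM ℂ (fun x : E2 => ‖x‖ ^ 2) (𝓕 φ)))
    = -(2 * π) ^ 2 • SchwartzMap.smulLeftCLM ℂ (fun x : E2 => ‖x‖ ^ 2) (𝓕 φ) := by
    rw [FourierTransform.fourier_smul, FourierTransform.fourier_fourierInv_eq]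
  rw [this, smul_apply, SchwartzMap.smulLeftCLM_apply_apply (by fun_prop)]
  simp
  ring

lemma fourier_Lop (φ : 𝓢(E2, ℂ)) (ξ : E2) :
    𝓕 (Lop φ) ξ = ((1 + ‖ξ‖ ^ 2 : ℝ) : ℂ) * 𝓕 φ ξ := by
  have : 𝓕 (Lop φ) = 𝓕 φ - ((1 / (4 * π ^ 2) : ℝ) : ℂ) • 𝓕 (Δ φ) := by
    unfold Lop
    rw [sub_eq_add_neg, ← neg_smul, FourierTransform.fourier_add, FourierTransform.fourier_smul,
      neg_smul, ← sub_eq_add_neg]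
  rw [this, sub_apply, smul_apply, fourier_lap]
  have : (π : ℂ) ≠ 0 := by exact_mod_cast pi_ne_zero
  simp
  field_simp
  ring

lemma Lop_surj (ψ : 𝓢(E2, ℂ)) : ∃ φ, Lop φ = ψ := by
  have hg := Function.hasTemperateGrowth_one_add_norm_sq_rpow E2 (-1)
  refine ⟨𝓕⁻ (SchwartzMap.smulLeftCLM ℂ (fun x : E2 => (1 + ‖x‖ ^ 2) ^ (-1 : ℝ)) (𝓕 ψ)), ?_⟩
  have : 𝓕 (Lop (𝓕⁻ (SchwartzMap.smulLeftCLM ℂ (fun x : E2 => (1 + ‖x‖ ^ 2) ^ (-1 : ℝ)) (𝓕 ψ))))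
      = 𝓕 ψ := by
    ext ξ
    rw [fourier_Lop, FourierTransform.fourier_fourierInv_eq,
      SchwartzMap.smulLeftCLM_apply_apply hg]
    have h1 : (0:ℝ) < 1 + ‖ξ‖ ^ 2 := by positivity
    have h2 : ((1 + ‖ξ‖ ^ 2 : ℝ) : ℂ) ≠ 0 := by exact_mod_cast h1.ne'
    rw [Real.rpow_neg_one, Complex.real_smul, ← mul_assoc, Complex.ofReal_inv,
      mul_inv_cancel₀ h2, one_mul]
  have h3 := congrArg (fun z => 𝓕⁻ z) this
  simpa [FourierTransform.fourierInv_fourier_eq] using h3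

lemma Lop_unique (z : E2 → ℂ) (hz : LocallyIntegrable z)
    (h : ∀ φ : 𝓢(E2, ℂ), ∫ x, z x * Lop φ x = 0) : ∀ᵐ x, z x = 0 := by
  apply ae_eq_zero_of_integral_contDiff_smul_eq_zero hz
  intro g hg hc
  have hc' : HasCompactSupport (fun x => (g x : ℂ)) := hc.comp_left (g := fun r : ℝ => (r : ℂ)) (by simp)
  have hg' : ContDiff ℝ (⊤ : ℕ∞) (fun x => (g x : ℂ)) := Complex.ofRealCLM.contDiff.comp hg
  obtain ⟨φ, hφ⟩ := Lop_surj (hc'.toSchwartzMap hg')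
  rw [← h φ, hφ]
  congr 1
  ext x
  simp [mul_comm]

lemma WK.integrable_pow {k : ℕ} {h : E2 → ℂ} (h1 : Integrable h)
    (hk : Integrable (fun ξ => (1 + ‖ξ‖) ^ k * ‖h ξ‖)) (n : ℕ) (hn : n ≤ k) :
    Integrable (fun ξ => ‖ξ‖ ^ n * ‖h ξ‖) := by
  refine hk.mono' ?_ ?_
  · exact ((continuous_norm.pow n).aestronglyMeasurable).mul h1.aestronglyMeasurable.norm
  · filter_upwards with ξ
    rw [norm_mul, norm_norm, norm_pow, norm_norm]
    gcongr
    calc ‖ξ‖ ^ n ≤ (1 + ‖ξ‖) ^ n := by gcongr; linarith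
      _ ≤ _ := pow_le_pow_right₀ (by linarith [norm_nonneg ξ]) hn

lemma WK.contDiff {k : ℕ} {w : E2 → ℂ} (hw : WK k w) : ContDiff ℝ k w := by
  obtain ⟨h, h1, h2, rfl⟩ := hw
  refine Real.contDiff_fourier (N := (k : ℕ∞)) fun n hn => ?_
  exact WK.integrable_pow h1 h2 n (by exact_mod_cast hn)

lemma WK.tendsto {k : ℕ} {w : E2 → ℂ} (hw : WK k w) : Tendsto w (cocompact E2) (𝓝 0) := by
  obtain ⟨h, h1, h2, rfl⟩ := hw
  exact tendsto_integral_exp_inner_smul_cocompact h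

lemma WK.add {k : ℕ} {w z : E2 → ℂ} (hw : WK k w) (hz : WK k z) : WK k (fun x => w x + z x) := by
  obtain ⟨h, h1, h2, rfl⟩ := hw
  obtain ⟨g, g1, g2, rfl⟩ := hz
  refine ⟨fun ξ => h ξ + g ξ, h1.add g1, (h2.add g2).mono' ?_ ?_, ?_⟩
  · exact (((continuous_const.add continuous_norm).pow k).aestronglyMeasurable).mul
      (h1.add g1).aestronglyMeasurable.norm
  · filter_upwards with ξ
    rw [norm_mul, norm_norm, norm_pow, Real.norm_of_nonneg (by positivity)]
    simp only [Pi.add_apply]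
    rw [← mul_add]
    gcongr
    exact norm_add_le _ _
  · ext x
    rw [Real.fourier_eq, Real.fourier_eq, Real.fourier_eq, ← integral_add]
    · simp
    · exact (Real.fourierIntegral_convergent_iff x).2 h1
    · exact (Real.fourierIntegral_convergent_iff x).2 g1

lemma WK.const_mul {k : ℕ} {w : E2 → ℂ} (hw : WK k w) (c : ℂ) : WK k (fun x => c * w x) := by
  obtain ⟨h, h1, h2, rfl⟩ := hw
  refine ⟨fun ξ => c * h ξ, h1.const_mul c, ?_, ?_⟩
  · refine (h2.const_mul ‖c‖).congr ?_
    filter_upwards with ξ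
    rw [norm_mul]; ring
  · ext x
    rw [Real.fourier_eq, Real.fourier_eq, ← integral_const_mul]
    congr 1
    ext v
    simp only [Circle.smul_def, smul_eq_mul]; ring

lemma WK.mul {k : ℕ} {w z : E2 → ℂ} (hw : WK k w) (hz : WK k z) : WK k (fun x => w x * z x) := by
  obtain ⟨h, h1, h2, rfl⟩ := hw
  obtain ⟨g, g1, g2, rfl⟩ := hz
  refine ⟨convolution h g (ContinuousLinearMap.mul ℂ ℂ) volume, h1.integrable_convolution _ g1, ?_, ?_⟩
  · have hc := h2.integrable_convolution (ContinuousLinearMap.mul ℝ ℝ) g2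
    have hae := (h2.ae_convolution_exists (ContinuousLinearMap.mul ℝ ℝ) g2)
    refine hc.mono' ?_ ?_
    · exact (((continuous_const.add continuous_norm).pow k).aestronglyMeasurable).mul
        (h1.integrable_convolution (ContinuousLinearMap.mul ℂ ℂ) g1).aestronglyMeasurable.norm
    · filter_upwards [hae] with ξ hξ
      rw [norm_mul, norm_norm, norm_pow, Real.norm_of_nonneg (by positivity)]
      unfold convolution
      rw [← abs_of_nonneg (show (0:ℝ) ≤ (1 + ‖ξ‖) ^ k by positivity), ← Real.norm_eq_abs]
      calc ‖(1 + ‖ξ‖) ^ k‖ * ‖∫ t, (ContinuousLinearMap.mul ℂ ℂ) (h t) (g (ξ - t))‖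
          = ‖∫ t, ((1 + ‖ξ‖) ^ k : ℝ) • (ContinuousLinearMap.mul ℂ ℂ) (h t) (g (ξ - t))‖ := by
            rw [integral_smul, norm_smul]
        _ ≤ _ := by
            refine norm_integral_le_of_norm_le hξ ?_
            filter_upwards with t
            simp only [ContinuousLinearMap.mul_apply']
            rw [norm_smul, norm_mul, Real.norm_of_nonneg (by positivity)]
            have : (1 + ‖ξ‖) ^ k ≤ (1 + ‖t‖) ^ k * (1 + ‖ξ - t‖) ^ k := by
              rw [← mul_pow]
              gcongr
              have : ‖ξ‖ ≤ ‖t‖ + ‖ξ - t‖ := by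
                simpa using norm_add_le t (ξ - t)
              nlinarith [norm_nonneg t, norm_nonneg (ξ - t)]
            calc _ ≤ (1 + ‖t‖) ^ k * (1 + ‖ξ - t‖) ^ k * (‖h t‖ * ‖g (ξ - t)‖) := by gcongr
              _ = _ := by ring
  · ext x
    rw [Real.fourier_mul_convolution_eq h1 g1]

lemma WK.schwartz (k : ℕ) (φ : 𝓢(E2, ℂ)) : WK k φ := by
  refine ⟨((𝓕⁻ φ : 𝓢(E2, ℂ)) : E2 → ℂ), (𝓕⁻ φ).integrable, ?_, ?_⟩
  · have h1 : ∀ ξ : E2, (1 + ‖ξ‖) ^ k * ‖(𝓕⁻ φ) ξ‖ ≤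
        2 ^ k * ‖(𝓕⁻ φ) ξ‖ + 2 ^ k * (‖ξ‖ ^ k * ‖(𝓕⁻ φ) ξ‖) := by
      intro ξ
      rw [← mul_add, ← one_add_mul, ← mul_assoc]
      gcongr
      rcases le_total ‖ξ‖ 1 with h | h
      · calc (1 + ‖ξ‖) ^ k ≤ 2 ^ k := by gcongr; linarith
          _ ≤ _ := by nlinarith [pow_nonneg (norm_nonneg ξ) k, pow_pos (two_pos (α := ℝ)) k, mul_nonneg (pow_pos (two_pos (α := ℝ)) k).le (pow_nonneg (norm_nonneg ξ) k)]
      · calc (1 + ‖ξ‖) ^ k ≤ (2 * ‖ξ‖) ^ k := by gcongr; linarith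
          _ = 2 ^ k * ‖ξ‖ ^ k := by rw [mul_pow]
          _ ≤ _ := by gcongr; linarith
    refine Integrable.mono' (((𝓕⁻ φ).integrable.norm.const_mul (2 ^ k)).add
      (((𝓕⁻ φ).integrable_pow_mul volume k).const_mul (2 ^ k))) ?_ ?_
    · exact (((continuous_const.add continuous_norm).pow k).mul
        (𝓕⁻ φ).continuous.norm).aestronglyMeasurable
    · filter_upwards with ξ
      rw [Real.norm_of_nonneg (by positivity)]
      exact h1 ξ
  · rw [← SchwartzMap.fourier_coe]
    exact congrArg (fun z : 𝓢(E2, ℂ) => (z : E2 → ℂ)) (FourierTransform.fourier_fourierInv_eq φ).symm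

lemma fourier_lineDeriv (φ : 𝓢(E2, ℂ)) (m ξ : E2) :
    𝓕 (∂_{m} φ) ξ = (2 * π * Complex.I) * ((inner ℝ ξ m : ℝ) : ℂ) * 𝓕 φ ξ := by
  rw [SchwartzMap.fourier_lineDerivOp_eq, smul_apply, SchwartzMap.smulLeftCLM_apply_apply (by fun_prop)]
  simp
  ring

lemma schwartz_bdd_mul {h : E2 → ℂ} (hh : Integrable h) (φ : 𝓢(E2, ℂ)) :
    Integrable (fun ξ => h ξ * φ ξ) := by
  refine (hh.norm.mul_const (SchwartzMap.seminorm ℝ 0 0 φ)).mono'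
    (hh.aestronglyMeasurable.mul φ.continuous.aestronglyMeasurable) ?_
  filter_upwards with ξ
  rw [norm_mul]
  gcongr
  exact SchwartzMap.norm_le_seminorm ℝ φ ξ

lemma WK.bdd {k : ℕ} {w : E2 → ℂ} (hw : WK k w) : ∃ C, ∀ x, ‖w x‖ ≤ C := by
  obtain ⟨h, h1, h2, rfl⟩ := hw
  refine ⟨∫ ξ, ‖h ξ‖, fun x => ?_⟩
  exact VectorFourier.norm_fourierIntegral_le_integral_norm _ _ _ _ _

lemma WK.continuous {k : ℕ} {w : E2 → ℂ} (hw : WK k w) : Continuous w := hw.contDiff.continuous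

lemma WK.mul_integrable {k : ℕ} {w : E2 → ℂ} (hw : WK k w) (φ : 𝓢(E2, ℂ)) :
    Integrable (fun x => w x * φ x) := by
  obtain ⟨C, hC⟩ := hw.bdd
  refine (φ.integrable.norm.const_mul C).mono'
    (hw.continuous.mul φ.continuous).aestronglyMeasurable ?_
  filter_upwards with ξ
  rw [norm_mul]
  gcongr
  exact hC ξ

lemma eq_of_Lop {k : ℕ} {w W : E2 → ℂ} (hw : LocallyIntegrable w)
    (hwi : ∀ φ : 𝓢(E2, ℂ), Integrable (fun x => w x * φ x)) (hW : WK k W)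
    (h : ∀ φ : 𝓢(E2, ℂ), ∫ x, w x * Lop φ x = ∫ x, W x * Lop φ x) : w =ᵐ[volume] W := by
  have := Lop_unique (fun x => w x - W x) (hw.sub hW.continuous.locallyIntegrable) (fun φ => by
    simp_rw [sub_mul]
    rw [integral_sub (hwi _) (hW.mul_integrable _), h, sub_self])
  filter_upwards [this] with x hx
  exact sub_eq_zero.1 hx

lemma gain {k : ℕ} {w : E2 → ℂ} (hw : LocallyIntegrable w)
    (hwi : ∀ φ : 𝓢(E2, ℂ), Integrable (fun x => w x * φ x))
    {G0 : E2 → ℂ} {G : Fin 2 → E2 → ℂ} (hG0 : WK k G0) (hG : ∀ i, WK k (G i))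
    (heq : ∀ φ : 𝓢(E2, ℂ), ∫ x, w x * Lop φ x =
      (∫ x, G0 x * φ x) + ∑ i, ∫ x, G i x * (∂_{e2basis i} φ) x) :
    ∃ W, WK (k + 1) W ∧ w =ᵐ[volume] W := by
  obtain ⟨g0, g01, g02, rfl⟩ := hG0
  choose g g1 g2 g3 using hG
  set c : Fin 2 → E2 → ℂ := fun i ξ => (2 * π * Complex.I) * ((inner ℝ ξ (e2basis i) : ℝ) : ℂ) with hc
  have hcc : ∀ i, Continuous (c i) := fun i => by
    simp only [hc]; fun_prop
  have hcb : ∀ i ξ, ‖c i ξ‖ ≤ 2 * π * ‖ξ‖ := by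
    intro i ξ
    simp only [hc, norm_mul, Complex.norm_I, mul_one, Complex.norm_real, Complex.norm_ofNat]
    rw [Real.norm_of_nonneg pi_pos.le]
    gcongr
    refine (norm_inner_le_norm _ _).trans ?_
    simp [e2basis]
  set h : E2 → ℂ := fun ξ => ((1 + ‖ξ‖ ^ 2 : ℝ) : ℂ)⁻¹ * (g0 ξ + ∑ i, c i ξ * g i ξ) with hh
  have hpos : ∀ ξ : E2, (0:ℝ) < 1 + ‖ξ‖ ^ 2 := fun ξ => by positivity
  have hne : ∀ ξ : E2, ((1 + ‖ξ‖ ^ 2 : ℝ) : ℂ) ≠ 0 := fun ξ => by exact_mod_cast (hpos ξ).ne'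
  have hmeas : AEStronglyMeasurable h := by
    refine AEStronglyMeasurable.mul (Continuous.aestronglyMeasurable ?_) ?_
    · exact Continuous.inv₀ (by fun_prop) hne
    · refine g01.aestronglyMeasurable.add ?_
      refine Finset.aestronglyMeasurable_fun_sum _ fun i _ => ?_
      exact (hcc i).aestronglyMeasurable.mul (g1 i).aestronglyMeasurable
  have hbound : ∀ ξ, (1 + ‖ξ‖) * ‖h ξ‖ ≤ (4 * π) * (‖g0 ξ‖ + ∑ i, ‖g i ξ‖) := by
    intro ξ
    have hn := norm_nonneg ξ
    have e1 : ‖g0 ξ + ∑ i, c i ξ * g i ξ‖ ≤ (1 + 2 * π * ‖ξ‖) * (‖g0 ξ‖ + ∑ i, ‖g i ξ‖) := by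
      calc _ ≤ ‖g0 ξ‖ + ∑ i, ‖c i ξ * g i ξ‖ := (norm_add_le _ _).trans (by gcongr; exact norm_sum_le _ _)
        _ ≤ (1 + 2 * π * ‖ξ‖) * ‖g0 ξ‖ + ∑ i, (1 + 2 * π * ‖ξ‖) * ‖g i ξ‖ := by
          gcongr with i
          · exact le_mul_of_one_le_left (norm_nonneg _) (by nlinarith [pi_pos])
          · rw [norm_mul]; gcongr; linarith [hcb i ξ]
        _ = _ := by rw [← Finset.mul_sum, mul_add]
    have e2 : (1 + ‖ξ‖) * (1 + 2 * π * ‖ξ‖) ≤ 4 * π * (1 + ‖ξ‖ ^ 2) := by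
      nlinarith [pi_gt_three, sq_nonneg (‖ξ‖ - 1), mul_nonneg (sub_nonneg.2 pi_gt_three.le) (sq_nonneg (‖ξ‖ - 1)), mul_nonneg (sub_nonneg.2 pi_gt_three.le) hn]
    simp only [hh, norm_mul, norm_inv, Complex.norm_real]
    rw [Real.norm_of_nonneg (hpos ξ).le]
    calc _ ≤ (1 + ‖ξ‖) * ((1 + ‖ξ‖ ^ 2)⁻¹ * ((1 + 2 * π * ‖ξ‖) * (‖g0 ξ‖ + ∑ i, ‖g i ξ‖))) := by gcongr
      _ = ((1 + ‖ξ‖) * (1 + 2 * π * ‖ξ‖)) * (1 + ‖ξ‖ ^ 2)⁻¹ * (‖g0 ξ‖ + ∑ i, ‖g i ξ‖) := by ring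
      _ ≤ (4 * π * (1 + ‖ξ‖ ^ 2)) * (1 + ‖ξ‖ ^ 2)⁻¹ * (‖g0 ξ‖ + ∑ i, ‖g i ξ‖) := by gcongr
      _ = _ := by field_simp [(hpos ξ).ne']
  have hi2 : Integrable (fun ξ => (1 + ‖ξ‖) ^ (k + 1) * ‖h ξ‖) := by
    have : Integrable (fun ξ => (4 * π) * ((1 + ‖ξ‖) ^ k * ‖g0 ξ‖ + ∑ i, (1 + ‖ξ‖) ^ k * ‖g i ξ‖)) :=
      (g02.add (integrable_finsetSum _ fun i _ => g2 i)).const_mul _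
    refine this.mono' ?_ ?_
    · exact (((continuous_const.add continuous_norm).pow _).aestronglyMeasurable).mul hmeas.norm
    · filter_upwards with ξ
      rw [Real.norm_of_nonneg (by positivity), pow_succ, mul_assoc]
      calc _ ≤ (1 + ‖ξ‖) ^ k * ((4 * π) * (‖g0 ξ‖ + ∑ i, ‖g i ξ‖)) :=
          mul_le_mul_of_nonneg_left (hbound ξ) (by positivity)
        _ = _ := by rw [← Finset.mul_sum]; ring
  have hi : Integrable h := by
    refine hi2.mono' hmeas ?_
    filter_upwards with ξ
    exact le_mul_of_one_le_left (norm_nonneg _) (one_le_pow₀ (by linarith [norm_nonneg ξ]))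
  have hW : WK (k + 1) (𝓕 h) := ⟨h, hi, hi2, rfl⟩
  refine ⟨𝓕 h, hW, eq_of_Lop hw hwi hW fun φ => ?_⟩
  rw [heq, fourier_pair h hi, fourier_pair g0 g01]
  have e3 : ∀ i, ∫ x, G i x * (∂_{e2basis i} φ) x = ∫ ξ, g i ξ * 𝓕 (∂_{e2basis i} φ) ξ := by
    intro i
    rw [g3 i, fourier_pair _ (g1 i)]
  simp_rw [e3]
  rw [← integral_finsetSum _ (fun i _ => schwartz_bdd_mul (g1 i) _),
    ← integral_add (schwartz_bdd_mul g01 _)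
      (integrable_finsetSum _ fun i _ => schwartz_bdd_mul (g1 i) _)]
  congr 1
  ext ξ
  simp only [fourier_Lop, fourier_lineDeriv, hh]
  rw [show ∀ a b d : ℂ, a⁻¹ * b * (a * d) = (a⁻¹ * a) * (b * d) by intros; ring,
    inv_mul_cancel₀ (hne ξ), one_mul, add_mul, Finset.sum_mul]
  congr 1
  refine Finset.sum_congr rfl fun i _ => ?_
  simp only [hc]; ring

lemma gainL2 {w G : E2 → ℂ} (hw : LocallyIntegrable w)
    (hwi : ∀ φ : 𝓢(E2, ℂ), Integrable (fun x => w x * φ x))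
    (hG : MemLp G 2)
    (heq : ∀ φ : 𝓢(E2, ℂ), ∫ x, w x * Lop φ x = ∫ x, G x * φ x) :
    ∃ W, WK 0 W ∧ w =ᵐ[volume] W := by
  set T : Lp ℂ 2 (volume : Measure E2) := 𝓕⁻ (hG.toLp G) with hT
  set h : E2 → ℂ := fun ξ => ((1 + ‖ξ‖ ^ 2 : ℝ) : ℂ)⁻¹ * T ξ with hh
  have hpos : ∀ ξ : E2, (0:ℝ) < 1 + ‖ξ‖ ^ 2 := fun ξ => by positivity
  have hne : ∀ ξ : E2, ((1 + ‖ξ‖ ^ 2 : ℝ) : ℂ) ≠ 0 := fun ξ => by exact_mod_cast (hpos ξ).ne'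
  have hcont : Continuous (fun ξ : E2 => ((1 + ‖ξ‖ ^ 2 : ℝ) : ℂ)⁻¹) := Continuous.inv₀ (by fun_prop) hne
  have hm : MemLp (fun ξ : E2 => ((1 + ‖ξ‖ ^ 2 : ℝ) : ℂ)⁻¹) 2 := by
    rw [memLp_two_iff_integrable_sq_norm hcont.aestronglyMeasurable]
    have := integrable_rpow_neg_one_add_norm_sq (E := E2) (μ := volume) (r := 4) (by simp; norm_num)
    refine this.congr ?_
    filter_upwards with ξ
    rw [norm_inv, Complex.norm_real, Real.norm_of_nonneg (hpos ξ).le, inv_pow,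
      show (-4 / 2 : ℝ) = -((2:ℕ):ℝ) by norm_num, Real.rpow_neg (hpos ξ).le, Real.rpow_natCast]
  have hi : Integrable h := hm.integrable_mul (Lp.memLp T)
  have hW : WK 0 (𝓕 h) := ⟨h, hi, by simpa using hi.norm, rfl⟩
  refine ⟨𝓕 h, hW, eq_of_Lop hw hwi hW fun φ => ?_⟩
  rw [heq, fourier_pair h hi]
  have e1 := Lp.fourier_toTemperedDistribution_eq T
  rw [hT, FourierTransform.fourier_fourierInv_eq, ← hT] at e1
  have e2 := congrArg (fun D => D φ) e1
  simp only [TemperedDistribution.fourier_apply, Lp.toTemperedDistribution_apply, smul_eq_mul] at e2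
  have e3 : ∫ x, φ x * (hG.toLp G) x = ∫ x, G x * φ x := by
    refine integral_congr_ae ?_
    filter_upwards [hG.coeFn_toLp] with x hx
    rw [hx, mul_comm]
  rw [← e3, ← e2]
  congr 1
  ext ξ
  simp only [fourier_Lop, hh]
  rw [show ∀ a b d : ℂ, a⁻¹ * b * (a * d) = (a⁻¹ * a) * (d * b) by intros; ring,
    inv_mul_cancel₀ (hne ξ), one_mul]


lemma one_dim_bound {f f' : ℝ → ℝ} (hd : ∀ x, HasDerivAt f (f' x) x) (hf : Integrable f)
    (hf' : Integrable f') (x : ℝ) : ‖f x‖ₑ ≤ ∫⁻ t, ‖f' t‖ₑ := by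
  have h0 := tendsto_zero_of_hasDerivAt_of_integrableOn_Iic (a := x) (fun y _ => hd y)
    hf'.integrableOn hf.integrableOn
  have h1 := integral_Iic_of_hasDerivAt_of_tendsto' (fun y _ => hd y) hf'.integrableOn h0 (a := x)
  rw [sub_zero] at h1
  rw [← h1]
  exact (enorm_integral_le_lintegral_enorm _).trans (setLIntegral_le_lintegral _ _)

/-- coordinates -/
def Phi (p : ℝ × ℝ) : E2 := !₂[p.1, p.2]

lemma Phi_mp : MeasurePreserving Phi (volume : Measure (ℝ × ℝ)) (volume : Measure E2) := by
  have h1 := (volume_preserving_finTwoArrow ℝ).symm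
  have h2 := (EuclideanSpace.volume_preserving_symm_measurableEquiv_toLp (Fin 2)).symm
  exact h2.comp h1

lemma Phi_emb : MeasurableEmbedding Phi := by
  have h1 := (MeasurableEquiv.finTwoArrow (α := ℝ)).symm.measurableEmbedding
  have h2 := (MeasurableEquiv.toLp 2 (Fin 2 → ℝ)).measurableEmbedding
  exact h2.comp h1

lemma Phi_eq (p : ℝ × ℝ) : Phi p = p.1 • e2basis 0 + p.2 • e2basis 1 := by
  ext i; fin_cases i <;> simp [Phi, e2basis]

lemma norm_e2basis (i : Fin 2) : ‖e2basis i‖ = 1 := by simp [e2basis]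

lemma sq_lintegral_le {w : E2 → ℝ} (hd : Differentiable ℝ w) (hw : Integrable w)
    (hw' : Integrable (fderiv ℝ w)) :
    ∫⁻ x, ‖w x‖ₑ ^ 2 ≤ (∫⁻ x, ‖fderiv ℝ w x‖ₑ) ^ 2 := by
  have hm : Measurable Phi := Phi_mp.measurable
  have hwm : Measurable w := hd.continuous.measurable
  have hDm : Measurable (fderiv ℝ w) := measurable_fderiv ℝ w
  rw [← Phi_mp.lintegral_comp_emb Phi_emb, ← Phi_mp.lintegral_comp_emb Phi_emb]
  have i1 : Integrable (fun p : ℝ × ℝ => w (Phi p)) (volume.prod volume) :=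
    (Phi_mp.integrable_comp_emb Phi_emb).2 hw
  have i2 : Integrable (fun p : ℝ × ℝ => fderiv ℝ w (Phi p)) (volume.prod volume) :=
    (Phi_mp.integrable_comp_emb Phi_emb).2 hw'
  set D : ℝ × ℝ → ℝ≥0∞ := fun p => ‖fderiv ℝ w (Phi p)‖ₑ with hD
  have hDmeas : Measurable D := (hDm.comp hm).enorm
  have dle : ∀ p i, ‖fderiv ℝ w (Phi p) (e2basis i)‖ₑ ≤ D p := by
    intro p i
    rw [hD, enorm_le_iff_norm_le]
    simpa [norm_e2basis] using (fderiv ℝ w (Phi p)).le_opNorm (e2basis i)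
  have B : ∀ᵐ x : ℝ, ∀ y, ‖w (Phi (x, y))‖ₑ ≤ ∫⁻ t, D (x, t) := by
    filter_upwards [i1.prod_right_ae, i2.prod_right_ae] with x h1 h2 y
    have hd1 : ∀ y, HasDerivAt (fun y => w (Phi (x, y))) (fderiv ℝ w (Phi (x, y)) (e2basis 1)) y := by
      intro y
      refine (hd _).hasFDerivAt.comp_hasDerivAt y ?_
      simp only [Phi_eq]
      simpa using ((hasDerivAt_id y).smul_const (e2basis 1)).const_add (x • e2basis 0)
    refine (one_dim_bound hd1 h1 ?_ y).trans (lintegral_mono fun t => dle _ _)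
    exact h2.apply_continuousLinearMap _
  have A : ∀ᵐ y : ℝ, ∀ x, ‖w (Phi (x, y))‖ₑ ≤ ∫⁻ t, D (t, y) := by
    filter_upwards [i1.prod_left_ae, i2.prod_left_ae] with y h1 h2 x
    have hd1 : ∀ x, HasDerivAt (fun x => w (Phi (x, y))) (fderiv ℝ w (Phi (x, y)) (e2basis 0)) x := by
      intro x
      refine (hd _).hasFDerivAt.comp_hasDerivAt x ?_
      simp only [Phi_eq]
      simpa using ((hasDerivAt_id x).smul_const (e2basis 0)).add_const (y • e2basis 1)
    refine (one_dim_bound hd1 h1 ?_ x).trans (lintegral_mono fun t => dle _ _)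
    exact h2.apply_continuousLinearMap _
  have hBm : Measurable fun x : ℝ => ∫⁻ t, D (x, t) := hDmeas.lintegral_prod_right'
  have hAm : Measurable fun y : ℝ => ∫⁻ t, D (t, y) := hDmeas.lintegral_prod_left'
  calc ∫⁻ p : ℝ × ℝ, ‖w (Phi p)‖ₑ ^ 2
      = ∫⁻ x : ℝ, ∫⁻ y : ℝ, ‖w (Phi (x, y))‖ₑ ^ 2 :=
        lintegral_prod _ ((hwm.comp hm).enorm.pow_const 2).aemeasurable
    _ ≤ ∫⁻ x : ℝ, ∫⁻ y : ℝ, (∫⁻ t, D (x, t)) * (∫⁻ t, D (t, y)) := by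
        refine lintegral_mono_ae ?_
        filter_upwards [B] with x hx
        refine lintegral_mono_ae ?_
        filter_upwards [A] with y hy
        rw [sq]
        exact mul_le_mul' (hx y) (hy x)
    _ = (∫⁻ x : ℝ, ∫⁻ t, D (x, t)) * ∫⁻ y : ℝ, ∫⁻ t, D (t, y) := by
        simp_rw [lintegral_const_mul _ hAm]
        rw [lintegral_mul_const _ hBm]
    _ = _ := by
        rw [sq]
        congr 1
        · exact (lintegral_prod _ hDmeas.aemeasurable).symm
        · exact (lintegral_prod_symm _ hDmeas.aemeasurable).symm

lemma sq_integral_le {w : E2 → ℝ} (hd : Differentiable ℝ w) (hw : Integrable w)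
    (hw' : Integrable (fderiv ℝ w)) :
    Integrable (fun x => w x ^ 2) ∧ ∫ x, w x ^ 2 ≤ (∫ x, ‖fderiv ℝ w x‖) ^ 2 := by
  have h := sq_lintegral_le hd hw hw'
  have e : ∀ x, ‖w x‖ₑ ^ 2 = ‖w x ^ 2‖ₑ := fun x => by rw [enorm_pow]
  simp_rw [e] at h
  rw [← ofReal_integral_norm_eq_lintegral_enorm hw', ← ENNReal.ofReal_pow (by positivity)] at h
  have hi : Integrable (fun x => w x ^ 2) :=
    ⟨(hd.continuous.pow 2).aestronglyMeasurable, h.trans_lt ENNReal.ofReal_lt_top⟩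
  refine ⟨hi, ?_⟩
  rw [← ofReal_integral_norm_eq_lintegral_enorm hi,
    ENNReal.ofReal_le_ofReal_iff (by positivity)] at h
  refine le_trans (le_of_eq ?_) h
  congr 1; ext x; rw [Real.norm_of_nonneg (by positivity)]

lemma scalar_L4L6 {v : E2 → ℝ} (hd : Differentiable ℝ v) (h2 : Integrable (fun x => v x ^ 2))
    (hD : Integrable (fun x => ‖fderiv ℝ v x‖ ^ 2)) {M : ℝ}
    (hM : ∫ x, v x ^ 2 + ‖fderiv ℝ v x‖ ^ 2 ≤ M) :
    Integrable (fun x => v x ^ 4) ∧ Integrable (fun x => v x ^ 6) ∧ ∫ x, v x ^ 4 ≤ M ^ 2 ∧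
      ∫ x, v x ^ 6 ≤ (2 * (M ^ 2 + M)) ^ 2 := by
  have hcv := hd.continuous
  have hDm : Measurable (fderiv ℝ v) := measurable_fderiv ℝ v
  have f2 : ∀ x, fderiv ℝ (fun x => v x ^ 2) x = (2 * v x) • fderiv ℝ v x := by
    intro x
    have := ((hd x).hasFDerivAt.pow 2).fderiv
    simpa using this
  have f3 : ∀ x, fderiv ℝ (fun x => v x ^ 3) x = (3 * v x ^ 2) • fderiv ℝ v x := by
    intro x
    have := ((hd x).hasFDerivAt.pow 3).fderiv
    simpa using this
  have M0 : 0 ≤ ∫ x, v x ^ 2 + ‖fderiv ℝ v x‖ ^ 2 := integral_nonneg fun x => by positivity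
  have b2 : ∀ x, ‖fderiv ℝ (fun x => v x ^ 2) x‖ ≤ v x ^ 2 + ‖fderiv ℝ v x‖ ^ 2 := by
    intro x
    rw [f2, norm_smul, norm_mul, Real.norm_eq_abs, Real.norm_eq_abs, abs_two, ← sq_abs (v x)]
    nlinarith [sq_nonneg (|v x| - ‖fderiv ℝ v x‖)]
  have i2 : Integrable (fderiv ℝ (fun x => v x ^ 2)) :=
    (h2.add hD).mono' (measurable_fderiv ℝ _).aestronglyMeasurable (Eventually.of_forall b2)
  obtain ⟨k4, l4⟩ := sq_integral_le (w := fun x => v x ^ 2) (hd.pow 2) h2 i2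
  have e4 : ∀ x, (v x ^ 2) ^ 2 = v x ^ 4 := fun x => by ring
  simp only [e4] at k4 l4
  have l4' : ∫ x, v x ^ 4 ≤ M ^ 2 := by
    refine l4.trans ?_
    gcongr
    exact (integral_mono i2.norm (h2.add hD) b2).trans hM
  have b3 : ∀ x, ‖fderiv ℝ (fun x => v x ^ 3) x‖ ≤ 2 * (v x ^ 4 + ‖fderiv ℝ v x‖ ^ 2) := by
    intro x
    rw [f3, norm_smul, Real.norm_of_nonneg (by positivity)]
    nlinarith [sq_nonneg (v x ^ 2 - ‖fderiv ℝ v x‖), sq_nonneg (v x ^ 2), sq_nonneg ‖fderiv ℝ v x‖]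
  have i3 : Integrable (fderiv ℝ (fun x => v x ^ 3)) :=
    ((k4.add hD).const_mul 2).mono' (measurable_fderiv ℝ _).aestronglyMeasurable (Eventually.of_forall b3)
  have j3 : Integrable (fun x => v x ^ 3) := by
    refine (h2.add k4).mono' (hcv.pow 3).aestronglyMeasurable (Eventually.of_forall fun x => ?_)
    rw [norm_pow, Real.norm_eq_abs]
    simp only [Pi.add_apply]
    rw [← Even.pow_abs (by decide : Even 2) (v x), ← Even.pow_abs (by decide : Even 4) (v x)]
    nlinarith [sq_nonneg (|v x| - |v x| ^ 2), abs_nonneg (v x), sq_nonneg (|v x|), sq_nonneg (|v x| ^ 2)]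
  obtain ⟨k6, l6⟩ := sq_integral_le (w := fun x => v x ^ 3) (hd.pow 3) j3 i3
  have e6 : ∀ x, (v x ^ 3) ^ 2 = v x ^ 6 := fun x => by ring
  simp only [e6] at k6 l6
  refine ⟨k4, k6, l4', l6.trans ?_⟩
  gcongr
  refine (integral_mono i3.norm ((k4.add hD).const_mul 2) b3).trans ?_
  rw [integral_const_mul, integral_add' k4 hD]
  have : ∫ x, ‖fderiv ℝ v x‖ ^ 2 ≤ M := by
    refine le_trans ?_ hM
    refine integral_mono hD (h2.add hD) fun x => ?_
    simp only [Pi.add_apply]; nlinarith [sq_nonneg (v x)]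
  linarith

lemma MemH1.sq {u : E2 → E2} (hu : MemH1 u) : Integrable (fun x => ‖u x‖ ^ 2) :=
  (memLp_two_iff_integrable_sq_norm hu.2.1.1).1 hu.2.1

lemma MemH1.dsq {u : E2 → E2} (hu : MemH1 u) : Integrable (fun x => ‖fderiv ℝ u x‖ ^ 2) :=
  (memLp_two_iff_integrable_sq_norm hu.2.2.1).1 hu.2.2

lemma MemH1.fderiv_comp {u : E2 → E2} (hd : Differentiable ℝ u) (j : Fin 2) (x : E2) :
    fderiv ℝ (fun x => u x j) x = (EuclideanSpace.proj j : E2 →L[ℝ] ℝ).comp (fderiv ℝ u x) :=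
  ((EuclideanSpace.proj j : E2 →L[ℝ] ℝ).hasFDerivAt.comp x (hd x).hasFDerivAt).fderiv

lemma norm_coord_le (y : E2) (j : Fin 2) : |y j| ≤ ‖y‖ := by
  simpa using PiLp.norm_apply_le y j

lemma norm_sq_coord (y : E2) : ‖y‖ ^ 2 = y 0 ^ 2 + y 1 ^ 2 := by
  rw [EuclideanSpace.norm_sq_eq]; simp

lemma H1_L4L6 {u : E2 → E2} (hu : MemH1 u) {M : ℝ}
    (hM : ∫ x, ‖u x‖ ^ 2 + ‖fderiv ℝ u x‖ ^ 2 ≤ M) :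
    Integrable (fun x => ‖u x‖ ^ 4) ∧ Integrable (fun x => ‖u x‖ ^ 6) ∧
      ∫ x, ‖u x‖ ^ 4 ≤ 4 * M ^ 2 ∧ ∫ x, ‖u x‖ ^ 6 ≤ 8 * (2 * (M ^ 2 + M)) ^ 2 := by
  have hd := hu.1
  have hcu := hd.continuous
  have hcd : ∀ j : Fin 2, Differentiable ℝ (fun x => u x j) := fun j =>
    (EuclideanSpace.proj j : E2 →L[ℝ] ℝ).differentiable.comp hd
  have b1 : ∀ (j : Fin 2) x, u x j ^ 2 ≤ ‖u x‖ ^ 2 := fun j x => by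
    rw [← sq_abs]; gcongr; exact norm_coord_le _ _
  have b2 : ∀ (j : Fin 2) x, ‖fderiv ℝ (fun x => u x j) x‖ ^ 2 ≤ ‖fderiv ℝ u x‖ ^ 2 := fun j x => by
    gcongr
    rw [MemH1.fderiv_comp hd]
    refine ContinuousLinearMap.opNorm_le_bound _ (norm_nonneg _) fun y => ?_
    refine le_trans ?_ ((fderiv ℝ u x).le_opNorm y)
    simpa using norm_coord_le _ _
  have i1 : ∀ j : Fin 2, Integrable (fun x => u x j ^ 2) := fun j =>
    hu.sq.mono' ((hcd j).continuous.pow 2).aestronglyMeasurable (Eventually.of_forall fun x => by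
      rw [Real.norm_of_nonneg (by positivity)]; exact b1 j x)
  have i2 : ∀ j : Fin 2, Integrable (fun x => ‖fderiv ℝ (fun x => u x j) x‖ ^ 2) := fun j =>
    hu.dsq.mono' ((measurable_fderiv ℝ _).norm.pow_const 2).aestronglyMeasurable
      (Eventually.of_forall fun x => by
        rw [Real.norm_of_nonneg (by positivity)]; exact b2 j x)
  have key := fun j : Fin 2 => scalar_L4L6 (hcd j) (i1 j) (i2 j) (M := M) (by
    refine le_trans (integral_mono ((i1 j).add (i2 j)) (hu.sq.add hu.dsq) fun x => ?_) hM
    exact add_le_add (b1 j x) (b2 j x))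
  have c4 : ∀ x, ‖u x‖ ^ 4 ≤ 2 * (u x 0 ^ 4 + u x 1 ^ 4) := fun x => by
    have : ‖u x‖ ^ 4 = (‖u x‖ ^ 2) ^ 2 := by ring
    rw [this, norm_sq_coord]
    nlinarith [sq_nonneg (u x 0 ^ 2 - u x 1 ^ 2)]
  have c6 : ∀ x, ‖u x‖ ^ 6 ≤ 4 * (u x 0 ^ 6 + u x 1 ^ 6) := fun x => by
    have : ‖u x‖ ^ 6 = (‖u x‖ ^ 2) ^ 3 := by ring
    rw [this, norm_sq_coord]
    have h0 : 0 ≤ u x 0 ^ 2 := by positivity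
    have h1 : 0 ≤ u x 1 ^ 2 := by positivity
    have : u x 0 ^ 6 = (u x 0 ^ 2) ^ 3 := by ring
    rw [this]
    have : u x 1 ^ 6 = (u x 1 ^ 2) ^ 3 := by ring
    rw [this]
    nlinarith [mul_nonneg (add_nonneg h0 h1) (sq_nonneg (u x 0 ^ 2 - u x 1 ^ 2))]
  have I4 := (((key 0).1).add ((key 1).1)).const_mul 2
  have I6 := (((key 0).2.1).add ((key 1).2.1)).const_mul 4
  have J4 : Integrable (fun x => ‖u x‖ ^ 4) :=
    I4.mono' (hcu.norm.pow 4).aestronglyMeasurable (Eventually.of_forall fun x => by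
      rw [Real.norm_of_nonneg (by positivity)]; exact c4 x)
  have J6 : Integrable (fun x => ‖u x‖ ^ 6) :=
    I6.mono' (hcu.norm.pow 6).aestronglyMeasurable (Eventually.of_forall fun x => by
      rw [Real.norm_of_nonneg (by positivity)]; exact c6 x)
  refine ⟨J4, J6, ?_, ?_⟩
  · refine (integral_mono J4 I4 c4).trans ?_
    rw [integral_const_mul]
    simp only [Pi.add_apply]
    rw [integral_add (key 0).1 (key 1).1]
    linarith [(key 0).2.2.1, (key 1).2.2.1]
  · refine (integral_mono J6 I6 c6).trans ?_
    rw [integral_const_mul]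
    simp only [Pi.add_apply]
    rw [integral_add (key 0).2.1 (key 1).2.1]
    linarith [(key 0).2.2.2, (key 1).2.2.2]


lemma weak_subseq {H : Type*} [NormedAddCommGroup H] [InnerProductSpace ℝ H] [CompleteSpace H]
    [TopologicalSpace.SeparableSpace H] (x : ℕ → H) {C : ℝ} (hb : ∀ n, ‖x n‖ ≤ C) :
    ∃ y : H, ∃ s : ℕ → ℕ, StrictMono s ∧
      ∀ z, Tendsto (fun n => inner ℝ (x (s n)) z) atTop (𝓝 (inner ℝ y z)) := by
  have hc := WeakDual.isSeqCompact_closedBall ℝ H (0 : StrongDual ℝ H) C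
  obtain ⟨L, _, s, hs, ht⟩ := hc (x := fun n => StrongDual.toWeakDual (InnerProductSpace.toDual ℝ H (x n)))
    (fun n => by simpa using hb n)
  refine ⟨(InnerProductSpace.toDual ℝ H).symm (WeakDual.toStrongDual L), s, hs, fun z => ?_⟩
  have h2 := ((WeakDual.eval_continuous z).tendsto L).comp ht
  have e : inner ℝ ((InnerProductSpace.toDual ℝ H).symm (WeakDual.toStrongDual L)) z = L z := by
    rw [InnerProductSpace.toDual_symm_apply]; rfl
  rw [e]
  exact h2

lemma weak_family {ι : Type} [Fintype ι] [DecidableEq ι] (g : ι → ℕ → E2 → ℝ)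
    (hg : ∀ i n, MemLp (g i n) 2 volume) {C : ℝ} (hC : ∀ i n, ∫ x, g i n x ^ 2 ≤ C) :
    ∃ s : ℕ → ℕ, StrictMono s ∧ ∃ G : ι → E2 → ℝ, (∀ i, MemLp (G i) 2 volume) ∧
      ∀ i (h : E2 → ℝ), MemLp h 2 volume →
        Tendsto (fun n => ∫ x, g i (s n) x * h x) atTop (𝓝 (∫ x, G i x * h x)) := by
  have hn : ∀ i n, ‖(hg i n).toLp (g i n)‖ ^ 2 ≤ C := by
    intro i n
    refine le_trans (le_of_eq ?_) (hC i n)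
    rw [← real_inner_self_eq_norm_sq, L2.inner_def]
    refine integral_congr_ae ?_
    filter_upwards [(hg i n).coeFn_toLp] with x hx
    rw [hx]; simp [sq]
  let X : ℕ → PiLp 2 (fun _ : ι => Lp ℝ 2 (volume : Measure E2)) := fun n =>
    WithLp.toLp 2 fun i => (hg i n).toLp (g i n)
  have hX : ∀ n, ‖X n‖ ≤ √(∑ i : ι, C) := by
    intro n
    rw [PiLp.norm_eq_of_L2]
    exact Real.sqrt_le_sqrt (Finset.sum_le_sum fun i _ => hn i n)
  haveI : Fact ((2:ℝ≥0∞) ≠ ⊤) := ⟨by norm_num⟩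
  haveI i1 : SecondCountableTopology (Lp ℝ 2 (volume : Measure E2)) := Lp.SecondCountableTopology
  haveI i2 : TopologicalSpace.SeparableSpace (PiLp 2 (fun _ : ι => Lp ℝ 2 (volume : Measure E2))) :=
    (PiLp.homeomorph 2 (fun _ : ι => Lp ℝ 2 (volume : Measure E2))).symm.surjective.denseRange.separableSpace
      (PiLp.homeomorph 2 (fun _ : ι => Lp ℝ 2 (volume : Measure E2))).symm.continuous
  obtain ⟨y, s, hs, ht⟩ := weak_subseq X hX
  refine ⟨s, hs, fun i => y i, fun i => Lp.memLp _, fun i h hh => ?_⟩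
  have := ht (WithLp.toLp 2 (Pi.single i (hh.toLp h)))
  have e : ∀ (v : PiLp 2 (fun _ : ι => Lp ℝ 2 (volume : Measure E2))),
      inner ℝ v (WithLp.toLp 2 (Pi.single i (hh.toLp h))) = ∫ x, v i x * h x := by
    intro v
    rw [PiLp.inner_apply, Finset.sum_eq_single i]
    · simp only [Pi.single_eq_same]
      rw [L2.inner_def]
      refine integral_congr_ae ?_
      filter_upwards [hh.coeFn_toLp] with x hx
      rw [hx]; simp [mul_comm]
    · intro b _ hb
      simp [Pi.single_eq_of_ne hb]
    · simp
  simp only [e] at this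
  refine this.congr fun n => ?_
  refine integral_congr_ae ?_
  filter_upwards [(hg i (s n)).coeFn_toLp] with x hx
  simp only [X, hx]

lemma plancherel {w : E2 → ℂ} (h1 : Integrable w) (h2 : MemLp w 2 volume) :
    MemLp (𝓕 w) 2 volume ∧ ∫ x, ‖𝓕 w x‖ ^ 2 = ∫ x, ‖w x‖ ^ 2 := by
  set T := h2.toLp w with hT
  have hcont : Continuous (𝓕 w) := by
    exact VectorFourier.fourierIntegral_continuous Real.continuous_fourierChar continuous_inner h1
  have key : 𝓕 w =ᵐ[volume] (𝓕 T : Lp ℂ 2 (volume : Measure E2)) := by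
    have hl : LocallyIntegrable (fun x => 𝓕 w x - (𝓕 T : Lp ℂ 2 (volume : Measure E2)) x) :=
      hcont.locallyIntegrable.sub ((Lp.memLp (𝓕 T)).locallyIntegrable (by norm_num))
    have := ae_eq_zero_of_integral_contDiff_smul_eq_zero hl ?_
    · filter_upwards [this] with x hx
      exact sub_eq_zero.1 hx
    intro g hg hc
    have hc' : HasCompactSupport (fun x => (g x : ℂ)) := hc.comp_left (g := fun r : ℝ => (r : ℂ)) (by simp)
    have hg' : ContDiff ℝ (⊤ : ℕ∞) (fun x => (g x : ℂ)) := Complex.ofRealCLM.contDiff.comp hg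
    set φ := hc'.toSchwartzMap hg' with hφ
    have e1 := congrArg (fun D => D φ) (Lp.fourier_toTemperedDistribution_eq T)
    simp only [TemperedDistribution.fourier_apply, Lp.toTemperedDistribution_apply, smul_eq_mul] at e1
    have e2 := fourier_pair w h1 φ
    have e3 : ∫ x, 𝓕 φ x * T x = ∫ x, w x * 𝓕 φ x := by
      refine integral_congr_ae ?_
      filter_upwards [h2.coeFn_toLp] with x hx
      rw [hx, mul_comm]
    rw [e3, ← e2] at e1
    have ia : Integrable (fun x => 𝓕 w x * φ x) := by
      have := (WK.mul_integrable (k := 0) ⟨w, h1, by simpa using h1.norm, rfl⟩ φ)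
      exact this
    have ib : Integrable (fun x => φ x * (𝓕 T : Lp ℂ 2 (volume : Measure E2)) x) :=
      (φ.memLp 2 volume).integrable_mul (Lp.memLp (𝓕 T))
    have : ∀ x, g x • (𝓕 w x - (𝓕 T : Lp ℂ 2 (volume : Measure E2)) x) =
        𝓕 w x * φ x - φ x * (𝓕 T : Lp ℂ 2 (volume : Measure E2)) x := by
      intro x
      simp [hφ]; ring
    simp_rw [this]
    rw [integral_sub ia ib, e1, sub_self]
  have m : MemLp (𝓕 w) 2 volume := (memLp_congr_ae key).2 (Lp.memLp (𝓕 T))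
  refine ⟨m, ?_⟩
  have n1 : ∀ S : Lp ℂ 2 (volume : Measure E2), ‖S‖ ^ 2 = ∫ x, ‖S x‖ ^ 2 := by
    intro S
    have h := @inner_self_eq_norm_sq_to_K ℂ _ _ _ _ S
    rw [L2.inner_def] at h
    simp only [inner_self_eq_norm_sq_to_K] at h
    have : (((∫ x, ‖S x‖ ^ 2 : ℝ)) : ℂ) = ((‖S‖ ^ 2 : ℝ) : ℂ) := by
      rw [← integral_complex_ofReal]; push_cast; exact h
    exact_mod_cast this.symm
  have a1 := n1 T
  have a2 := n1 (𝓕 T)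
  rw [Lp.norm_fourier_eq, a1] at a2
  have a3 : ∫ x, ‖T x‖ ^ 2 = ∫ x, ‖w x‖ ^ 2 := integral_congr_ae (by
      filter_upwards [h2.coeFn_toLp] with x hx
      rw [hx])
  rw [← a3, a2]
  refine integral_congr_ae ?_
  filter_upwards [key] with x hx
  rw [hx]


lemma tail_conv {g : ℕ → E2 → ℂ} {g0 : E2 → ℂ} (hm : ∀ n, Measurable (g n)) (hm0 : Measurable g0)
    {C : ℝ} (hC : ∀ n ξ, ‖g n ξ‖ ≤ C) (hlim : ∀ ξ, Tendsto (fun n => g n ξ) atTop (𝓝 (g0 ξ)))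
    {K : ℝ} (hK : ∀ n, ∫⁻ ξ : E2, ‖ξ‖ₑ ^ 2 * ‖g n ξ‖ₑ ^ 2 ≤ ENNReal.ofReal K) :
    Tendsto (fun n => ∫⁻ ξ, ‖g n ξ - g0 ξ‖ₑ ^ 2) atTop (𝓝 0) := by
  have hC0 : ∀ ξ, ‖g0 ξ‖ ≤ C := fun ξ => le_of_tendsto' (hlim ξ).norm fun n => hC n ξ
  have hF : ∫⁻ ξ : E2, ‖ξ‖ₑ ^ 2 * ‖g0 ξ‖ₑ ^ 2 ≤ ENNReal.ofReal K := by
    have e : ∀ ξ : E2, ‖ξ‖ₑ ^ 2 * ‖g0 ξ‖ₑ ^ 2 = liminf (fun n => ‖ξ‖ₑ ^ 2 * ‖g n ξ‖ₑ ^ 2) atTop := by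
      intro ξ
      symm
      apply Tendsto.liminf_eq
      refine ENNReal.Tendsto.const_mul ?_ (Or.inr (by simp))
      exact ((ENNReal.continuous_pow 2).tendsto _).comp (hlim ξ).enorm
    simp_rw [e]
    refine (lintegral_liminf_le fun n => ?_).trans ?_
    · exact (measurable_enorm.pow_const 2).mul ((hm n).enorm.pow_const 2)
    · exact Filter.liminf_le_of_frequently_le' (Frequently.of_forall hK)
  have hD : ∀ n, ∫⁻ ξ : E2, ‖ξ‖ₑ ^ 2 * ‖g n ξ - g0 ξ‖ₑ ^ 2 ≤ 4 * ENNReal.ofReal K := by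
    intro n
    have hp : ∀ ξ : E2, ‖ξ‖ₑ ^ 2 * ‖g n ξ - g0 ξ‖ₑ ^ 2 ≤
        2 * (‖ξ‖ₑ ^ 2 * ‖g n ξ‖ₑ ^ 2) + 2 * (‖ξ‖ₑ ^ 2 * ‖g0 ξ‖ₑ ^ 2) := by
      intro ξ
      have h1 : ‖g n ξ - g0 ξ‖ₑ ^ 2 ≤ 2 * ‖g n ξ‖ₑ ^ 2 + 2 * ‖g0 ξ‖ₑ ^ 2 := by
        simp only [← ofReal_norm]
        have : (2:ℝ≥0∞) = ENNReal.ofReal 2 := by simp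
        rw [this, ← ENNReal.ofReal_pow (by positivity), ← ENNReal.ofReal_pow (by positivity),
          ← ENNReal.ofReal_pow (by positivity), ← ENNReal.ofReal_mul (by positivity),
          ← ENNReal.ofReal_mul (by positivity), ← ENNReal.ofReal_add (by positivity) (by positivity)]
        apply ENNReal.ofReal_le_ofReal
        have := norm_sub_le (g n ξ) (g0 ξ)
        nlinarith [norm_nonneg (g n ξ - g0 ξ), sq_nonneg (‖g n ξ‖ - ‖g0 ξ‖)]
      calc _ ≤ ‖ξ‖ₑ ^ 2 * (2 * ‖g n ξ‖ₑ ^ 2 + 2 * ‖g0 ξ‖ₑ ^ 2) := by gcongr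
        _ = _ := by ring
    refine (lintegral_mono hp).trans ?_
    have m1 : Measurable fun ξ : E2 => ‖ξ‖ₑ ^ 2 * ‖g n ξ‖ₑ ^ 2 :=
      (measurable_enorm.pow_const 2).mul ((hm n).enorm.pow_const 2)
    have m2 : Measurable fun ξ : E2 => ‖ξ‖ₑ ^ 2 * ‖g0 ξ‖ₑ ^ 2 :=
      (measurable_enorm.pow_const 2).mul (hm0.enorm.pow_const 2)
    rw [lintegral_add_left (m1.const_mul 2), lintegral_const_mul _ m1, lintegral_const_mul _ m2]
    calc _ ≤ 2 * ENNReal.ofReal K + 2 * ENNReal.ofReal K := by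
          gcongr
          exact hK n
      _ = _ := by ring
  have hmm : ∀ n, Measurable fun ξ => ‖g n ξ - g0 ξ‖ₑ ^ 2 := fun n =>
    ((hm n).sub hm0).enorm.pow_const 2
  rw [ENNReal.tendsto_nhds_zero]
  intro η hη
  obtain ⟨R, hR0, hR⟩ : ∃ R : ℝ, 0 < R ∧ 4 * ENNReal.ofReal K / ENNReal.ofReal R ^ 2 ≤ η / 2 := by
    have : Tendsto (fun R : ℝ => 4 * ENNReal.ofReal K / ENNReal.ofReal R ^ 2) atTop (𝓝 0) := by
      have h1 : Tendsto (fun R : ℝ => ENNReal.ofReal R ^ 2) atTop (𝓝 ⊤) := by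
        have := ((ENNReal.continuous_pow 2).tendsto ⊤).comp ENNReal.tendsto_ofReal_atTop
        simpa [Function.comp_def] using this
      have := ENNReal.Tendsto.const_div h1 (Or.inr (show (4 * ENNReal.ofReal K) ≠ ⊤ by finiteness))
      simpa using this
    have h2 := (ENNReal.tendsto_nhds_zero.1 this (η / 2) (ENNReal.half_pos hη.ne'))
    obtain ⟨R, h, h'⟩ := (h2.and (eventually_gt_atTop 0)).exists
    exact ⟨R, h', h⟩
  have hball : Tendsto (fun n => ∫⁻ ξ in Metric.ball (0:E2) R, ‖g n ξ - g0 ξ‖ₑ ^ 2) atTop (𝓝 0) := by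
    have := tendsto_lintegral_of_dominated_convergence (μ := volume.restrict (Metric.ball (0:E2) R))
      (F := fun n ξ => ‖g n ξ - g0 ξ‖ₑ ^ 2) (f := fun _ => 0) (fun _ => ENNReal.ofReal (2 * C) ^ 2)
      (fun n => ((hm n).sub hm0).enorm.pow_const 2) (fun n => ?_) ?_ ?_
    · simpa using this
    · filter_upwards with ξ
      gcongr
      rw [← ofReal_norm]
      apply ENNReal.ofReal_le_ofReal
      linarith [norm_sub_le (g n ξ) (g0 ξ), hC n ξ, hC0 ξ]
    · rw [lintegral_const, Measure.restrict_apply_univ]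
      exact ENNReal.mul_ne_top (by finiteness) measure_ball_lt_top.ne
    · filter_upwards with ξ
      have h0 : Tendsto (fun n => g n ξ - g0 ξ) atTop (𝓝 0) := by
        simpa using (hlim ξ).sub_const (g0 ξ)
      have := ((ENNReal.continuous_pow 2).tendsto _).comp h0.enorm
      simpa [Function.comp_def] using this
  filter_upwards [ENNReal.tendsto_nhds_zero.1 hball (η / 2) (ENNReal.half_pos hη.ne')] with n hn
  rw [← lintegral_add_compl _ (measurableSet_ball (x := (0:E2)) (ε := R)), ← ENNReal.add_halves η]
  refine add_le_add hn (le_trans ?_ hR)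
  rw [ENNReal.le_div_iff_mul_le (Or.inl (by simp [hR0])) (Or.inl (by finiteness)),
    ← lintegral_mul_const _ (hmm n)]
  refine le_trans (le_trans (setLIntegral_mono' measurableSet_ball.compl fun ξ hξ => ?_)
    (setLIntegral_le_lintegral _ _)) (hD n)
  rw [mul_comm]
  gcongr
  rw [← ofReal_norm]
  apply ENNReal.ofReal_le_ofReal
  simpa using hξ

lemma fourier_grad_bound {z : E2 → ℝ} (hd : Differentiable ℝ z) (h1 : Integrable z)
    (h1' : Integrable (fderiv ℝ z)) (h2' : MemLp (fderiv ℝ z) 2 volume) :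
    ∫⁻ ξ : E2, ‖ξ‖ₑ ^ 2 * ‖𝓕 (fun x => (z x : ℂ)) ξ‖ₑ ^ 2 ≤
      ENNReal.ofReal (2 * ∫ x, ‖fderiv ℝ z x‖ ^ 2) := by
  set Z : E2 → ℂ := fun x => (z x : ℂ) with hZ
  have hZi : Integrable Z := h1.ofReal
  have hZf : ∀ x, HasFDerivAt Z (Complex.ofRealCLM.comp (fderiv ℝ z x)) x := fun x =>
    Complex.ofRealCLM.hasFDerivAt.comp x (hd x).hasFDerivAt
  have hZf' : fderiv ℝ Z = fun x => Complex.ofRealCLM.comp (fderiv ℝ z x) := by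
    ext1 x; exact (hZf x).fderiv
  have hZD : Integrable (fderiv ℝ Z) := by
    rw [hZf']
    refine h1'.norm.mono' ?_ ?_
    · exact (Measurable.aestronglyMeasurable (by rw [← hZf']; exact measurable_fderiv ℝ Z))
    · filter_upwards with x
      refine (ContinuousLinearMap.opNorm_comp_le _ _).trans ?_
      simp
  have hF := Real.fourier_fderiv hZi (fun x => (hZf x).differentiableAt) hZD
  set P : Fin 2 → E2 → ℂ := fun i x => ((fderiv ℝ z x (e2basis i) : ℝ) : ℂ) with hP
  have hPn : ∀ i x, ‖P i x‖ ≤ ‖fderiv ℝ z x‖ := by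
    intro i x
    simp only [hP, Complex.norm_real]
    simpa [norm_e2basis] using (fderiv ℝ z x).le_opNorm (e2basis i)
  have hPi : ∀ i, Integrable (P i) := fun i => (h1'.apply_continuousLinearMap _).ofReal
  have hPm : ∀ i, MemLp (P i) 2 volume := fun i =>
    h2'.norm.mono' (hPi i).aestronglyMeasurable (Eventually.of_forall (hPn i))
  have hPF : ∀ i ξ, ‖𝓕 (P i) ξ‖ = 2 * π * |ξ i| * ‖𝓕 Z ξ‖ := by
    intro i ξ
    have e : P i = fun x => (fderiv ℝ Z x) (e2basis i) := by
      ext1 x; rw [hZf']; simp [hP]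
    rw [e, ← Real.fourier_continuousLinearMap_apply hZD, hF]
    rw [VectorFourier.fourierSMulRight_apply]
    have e3 : ((innerSL ℝ) ξ) (EuclideanSpace.single i 1) = ξ i := by
      rw [innerSL_apply_apply, EuclideanSpace.inner_single_right]; simp
    simp [e2basis, abs_of_pos pi_pos, e3]
    rw [← mul_assoc]
  have hsq : Integrable (fun x => ‖fderiv ℝ z x‖ ^ 2) := (memLp_two_iff_integrable_sq_norm h2'.1).1 h2'
  have hPl : ∀ i, ∫ ξ, ‖𝓕 (P i) ξ‖ ^ 2 ≤ ∫ x, ‖fderiv ℝ z x‖ ^ 2 := by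
    intro i
    rw [(plancherel (hPi i) (hPm i)).2]
    refine integral_mono ((memLp_two_iff_integrable_sq_norm (hPm i).1).1 (hPm i)) hsq fun x => ?_
    have := hPn i x
    dsimp only
    gcongr
  have hPq : ∀ i, Integrable (fun ξ => ‖𝓕 (P i) ξ‖ ^ 2) := fun i =>
    (memLp_two_iff_integrable_sq_norm (plancherel (hPi i) (hPm i)).1.1).1 (plancherel (hPi i) (hPm i)).1
  have hb : ∀ ξ : E2, ‖ξ‖ ^ 2 * ‖𝓕 Z ξ‖ ^ 2 ≤ ‖𝓕 (P 0) ξ‖ ^ 2 + ‖𝓕 (P 1) ξ‖ ^ 2 := by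
    intro ξ
    rw [hPF, hPF, norm_sq_coord, mul_pow, mul_pow, mul_pow _ ‖𝓕 Z ξ‖, mul_pow (2 * π), sq_abs, sq_abs]
    have : 1 ≤ (2 * π) ^ 2 := by nlinarith [pi_gt_three]
    rw [← add_mul, ← mul_add]
    have h0 : 0 ≤ ξ 0 ^ 2 + ξ 1 ^ 2 := by positivity
    gcongr
    nlinarith
  calc ∫⁻ ξ : E2, ‖ξ‖ₑ ^ 2 * ‖𝓕 Z ξ‖ₑ ^ 2
      ≤ ∫⁻ ξ, ENNReal.ofReal (‖𝓕 (P 0) ξ‖ ^ 2 + ‖𝓕 (P 1) ξ‖ ^ 2) := by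
        refine lintegral_mono fun ξ => ?_
        simp only [← ofReal_norm]
        rw [← ENNReal.ofReal_pow (by positivity), ← ENNReal.ofReal_pow (by positivity),
          ← ENNReal.ofReal_mul (by positivity)]
        exact ENNReal.ofReal_le_ofReal (hb ξ)
    _ = ENNReal.ofReal (∫ ξ, (‖𝓕 (P 0) ξ‖ ^ 2 + ‖𝓕 (P 1) ξ‖ ^ 2)) := by
        rw [ofReal_integral_eq_lintegral_ofReal (f := fun ξ => ‖𝓕 (P 0) ξ‖ ^ 2 + ‖𝓕 (P 1) ξ‖ ^ 2) ((hPq 0).add (hPq 1))]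
        · filter_upwards with x
          simp only [Pi.zero_apply]; positivity
    _ ≤ _ := by
        apply ENNReal.ofReal_le_ofReal
        rw [integral_add (hPq 0) (hPq 1)]
        linarith [hPl 0, hPl 1]


lemma sq_int {w : E2 → ℝ} (h : MemLp w 2 volume) : Integrable (fun x => w x ^ 2) := by
  simpa using (memLp_two_iff_integrable_sq_norm h.1).1 h

lemma cs_abs {f g : E2 → ℝ} (hf : MemLp f 2 volume) (hg : MemLp g 2 volume) :
    ∫ x, |f x * g x| ≤ (∫ x, f x ^ 2) + ∫ x, g x ^ 2 := by
  rw [← integral_add (sq_int hf) (sq_int hg)]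
  refine integral_mono (hf.integrable_mul hg).norm ((sq_int hf).add (sq_int hg)) fun x => ?_
  simp only [Pi.add_apply, abs_mul]
  rw [← sq_abs (f x), ← sq_abs (g x)]
  nlinarith [sq_nonneg (|f x| - |g x|), sq_nonneg (|f x|), sq_nonneg (|g x|)]

lemma rellich_aux {w : ℕ → E2 → ℝ} {w0 : E2 → ℝ} (hd : ∀ n, Differentiable ℝ (w n))
    (h2 : ∀ n, MemLp (w n) 2 volume) (hD : ∀ n, MemLp (fderiv ℝ (w n)) 2 volume) {C : ℝ}
    (hC : ∀ n, ∫ x, w n x ^ 2 ≤ C) (hCD : ∀ n, ∫ x, ‖fderiv ℝ (w n) x‖ ^ 2 ≤ C)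
    (h0 : MemLp w0 2 volume)
    (hw : ∀ h : E2 → ℝ, MemLp h 2 volume →
      Tendsto (fun n => ∫ x, w n x * h x) atTop (𝓝 (∫ x, w0 x * h x)))
    {φ : E2 → ℝ} (hφd : Differentiable ℝ φ) (hφ2 : MemLp φ 2 volume)
    (hφ2' : MemLp (fderiv ℝ φ) 2 volume) {B : ℝ} (hB0 : 0 ≤ B)
    (hB : ∀ x, ‖φ x‖ ≤ B ∧ ‖fderiv ℝ φ x‖ ≤ B) :
    Tendsto (fun n => ∫ x, φ x ^ 2 * (w n x - w0 x) ^ 2) atTop (𝓝 0) := by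
  have hz : ∀ w : E2 → ℝ, MemLp w 2 volume →
      Integrable (fun x => φ x * w x) ∧ MemLp (fun x => φ x * w x) 2 volume := by
    intro w hw
    refine ⟨hφ2.integrable_mul hw, ?_⟩
    refine (hw.norm.const_mul B).mono' (hφd.continuous.aestronglyMeasurable.mul hw.1) ?_
    filter_upwards with x
    rw [norm_mul]
    gcongr
    exact (hB x).1
  set z : ℕ → E2 → ℝ := fun n x => φ x * w n x with hzdef
  set z0 : E2 → ℝ := fun x => φ x * w0 x with hz0def
  have hzd : ∀ n, Differentiable ℝ (z n) := fun n => hφd.mul (hd n)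
  have hzf : ∀ n x, fderiv ℝ (z n) x = φ x • fderiv ℝ (w n) x + w n x • fderiv ℝ φ x := fun n x =>
    fderiv_mul (hφd x) (hd n x)
  have hzn : ∀ n x, ‖fderiv ℝ (z n) x‖ ≤ |φ x| * ‖fderiv ℝ (w n) x‖ + |w n x| * ‖fderiv ℝ φ x‖ := by
    intro n x
    rw [hzf]
    refine (norm_add_le _ _).trans (le_of_eq ?_)
    rw [norm_smul, norm_smul, Real.norm_eq_abs, Real.norm_eq_abs]
  have hzD1 : ∀ n, Integrable (fderiv ℝ (z n)) := fun n =>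
    ((hφ2.norm.integrable_mul (hD n).norm).add ((h2 n).norm.integrable_mul hφ2'.norm)).mono'
      (measurable_fderiv ℝ _).aestronglyMeasurable (Eventually.of_forall (hzn n))
  have hzn2 : ∀ n x, ‖fderiv ℝ (z n) x‖ ≤ B * ‖fderiv ℝ (w n) x‖ + B * |w n x| := by
    intro n x
    refine (hzn n x).trans ?_
    rw [mul_comm (|w n x|)]
    gcongr
    · exact (hB x).1
    · exact (hB x).2
  have hzD2 : ∀ n, MemLp (fderiv ℝ (z n)) 2 volume := fun n =>
    (((hD n).norm.const_mul B).add ((h2 n).norm.const_mul B)).mono'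
      (measurable_fderiv ℝ _).aestronglyMeasurable (Eventually.of_forall (hzn2 n))
  have hDs : ∀ n, Integrable (fun x => ‖fderiv ℝ (w n) x‖ ^ 2) := fun n =>
    (memLp_two_iff_integrable_sq_norm (hD n).1).1 (hD n)
  have hzDb : ∀ n, ∫ x, ‖fderiv ℝ (z n) x‖ ^ 2 ≤ 4 * B ^ 2 * C := by
    intro n
    calc ∫ x, ‖fderiv ℝ (z n) x‖ ^ 2
        ≤ ∫ x, 2 * B ^ 2 * (‖fderiv ℝ (w n) x‖ ^ 2 + w n x ^ 2) := by
          refine integral_mono ((memLp_two_iff_integrable_sq_norm (hzD2 n).1).1 (hzD2 n))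
            (((hDs n).add (sq_int (h2 n))).const_mul _) fun x => ?_
          have h := hzn2 n x
          simp only
          rw [← sq_abs (w n x)]
          have h' : ‖fderiv ℝ (z n) x‖ ^ 2 ≤ (B * ‖fderiv ℝ (w n) x‖ + B * |w n x|) ^ 2 := by gcongr
          nlinarith [sq_nonneg (B * (‖fderiv ℝ (w n) x‖ - |w n x|))]
      _ = 2 * B ^ 2 * ((∫ x, ‖fderiv ℝ (w n) x‖ ^ 2) + ∫ x, w n x ^ 2) := by
          rw [integral_const_mul, integral_add (hDs n) (sq_int (h2 n))]
      _ ≤ 2 * B ^ 2 * (C + C) := by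
          gcongr
          · exact hCD n
          · exact hC n
      _ = _ := by ring
  set Z : ℕ → E2 → ℂ := fun n x => (z n x : ℂ) with hZ
  set Z0 : E2 → ℂ := fun x => (z0 x : ℂ) with hZ0
  have iZ : ∀ n, Integrable (Z n) := fun n => (hz _ (h2 n)).1.ofReal
  have iZ0 : Integrable Z0 := (hz _ h0).1.ofReal
  have hcont : ∀ {h : E2 → ℂ}, Integrable h → Continuous (𝓕 h) := fun h1 =>
    VectorFourier.fourierIntegral_continuous Real.continuous_fourierChar continuous_inner h1
  have hbd : ∀ n ξ, ‖𝓕 (Z n) ξ‖ ≤ (∫ x, φ x ^ 2) + C := by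
    intro n ξ
    refine (VectorFourier.norm_fourierIntegral_le_integral_norm _ _ _ _ _).trans ?_
    refine le_trans (le_of_eq ?_) ((cs_abs hφ2 (h2 n)).trans (by linarith [hC n]))
    congr 1; ext x
    simp [hZ, hzdef]
  have hlim : ∀ ξ, Tendsto (fun n => 𝓕 (Z n) ξ) atTop (𝓝 (𝓕 Z0 ξ)) := by
    intro ξ
    set c : E2 → ℂ := fun x => (𝐞 (-(inner ℝ x ξ)) : ℂ) with hc
    have hcc : Continuous c := by
      simp only [hc]
      exact continuous_subtype_val.comp (Real.continuous_fourierChar.comp (by fun_prop))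
    have hc1 : ∀ x, ‖c x‖ = 1 := fun x => Circle.norm_coe _
    have m : ∀ (T : ℂ →L[ℝ] ℝ), (∀ y, |T y| ≤ ‖y‖) → MemLp (fun x => φ x * T (c x)) 2 volume := by
      intro T hT
      refine hφ2.norm.mono' (hφd.continuous.mul (T.continuous.comp hcc)).aestronglyMeasurable ?_
      filter_upwards with x
      rw [norm_mul]
      refine mul_le_of_le_one_right (norm_nonneg _) ?_
      simpa [hc1] using hT (c x)
    have mr := m Complex.reCLM (fun y => by simpa using Complex.abs_re_le_norm y)
    have mi := m Complex.imCLM (fun y => by simpa using Complex.abs_im_le_norm y)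
    have e : ∀ v : E2 → ℝ, MemLp v 2 volume → 𝓕 (fun x => ((φ x * v x : ℝ) : ℂ)) ξ =
        ((∫ x, v x * (φ x * Complex.reCLM (c x)) : ℝ) : ℂ)
          + ((∫ x, v x * (φ x * Complex.imCLM (c x)) : ℝ) : ℂ) * Complex.I := by
      intro v hv
      rw [Real.fourier_eq, ← integral_complex_ofReal, ← integral_complex_ofReal, ← integral_mul_const,
        ← integral_add]
      · congr 1; ext x
        change c x * _ = _
        generalize c x = y
        apply Complex.ext <;> simp <;> ring
      · exact (hv.integrable_mul mr).ofReal
      · exact (hv.integrable_mul mi).ofReal.mul_const _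
    have e1 : ∀ n, 𝓕 (Z n) ξ = _ := fun n => e (w n) (h2 n)
    have e0 : 𝓕 Z0 ξ = _ := e w0 h0
    simp only [e1, e0]
    have t1 := (Complex.continuous_ofReal.tendsto _).comp (hw _ mr)
    have t2 := (Complex.continuous_ofReal.tendsto _).comp (hw _ mi)
    exact t1.add (t2.mul_const _)
  have key := tail_conv (fun n => (hcont (iZ n)).measurable) (hcont iZ0).measurable hbd hlim
    (K := 2 * (4 * B ^ 2 * C)) (fun n =>
      (fourier_grad_bound (hzd n) (hz _ (h2 n)).1 (hzD1 n) (hzD2 n)).trans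
        (ENNReal.ofReal_le_ofReal (by linarith [hzDb n])))
  have key2 := (ENNReal.tendsto_toReal ENNReal.zero_ne_top).comp key
  refine key2.congr fun n => ?_
  simp only [Function.comp]
  have mZ : MemLp (fun x => Z n x - Z0 x) 2 volume :=
    ((hz _ (h2 n)).2.ofReal).sub ((hz _ h0).2.ofReal)
  have P := plancherel ((iZ n).sub iZ0) mZ
  have e : ∀ ξ, 𝓕 (Z n - Z0) ξ = 𝓕 (Z n) ξ - 𝓕 Z0 ξ := by
    intro ξ
    rw [Real.fourier_eq, Real.fourier_eq, Real.fourier_eq, ← integral_sub]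
    · simp [smul_sub]
    · exact (Real.fourierIntegral_convergent_iff ξ).2 (iZ n)
    · exact (Real.fourierIntegral_convergent_iff ξ).2 iZ0
  have e2 : ∫ x, φ x ^ 2 * (w n x - w0 x) ^ 2 = ∫ x, ‖(Z n - Z0) x‖ ^ 2 := by
    congr 1; ext x
    simp only [hZ, hZ0, Pi.sub_apply, ← Complex.ofReal_sub, Complex.norm_real, hzdef, hz0def,
      Real.norm_eq_abs, sq_abs]
    ring
  rw [e2, ← P.2]
  simp only [e]
  have := integral_eq_lintegral_of_nonneg_ae (μ := (volume : Measure E2))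
    (f := fun ξ => ‖𝓕 (Z n) ξ - 𝓕 Z0 ξ‖ ^ 2) (Eventually.of_forall fun ξ => by positivity)
    (((hcont (iZ n)).sub (hcont iZ0)).norm.pow 2).aestronglyMeasurable
  rw [this]
  congr 2; ext ξ
  rw [← ofReal_norm, ENNReal.ofReal_pow (by positivity)]

/-- A convenient positive weight. -/
def wt (x : E2) : ℝ := (1 + ‖x‖ ^ 2)⁻¹

lemma wt_pos (x : E2) : 0 < wt x := by unfold wt; positivity

lemma wt_le_one (x : E2) : wt x ≤ 1 := by
  unfold wt
  exact inv_le_one_of_one_le₀ (by nlinarith [sq_nonneg ‖x‖])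

lemma wt_hasFDerivAt (x : E2) :
    HasFDerivAt wt (-((1 + ‖x‖ ^ 2) ^ 2)⁻¹ • (2 • innerSL ℝ x)) x := by
  have h1 : HasFDerivAt (fun x : E2 => 1 + ‖x‖ ^ 2) (2 • innerSL ℝ x) x :=
    (HasStrictFDerivAt.hasFDerivAt (hasStrictFDerivAt_norm_sq x)).const_add 1
  have h0 : (1 + ‖x‖ ^ 2) ≠ 0 := by positivity
  exact (hasDerivAt_inv h0).comp_hasFDerivAt x h1

lemma wt_diff : Differentiable ℝ wt := fun x => (wt_hasFDerivAt x).differentiableAt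

lemma wt_fderiv_le (x : E2) : ‖fderiv ℝ wt x‖ ≤ wt x := by
  rw [(wt_hasFDerivAt x).fderiv, norm_smul, norm_neg, norm_inv, norm_pow,
    Real.norm_of_nonneg (by positivity)]
  have : ‖(2:ℕ) • innerSL ℝ x‖ ≤ 1 + ‖x‖ ^ 2 := by
    rw [← Nat.cast_smul_eq_nsmul ℝ, norm_smul, innerSL_apply_norm]
    norm_num
    nlinarith [sq_nonneg (‖x‖ - 1)]
  calc ((1 + ‖x‖ ^ 2) ^ 2)⁻¹ * ‖(2:ℕ) • innerSL ℝ x‖ ≤ ((1 + ‖x‖ ^ 2) ^ 2)⁻¹ * (1 + ‖x‖ ^ 2) := by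
        gcongr
    _ = wt x := by unfold wt; field_simp

lemma wt_memLp : MemLp wt 2 volume := by
  rw [memLp_two_iff_integrable_sq_norm wt_diff.continuous.aestronglyMeasurable]
  have := integrable_rpow_neg_one_add_norm_sq (E := E2) (μ := volume) (r := 4) (by simp; norm_num)
  refine this.congr ?_
  filter_upwards with ξ
  have hpos : (0:ℝ) < 1 + ‖ξ‖ ^ 2 := by positivity
  unfold wt
  rw [norm_inv, Real.norm_of_nonneg hpos.le, inv_pow,
      show (-4 / 2 : ℝ) = -((2:ℕ):ℝ) by norm_num, Real.rpow_neg hpos.le, Real.rpow_natCast]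

lemma rellich {w : ℕ → E2 → ℝ} {w0 : E2 → ℝ} (hd : ∀ n, Differentiable ℝ (w n))
    (h2 : ∀ n, MemLp (w n) 2 volume) (hD : ∀ n, MemLp (fderiv ℝ (w n)) 2 volume) {C : ℝ}
    (hC : ∀ n, ∫ x, w n x ^ 2 ≤ C) (hCD : ∀ n, ∫ x, ‖fderiv ℝ (w n) x‖ ^ 2 ≤ C)
    (h0 : MemLp w0 2 volume)
    (hw : ∀ h : E2 → ℝ, MemLp h 2 volume →
      Tendsto (fun n => ∫ x, w n x * h x) atTop (𝓝 (∫ x, w0 x * h x))) :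
    Tendsto (fun n => ∫ x, wt x ^ 2 * (w n x - w0 x) ^ 2) atTop (𝓝 0) := by
  refine rellich_aux hd h2 hD hC hCD h0 hw wt_diff wt_memLp ?_ zero_le_one fun x => ⟨?_, ?_⟩
  · exact wt_memLp.mono' (measurable_fderiv ℝ _).aestronglyMeasurable (Eventually.of_forall wt_fderiv_le)
  · rw [Real.norm_of_nonneg (wt_pos x).le]; exact wt_le_one x
  · exact (wt_fderiv_le x).trans (wt_le_one x)

lemma schwartz_le_wt (φ : 𝓢(E2, ℝ)) : ∃ C, 0 ≤ C ∧ ∀ x, |φ x| ≤ C * wt x := by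
  refine ⟨SchwartzMap.seminorm ℝ 0 0 φ + SchwartzMap.seminorm ℝ 2 0 φ, by positivity, fun x => ?_⟩
  have h1 := SchwartzMap.norm_le_seminorm ℝ φ x
  have h2 := SchwartzMap.norm_pow_mul_le_seminorm ℝ φ 2 x
  unfold wt
  rw [← div_eq_mul_inv, le_div_iff₀ (by positivity)]
  rw [Real.norm_eq_abs] at h1 h2
  linarith

lemma cs_sq {f g : E2 → ℝ} (hf : MemLp f 2 volume) (hg : MemLp g 2 volume) :
    (∫ x, |f x * g x|) ^ 2 ≤ (∫ x, f x ^ 2) * ∫ x, g x ^ 2 := by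
  have key : ∀ t : ℝ, 0 ≤ (∫ x, g x ^ 2) * (t * t) + (-2 * ∫ x, |f x * g x|) * t + ∫ x, f x ^ 2 := by
    intro t
    have : 0 ≤ ∫ x, (|f x| - t * |g x|) ^ 2 := integral_nonneg fun x => by positivity
    have e : ∀ x, (|f x| - t * |g x|) ^ 2 = ((t * t) * g x ^ 2 + (-2 * t) * |f x * g x|) + f x ^ 2 := by
      intro x
      rw [← sq_abs (f x), ← sq_abs (g x), abs_mul]; ring
    simp_rw [e] at this
    have i1 := (sq_int hg).const_mul (t * t)
    have i2 : Integrable (fun x => (-2 * t) * |f x * g x|) := (hf.integrable_mul hg).norm.const_mul (-2 * t)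
    have i3 : Integrable (fun x => (t * t) * g x ^ 2 + (-2 * t) * |f x * g x|) := i1.add i2
    rw [integral_add i3 (sq_int hf), integral_add i1 i2, integral_const_mul, integral_const_mul] at this
    linarith
  have := discrim_le_zero key
  unfold discrim at this
  linarith

lemma cs_tendsto {f g : ℕ → E2 → ℝ} (hf : ∀ n, MemLp (f n) 2 volume) (hg : ∀ n, MemLp (g n) 2 volume)
    {C : ℝ} (hC : ∀ n, ∫ x, g n x ^ 2 ≤ C) (h0 : Tendsto (fun n => ∫ x, f n x ^ 2) atTop (𝓝 0)) :
    Tendsto (fun n => ∫ x, |f n x * g n x|) atTop (𝓝 0) := by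
  have h1 : Tendsto (fun n => √((∫ x, f n x ^ 2) * C)) atTop (𝓝 0) := by
    have := (Real.continuous_sqrt.tendsto _).comp (h0.mul_const C)
    simpa [Function.comp_def] using this
  refine squeeze_zero (fun n => integral_nonneg fun x => abs_nonneg _) (fun n => ?_) h1
  refine Real.le_sqrt_of_sq_le ((cs_sq (hf n) (hg n)).trans ?_)
  exact mul_le_mul_of_nonneg_left (hC n) (integral_nonneg fun x => by positivity)


/-- Partial derivatives of components. -/
def pd (u : E2 → E2) (i j : Fin 2) (x : E2) : ℝ := fderiv ℝ u x (e2basis i) j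

lemma inner_coord (y z : E2) : (inner ℝ y z : ℝ) = y 0 * z 0 + y 1 * z 1 := by
  simp [PiLp.inner_apply, mul_comm]

lemma gradSq_eq (u : E2 → E2) (x : E2) :
    gradSq u x = (pd u 0 0 x ^ 2 + pd u 0 1 x ^ 2) + (pd u 1 0 x ^ 2 + pd u 1 1 x ^ 2) := by
  simp only [gradSq, Fin.sum_univ_two, norm_sq_coord, pd]

lemma fderiv_sq_le (u : E2 → E2) (x : E2) : ‖fderiv ℝ u x‖ ^ 2 ≤ gradSq u x := by
  have h0 : 0 ≤ gradSq u x := by unfold gradSq; positivity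
  rw [← Real.le_sqrt (norm_nonneg _) h0]
  refine ContinuousLinearMap.opNorm_le_bound _ (Real.sqrt_nonneg _) fun y => ?_
  have hy : y = y 0 • e2basis 0 + y 1 • e2basis 1 := by
    ext i; fin_cases i <;> simp [e2basis]
  have h1 : ‖fderiv ℝ u x y‖ ≤ |y 0| * ‖fderiv ℝ u x (e2basis 0)‖ + |y 1| * ‖fderiv ℝ u x (e2basis 1)‖ := by
    conv_lhs => rw [hy, map_add, map_smul, map_smul]
    refine (norm_add_le _ _).trans (le_of_eq ?_)
    rw [norm_smul, norm_smul, Real.norm_eq_abs, Real.norm_eq_abs]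
  refine h1.trans ?_
  rw [← Real.sqrt_sq (norm_nonneg y), ← Real.sqrt_mul h0]
  refine Real.le_sqrt_of_sq_le ?_
  rw [norm_sq_coord, gradSq, Fin.sum_univ_two, ← sq_abs (y 0), ← sq_abs (y 1)]
  nlinarith [sq_nonneg (|y 0| * ‖fderiv ℝ u x (e2basis 1)‖ - |y 1| * ‖fderiv ℝ u x (e2basis 0)‖)]

lemma pd_abs_le (u : E2 → E2) (i j : Fin 2) (x : E2) : |pd u i j x| ≤ ‖fderiv ℝ u x‖ := by
  refine (norm_coord_le _ _).trans ?_
  simpa [norm_e2basis] using (fderiv ℝ u x).le_opNorm (e2basis i)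

lemma pd_eq {u : E2 → E2} (hd : Differentiable ℝ u) (i j : Fin 2) (x : E2) :
    pd u i j x = fderiv ℝ (fun y => u y j) x (e2basis i) := by
  rw [MemH1.fderiv_comp hd]; rfl

lemma pd_measurable (u : E2 → E2) (i j : Fin 2) : Measurable (pd u i j) := by
  have h := measurable_fderiv_apply_const ℝ u (e2basis i)
  exact (EuclideanSpace.proj j : E2 →L[ℝ] ℝ).continuous.measurable.comp h

lemma MemH1.pd_memLp {u : E2 → E2} (hu : MemH1 u) (i j : Fin 2) : MemLp (pd u i j) 2 volume :=
  hu.2.2.norm.mono' (pd_measurable u i j).aestronglyMeasurable (Eventually.of_forall fun x => pd_abs_le u i j x)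

lemma coord_memLp {u : E2 → E2} (hu : MemLp u 2 volume) (j : Fin 2) : MemLp (fun x => u x j) 2 volume :=
  hu.norm.mono' ((EuclideanSpace.proj j : E2 →L[ℝ] ℝ).continuous.comp_aestronglyMeasurable hu.1)
    (Eventually.of_forall fun x => norm_coord_le _ _)

lemma MemH1.coord_diff {u : E2 → E2} (hu : MemH1 u) (j : Fin 2) : Differentiable ℝ (fun x => u x j) :=
    (EuclideanSpace.proj j : E2 →L[ℝ] ℝ).differentiable.comp hu.1

lemma fderiv_coord_le {u : E2 → E2} (hd : Differentiable ℝ u) (j : Fin 2) (x : E2) :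
    ‖fderiv ℝ (fun x => u x j) x‖ ≤ ‖fderiv ℝ u x‖ := by
  rw [MemH1.fderiv_comp hd]
  refine ContinuousLinearMap.opNorm_le_bound _ (norm_nonneg _) fun y => ?_
  refine le_trans ?_ ((fderiv ℝ u x).le_opNorm y)
  simpa using norm_coord_le _ _

lemma MemH1.coord_fderiv_memLp {u : E2 → E2} (hu : MemH1 u) (j : Fin 2) :
    MemLp (fderiv ℝ (fun x => u x j)) 2 volume :=
  hu.2.2.norm.mono' (measurable_fderiv ℝ _).aestronglyMeasurable
    (Eventually.of_forall fun x => fderiv_coord_le hu.1 j x)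

/-- Data extracted from the hypotheses on `μ`, `f`. -/
structure Coef (μ : E2 → ℝ) (f : E2 → E2) (ε Cμ δ R : ℝ) : Prop where
  hμ : ContDiff ℝ (⊤ : ℕ∞) μ
  hf : ContDiff ℝ (⊤ : ℕ∞) f
  hμb : ∀ x, |μ x| ≤ Cμ
  hδ : 0 < δ
  hneg : ∀ x, R ≤ ‖x‖ → μ x ≤ -δ
  hf2 : MemLp f 2 volume
  hε : 0 < ε

lemma coef_exists {μ : E2 → ℝ} {μrad : ℝ → ℝ} {ρ : ℝ} {f : E2 → E2} {frad : ℝ → ℝ}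
    (hμ : MuHyp μ μrad ρ) (hf : FHyp f frad) {ε : ℝ} (hε : 0 < ε) :
    ∃ Cμ δ R, Coef μ f ε Cμ δ R := by
  obtain ⟨Cμ, hC⟩ := hμ.bdd
  have hanti : StrictAntiOn μrad (Ioi 0) := by
    refine strictAntiOn_of_deriv_neg (convex_Ioi 0) hμ.smooth_rad.continuous.continuousOn ?_
    intro x hx
    rw [interior_Ioi] at hx
    exact hμ.deriv_neg x hx
  have hρ := hμ.rho_pos
  have h2 : μrad (2 * ρ) < 0 := by
    have := hanti (show ρ ∈ Ioi 0 from hρ) (show 2 * ρ ∈ Ioi 0 by simp [hρ]) (by linarith)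
    rwa [hμ.rho_root] at this
  refine ⟨Cμ, -μrad (2 * ρ), 2 * ρ, hμ.smooth, hf.smooth, hC, by linarith, fun x hx => ?_, ?_, hε⟩
  · rw [hμ.radial, neg_neg]
    exact hanti.antitoneOn (show 2 * ρ ∈ Ioi 0 by simp [hρ]) (show ‖x‖ ∈ Ioi 0 from by
      have : 0 < ‖x‖ := by linarith
      exact this) hx
  · obtain ⟨C, hC⟩ := hf.bdd
    rw [memLp_two_iff_integrable_sq_norm hf.smooth.continuous.aestronglyMeasurable]
    refine (hf.integrable.norm.const_mul C).mono' (hf.smooth.continuous.norm.pow 2).aestronglyMeasurable ?_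
    filter_upwards with x
    rw [Real.norm_of_nonneg (by positivity), sq]
    gcongr
    exact hC x

lemma MemH1.gradSq_int {u : E2 → E2} (hu : MemH1 u) : Integrable (gradSq u) := by
  have := ((sq_int (hu.pd_memLp 0 0)).add (sq_int (hu.pd_memLp 0 1))).add
    ((sq_int (hu.pd_memLp 1 0)).add (sq_int (hu.pd_memLp 1 1)))
  refine this.congr (Eventually.of_forall fun x => ?_)
  simp only [Pi.add_apply, gradSq_eq]

lemma MemH1.four {u : E2 → E2} (hu : MemH1 u) : Integrable (fun x => ‖u x‖ ^ 4) :=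
  (H1_L4L6 hu le_rfl).1

lemma MemH1.six {u : E2 → E2} (hu : MemH1 u) : Integrable (fun x => ‖u x‖ ^ 6) :=
  (H1_L4L6 hu le_rfl).2.1

lemma inner_int {f u : E2 → E2} (hf : MemLp f 2 volume) (hu : MemLp u 2 volume) :
    Integrable (fun x => (inner ℝ (f x) (u x) : ℝ)) := by
  have := ((coord_memLp hf 0).integrable_mul (coord_memLp hu 0)).add
    ((coord_memLp hf 1).integrable_mul (coord_memLp hu 1))
  refine this.congr (Eventually.of_forall fun x => ?_)
  simp [inner_coord]

lemma bdd_mul_int {μ : E2 → ℝ} (hμ : Continuous μ) {C : ℝ} (hC : ∀ x, |μ x| ≤ C) {g : E2 → ℝ}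
    (hg : Integrable g) : Integrable (fun x => μ x * g x) := by
  refine (hg.norm.const_mul C).mono' (hμ.aestronglyMeasurable.mul hg.1) ?_
  filter_upwards with x
  rw [norm_mul]
  gcongr
  exact hC x

lemma bdd_mul_memLp {μ : E2 → ℝ} (hμ : Continuous μ) {C : ℝ} (hC : ∀ x, |μ x| ≤ C) {g : E2 → ℝ}
    (hg : MemLp g 2 volume) : MemLp (fun x => μ x * g x) 2 volume := by
  refine (hg.norm.const_mul C).mono' (hμ.aestronglyMeasurable.mul hg.1) ?_
  filter_upwards with x
  rw [norm_mul]
  gcongr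
  exact hC x

/-- The energy density. -/
def dens (ε a : ℝ) (μ : E2 → ℝ) (f : E2 → E2) (u : E2 → E2) (x : E2) : ℝ :=
  (1/2) * gradSq u x - (1/(2*ε^2)) * μ x * ‖u x‖^2
    + (1/(4*ε^2)) * ‖u x‖^4 - (a/ε) * (inner ℝ (f x) (u x) : ℝ)

lemma energy_eq (ε a : ℝ) (μ : E2 → ℝ) (f : E2 → E2) (u : E2 → E2) :
    energy ε a μ f u = ∫ x, dens ε a μ f u x := rfl

lemma Coef.dens_int {μ : E2 → ℝ} {f : E2 → E2} {ε a Cμ δ R : ℝ} (h : Coef μ f ε Cμ δ R)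
    {u : E2 → E2} (hu : MemH1 u) : Integrable (dens ε a μ f u) := by
  have i1 := hu.gradSq_int.const_mul (1/2)
  have i2 := (bdd_mul_int h.hμ.continuous h.hμb hu.sq).const_mul (1/(2*ε^2))
  have i3 := hu.four.const_mul (1/(4*ε^2))
  have i4 := (inner_int h.hf2 hu.2.1).const_mul (a/ε)
  refine (((i1.sub i2).add i3).sub i4).congr (Eventually.of_forall fun x => ?_)
  simp only [Pi.sub_apply, Pi.add_apply, dens]
  ring

lemma Coef.coercive {μ : E2 → ℝ} {f : E2 → E2} {ε Cμ δ R : ℝ} (h : Coef μ f ε Cμ δ R) (a : ℝ) :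
    ∃ κ K : ℝ, 0 < κ ∧ ∀ u, MemH1 u →
      κ * (∫ x, ‖u x‖ ^ 2 + ‖fderiv ℝ u x‖ ^ 2) ≤ energy ε a μ f u + K := by
  have hε := h.hε
  have hδ := h.hδ
  set g : E2 → ℝ := fun x => (Metric.ball (0:E2) R).indicator (fun _ => (Cμ + δ) ^ 2 / (4 * ε ^ 2)) x
    + a ^ 2 / δ * ‖f x‖ ^ 2 with hg
  have gi : Integrable g := by
    refine Integrable.add ?_ ?_
    · refine (integrable_indicator_iff measurableSet_ball).2 ?_
      exact integrableOn_const measure_ball_lt_top.ne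
    · exact ((memLp_two_iff_integrable_sq_norm h.hf2.1).1 h.hf2).const_mul _
  set κ := min (1/2) (δ / (4 * ε ^ 2)) with hκ
  have k1 : κ ≤ 1/2 := min_le_left _ _
  have k2 : κ ≤ δ / (4 * ε ^ 2) := min_le_right _ _
  refine ⟨κ, ∫ x, g x, by positivity, fun u hu => ?_⟩
  rw [energy_eq, ← integral_const_mul, ← integral_add (h.dens_int hu) gi]
  refine integral_mono ((hu.sq.add hu.dsq).const_mul κ) ((h.dens_int hu).add gi) fun x => ?_
  have d1 := fderiv_sq_le u x
  have hU : 0 ≤ ‖u x‖ := norm_nonneg _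
  have hF : 0 ≤ ‖f x‖ := norm_nonneg _
  have d2 : (a/ε) * (inner ℝ (f x) (u x) : ℝ) ≤ δ / (4 * ε ^ 2) * ‖u x‖ ^ 2 + a ^ 2 / δ * ‖f x‖ ^ 2 := by
    have c1 : (a/ε) * (inner ℝ (f x) (u x) : ℝ) ≤ |a| / ε * (‖f x‖ * ‖u x‖) := by
      refine (le_abs_self _).trans ?_
      rw [abs_mul, abs_div, abs_of_pos hε]
      gcongr
      exact abs_real_inner_le_norm _ _
    refine c1.trans ?_
    have : δ / (4 * ε ^ 2) * ‖u x‖ ^ 2 + a ^ 2 / δ * ‖f x‖ ^ 2 - |a| / ε * (‖f x‖ * ‖u x‖)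
        = (δ * ‖u x‖ - 2 * ε * |a| * ‖f x‖) ^ 2 / (4 * ε ^ 2 * δ) := by
      rw [← sq_abs a]
      field_simp
      ring
    have h2 : 0 ≤ (δ * ‖u x‖ - 2 * ε * |a| * ‖f x‖) ^ 2 / (4 * ε ^ 2 * δ) := by positivity
    linarith
  have d3 : δ / (2 * ε ^ 2) * ‖u x‖ ^ 2 ≤ - (1/(2*ε^2)) * μ x * ‖u x‖^2 + (1/(4*ε^2)) * ‖u x‖^4
      + (Metric.ball (0:E2) R).indicator (fun _ => (Cμ + δ) ^ 2 / (4 * ε ^ 2)) x := by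
    by_cases hx : x ∈ Metric.ball (0:E2) R
    · rw [indicator_of_mem hx]
      have hm := h.hμb x
      rw [abs_le] at hm
      have e : - (1/(2*ε^2)) * μ x * ‖u x‖^2 + (1/(4*ε^2)) * ‖u x‖^4 + (Cμ + δ) ^ 2 / (4 * ε ^ 2)
          - δ / (2 * ε ^ 2) * ‖u x‖ ^ 2 =
          ((‖u x‖ ^ 2 - (Cμ + δ)) ^ 2 + 2 * (Cμ - μ x) * ‖u x‖ ^ 2) / (4 * ε ^ 2) := by
        field_simp
        ring
      have : 0 ≤ ((‖u x‖ ^ 2 - (Cμ + δ)) ^ 2 + 2 * (Cμ - μ x) * ‖u x‖ ^ 2) / (4 * ε ^ 2) := by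
        have : 0 ≤ Cμ - μ x := by linarith
        positivity
      linarith
    · rw [indicator_of_notMem hx]
      have hm := h.hneg x (by simpa using hx)
      have e : - (1/(2*ε^2)) * μ x * ‖u x‖^2 + (1/(4*ε^2)) * ‖u x‖^4 + 0
          - δ / (2 * ε ^ 2) * ‖u x‖ ^ 2 = (2 * (-μ x - δ) * ‖u x‖ ^ 2 + ‖u x‖ ^ 4) / (4 * ε ^ 2) := by
        field_simp
        ring
      have : 0 ≤ (2 * (-μ x - δ) * ‖u x‖ ^ 2 + ‖u x‖ ^ 4) / (4 * ε ^ 2) := by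
        have : 0 ≤ -μ x - δ := by linarith
        positivity
      linarith
  have d4 : κ * ‖u x‖ ^ 2 ≤ δ / (4 * ε ^ 2) * ‖u x‖ ^ 2 := by gcongr
  have d5 : κ * ‖fderiv ℝ u x‖ ^ 2 ≤ 1/2 * gradSq u x := by gcongr
  have d6 : δ / (2 * ε ^ 2) * ‖u x‖ ^ 2 = δ / (4 * ε ^ 2) * ‖u x‖ ^ 2 + δ / (4 * ε ^ 2) * ‖u x‖ ^ 2 := by
    field_simp; ring
  simp only [hg, dens, Pi.add_apply]
  linarith


lemma eLpNorm_one_real {F : E2 → ℝ} (hF : Integrable F) :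
    eLpNorm F 1 volume = ENNReal.ofReal (∫ x, ‖F x‖) := by
  rw [eLpNorm_one_eq_lintegral_enorm, ofReal_integral_norm_eq_lintegral_enorm hF]

lemma ae_subseq {F : ℕ → E2 → ℝ} (hF : ∀ n, Integrable (F n)) (h0 : ∀ n x, 0 ≤ F n x)
    (hl : Tendsto (fun n => ∫ x, F n x) atTop (𝓝 0)) :
    ∃ s : ℕ → ℕ, StrictMono s ∧ ∀ᵐ x, Tendsto (fun n => F (s n) x) atTop (𝓝 0) := by
  have h1 : Tendsto (fun n => eLpNorm (F n - fun _ => (0:ℝ)) 1 volume) atTop (𝓝 0) := by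
    have : ∀ n, eLpNorm (F n - fun _ => (0:ℝ)) 1 volume = ENNReal.ofReal (∫ x, F n x) := by
      intro n
      have e : (F n - fun _ => (0:ℝ)) = F n := by ext x; simp
      rw [e, eLpNorm_one_real (hF n)]
      simp_rw [Real.norm_of_nonneg (h0 n _)]
    simp_rw [this]
    simpa using ENNReal.tendsto_ofReal hl
  exact (tendstoInMeasure_of_tendsto_eLpNorm one_ne_zero (fun n => (hF n).1)
    aestronglyMeasurable_const h1).exists_seq_tendsto_ae

lemma fatou_int {F : ℕ → E2 → ℝ} {G : E2 → ℝ} (hF : ∀ n, Integrable (F n)) (h0 : ∀ n x, 0 ≤ F n x)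
    {K : ℝ} (hK : ∀ n, ∫ x, F n x ≤ K) (hG : AEStronglyMeasurable G volume)
    (hl : ∀ᵐ x, Tendsto (fun n => F n x) atTop (𝓝 (G x))) : Integrable G := by
  rw [← memLp_one_iff_integrable]
  refine ⟨hG, ?_⟩
  refine lt_of_le_of_lt (Lp.eLpNorm_lim_le_liminf_eLpNorm (fun n => (hF n).1) _ hl) ?_
  refine lt_of_le_of_lt ?_ (ENNReal.ofReal_lt_top (r := K))
  refine liminf_le_of_le (by isBoundedDefault) fun b hb => ?_
  obtain ⟨n, hn⟩ := hb.exists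
  refine hn.trans ?_
  rw [eLpNorm_one_real (hF n)]
  simp_rw [Real.norm_of_nonneg (h0 n _)]
  exact ENNReal.ofReal_le_ofReal (hK n)

/-- A weakly converging sequence in `H¹` together with its limit. -/
structure Lim (u : ℕ → E2 → E2) (M : ℝ) (U : E2 → E2) (p : Fin 2 → Fin 2 → E2 → ℝ) : Prop where
  hu : ∀ n, MemH1 (u n)
  hM : ∀ n, ∫ x, ‖u n x‖ ^ 2 + ‖fderiv ℝ (u n) x‖ ^ 2 ≤ M
  hU : MemLp U 2 volume
  hp : ∀ i j, MemLp (p i j) 2 volume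
  wU : ∀ j (h : E2 → ℝ), MemLp h 2 volume →
    Tendsto (fun n => ∫ x, u n x j * h x) atTop (𝓝 (∫ x, U x j * h x))
  wp : ∀ i j (h : E2 → ℝ), MemLp h 2 volume →
    Tendsto (fun n => ∫ x, pd (u n) i j x * h x) atTop (𝓝 (∫ x, p i j x * h x))
  str : Tendsto (fun n => ∫ x, wt x ^ 2 * ‖u n x - U x‖ ^ 2) atTop (𝓝 0)
  U4 : Integrable (fun x => ‖U x‖ ^ 4)
  U6 : Integrable (fun x => ‖U x‖ ^ 6)

lemma wt_meas : Measurable wt := wt_diff.continuous.measurable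

lemma wt_mul_int {g : E2 → ℝ} (hg : Integrable g) : Integrable (fun x => wt x ^ 2 * g x) := by
  refine bdd_mul_int (wt_diff.continuous.pow 2) (C := 1) (fun x => ?_) hg
  rw [abs_of_nonneg (sq_nonneg _)]
  exact pow_le_one₀ (wt_pos x).le (wt_le_one x)

lemma lim_exists {u : ℕ → E2 → E2} {M : ℝ} (hu : ∀ n, MemH1 (u n))
    (hM : ∀ n, ∫ x, ‖u n x‖ ^ 2 + ‖fderiv ℝ (u n) x‖ ^ 2 ≤ M) :
    ∃ s : ℕ → ℕ, StrictMono s ∧ ∃ U p, Lim (u ∘ s) M U p := by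
  have hi : ∀ n, ∫ x, ‖u n x‖ ^ 2 ≤ M := fun n => le_trans (integral_mono (hu n).sq
    ((hu n).sq.add (hu n).dsq) fun x => by simp) (hM n)
  have hi' : ∀ n, ∫ x, ‖fderiv ℝ (u n) x‖ ^ 2 ≤ M := fun n => le_trans (integral_mono (hu n).dsq
    ((hu n).sq.add (hu n).dsq) fun x => by simp) (hM n)
  have hc : ∀ n j, ∫ x, (u n x j) ^ 2 ≤ M := fun n j => le_trans (integral_mono
    (sq_int (coord_memLp (hu n).2.1 j)) (hu n).sq fun x => by
      simp only; rw [← sq_abs]; gcongr; exact norm_coord_le _ _) (hi n)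
  have hcd : ∀ n j, ∫ x, ‖fderiv ℝ (fun y => u n y j) x‖ ^ 2 ≤ M := fun n j => le_trans (integral_mono
    (by simpa using (memLp_two_iff_integrable_sq_norm ((hu n).coord_fderiv_memLp j).1).1 ((hu n).coord_fderiv_memLp j)) (hu n).dsq fun x => by
      simp only; gcongr; exact fderiv_coord_le (hu n).1 _ _) (hi' n)
  let g : Fin 2 × Option (Fin 2) → ℕ → E2 → ℝ := fun q n => match q.2 with
    | none => fun x => u n x q.1
    | some i => pd (u n) i q.1
  obtain ⟨s, hs, G, hG, hw⟩ := weak_family g (C := M) (by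
      rintro ⟨j, i⟩ n
      cases i with
      | none => exact coord_memLp (hu n).2.1 j
      | some i => exact (hu n).pd_memLp i j) (by
      rintro ⟨j, i⟩ n
      cases i with
      | none => exact hc n j
      | some i =>
        refine le_trans (integral_mono (sq_int ((hu n).pd_memLp i j)) (hu n).dsq fun x => ?_) (hi' n)
        simp only; rw [← sq_abs]; gcongr; exact pd_abs_le _ _ _ _)
  set U : E2 → E2 := fun x => WithLp.toLp 2 (fun j => G (j, none) x) with hUd
  have hUm : AEStronglyMeasurable U volume := by
    have : AEMeasurable U volume := by
      have h1 : AEMeasurable (fun x j => G (j, none) x) volume :=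
        aemeasurable_pi_lambda _ fun j => (hG (j, none)).1.aemeasurable
      exact (WithLp.measurable_toLp 2 _).comp_aemeasurable h1
    exact this.aestronglyMeasurable
  have hU2 : MemLp U 2 volume := by
    rw [memLp_two_iff_integrable_sq_norm hUm]
    refine ((sq_int (hG (0, none))).add (sq_int (hG (1, none)))).congr (Eventually.of_forall fun x => ?_)
    simp [norm_sq_coord, hUd]
  have hstr : Tendsto (fun n => ∫ x, wt x ^ 2 * ‖u (s n) x - U x‖ ^ 2) atTop (𝓝 0) := by
    have hr : ∀ j, Tendsto (fun n => ∫ x, wt x ^ 2 * (u (s n) x j - U x j) ^ 2) atTop (𝓝 0) := fun j =>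
      rellich (w := fun n x => u (s n) x j) (fun n => (hu _).coord_diff j)
        (fun n => coord_memLp (hu _).2.1 j) (fun n => (hu _).coord_fderiv_memLp j) (fun n => hc _ j)
        (fun n => hcd _ j) (coord_memLp hU2 j) (fun h hh => hw (j, none) h hh)
    have := (hr 0).add (hr 1)
    rw [add_zero] at this
    refine this.congr fun n => ?_
    rw [← integral_add]
    · refine integral_congr_ae (Eventually.of_forall fun x => ?_)
      simp [norm_sq_coord]; ring
    · exact wt_mul_int (sq_int ((coord_memLp (hu _).2.1 0).sub (coord_memLp hU2 0)))
    · exact wt_mul_int (sq_int ((coord_memLp (hu _).2.1 1).sub (coord_memLp hU2 1)))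
  have hFi : ∀ n, Integrable (fun x => wt x ^ 2 * ‖u (s n) x - U x‖ ^ 2) := fun n =>
    wt_mul_int ((memLp_two_iff_integrable_sq_norm ((hu _).2.1.sub hU2).1).1 ((hu _).2.1.sub hU2))
  obtain ⟨t, ht, hae⟩ := ae_subseq hFi (fun n x => by positivity) hstr
  have hae2 : ∀ᵐ x, Tendsto (fun n => ‖u (s (t n)) x‖) atTop (𝓝 ‖U x‖) := by
    filter_upwards [hae] with x hx
    have hwt := wt_pos x
    have h1 : Tendsto (fun n => ‖u (s (t n)) x - U x‖ ^ 2) atTop (𝓝 0) := by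
      have := hx.const_mul ((wt x ^ 2)⁻¹)
      rw [mul_zero] at this
      refine this.congr fun n => ?_
      field_simp
    have h2 : Tendsto (fun n => ‖u (s (t n)) x - U x‖) atTop (𝓝 0) := by
      have := h1.sqrt
      simpa [Real.sqrt_sq (norm_nonneg _)] using this
    exact (tendsto_iff_norm_sub_tendsto_zero.2 h2).norm
  refine ⟨s, hs, U, fun i j => G (j, some i), fun n => hu _, fun n => hM _, hU2, fun i j => hG _,
    fun j h hh => hw (j, none) h hh, fun i j h hh => hw (j, some i) h hh, hstr, ?_, ?_⟩
  · refine fatou_int (F := fun n x => ‖u (s (t n)) x‖ ^ 4) (fun n => (hu _).four) (fun n x => by positivity)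
      (fun n => (H1_L4L6 (hu _) (hM _)).2.2.1) (hU2.1.norm.pow 4) ?_
    filter_upwards [hae2] with x hx using hx.pow 4
  · refine fatou_int (F := fun n x => ‖u (s (t n)) x‖ ^ 6) (fun n => (hu _).six) (fun n x => by positivity)
      (fun n => (H1_L4L6 (hu _) (hM _)).2.2.2) (hU2.1.norm.pow 6) ?_
    filter_upwards [hae2] with x hx using hx.pow 6


lemma sch2 (φ : 𝓢(E2, ℝ)) : MemLp φ 2 volume := φ.memLp 2 volume

/-- The perturbation `u + t φ e_j`. -/
def pert (u : E2 → E2) (φ : 𝓢(E2, ℝ)) (j : Fin 2) (t : ℝ) (x : E2) : E2 := u x + (t * φ x) • e2basis j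

lemma pert_hasFDeriv {u : E2 → E2} (hu : Differentiable ℝ u) (φ : 𝓢(E2, ℝ)) (j : Fin 2) (t : ℝ) (x : E2) :
    HasFDerivAt (pert u φ j t) (fderiv ℝ u x + (t • fderiv ℝ φ x).smulRight (e2basis j)) x := by
  have h1 : HasFDerivAt (fun x => t * φ x) (t • fderiv ℝ φ x) x :=
    (φ.differentiable x).hasFDerivAt.const_mul t
  exact (hu x).hasFDerivAt.add (h1.smul_const (e2basis j))

lemma pert_fderiv {u : E2 → E2} (hu : Differentiable ℝ u) (φ : 𝓢(E2, ℝ)) (j : Fin 2) (t : ℝ) (x : E2)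
    (i : Fin 2) : fderiv ℝ (pert u φ j t) x (e2basis i) =
      fderiv ℝ u x (e2basis i) + (t * (∂_{e2basis i} φ) x) • e2basis j := by
  rw [(pert_hasFDeriv hu φ j t x).fderiv, SchwartzMap.lineDerivOp_apply_eq_fderiv]
  simp

lemma sq_pert (y : E2) (s : ℝ) (j : Fin 2) : ‖y + s • e2basis j‖ ^ 2 = ‖y‖ ^ 2 + 2 * s * y j + s ^ 2 := by
  rw [norm_sq_coord, norm_sq_coord]
  fin_cases j <;> simp [e2basis] <;> ring

lemma memH1_pert {u : E2 → E2} (hu : MemH1 u) (φ : 𝓢(E2, ℝ)) (j : Fin 2) (t : ℝ) :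
    MemH1 (pert u φ j t) := by
  have hd : Differentiable ℝ (pert u φ j t) := fun x => (pert_hasFDeriv hu.1 φ j t x).differentiableAt
  refine ⟨hd, ?_, ?_⟩
  · refine hu.2.1.add ?_
    refine ((sch2 φ).const_mul t).norm.mono' (hd.continuous.sub hu.1.continuous |>.aestronglyMeasurable.congr
      (Eventually.of_forall fun x => by simp [pert])) (Eventually.of_forall fun x => ?_)
    simp [norm_smul, norm_e2basis]
  · have h3 : MemLp (fun x => ‖(∂_{e2basis 0} φ) x‖ + ‖(∂_{e2basis 1} φ) x‖) 2 volume :=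
      (sch2 _).norm.add (sch2 _).norm
    refine (hu.2.2.norm.add (h3.const_mul |t|)).mono' (measurable_fderiv ℝ _).aestronglyMeasurable
      (Eventually.of_forall fun x => ?_)
    rw [(pert_hasFDeriv hu.1 φ j t x).fderiv]
    refine (norm_add_le _ _).trans ?_
    simp only [Pi.add_apply]
    gcongr
    refine ContinuousLinearMap.opNorm_le_bound _ (by positivity) fun y => ?_
    have hy : y = y 0 • e2basis 0 + y 1 • e2basis 1 := by
      ext i; fin_cases i <;> simp [e2basis]
    have : fderiv ℝ φ x y = y 0 * (∂_{e2basis 0} φ) x + y 1 * (∂_{e2basis 1} φ) x := by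
      conv_lhs => rw [hy, map_add, map_smul, map_smul]
      simp [SchwartzMap.lineDerivOp_apply_eq_fderiv]
    simp only [ContinuousLinearMap.smulRight_apply, norm_smul, norm_e2basis, mul_one,
      ContinuousLinearMap.smul_apply, this, Real.norm_eq_abs, smul_eq_mul, abs_mul]
    rw [mul_assoc]
    refine mul_le_mul_of_nonneg_left ?_ (abs_nonneg _)
    refine (abs_add_le _ _).trans ?_
    rw [abs_mul, abs_mul]
    nlinarith [norm_coord_le y 0, norm_coord_le y 1, abs_nonneg ((∂_{e2basis 0} φ) x), abs_nonneg ((∂_{e2basis 1} φ) x)]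

lemma cubic_memLp {u : E2 → E2} (hu : MemLp u 2 volume) (h6 : Integrable (fun x => ‖u x‖ ^ 6)) (j : Fin 2) :
    MemLp (fun x => ‖u x‖ ^ 2 * u x j) 2 volume := by
  have hm : AEStronglyMeasurable (fun x => ‖u x‖ ^ 2 * u x j) volume :=
    (hu.1.norm.pow 2).mul (coord_memLp hu j).1
  rw [memLp_two_iff_integrable_sq_norm hm]
  refine h6.mono' (hm.norm.pow 2) (Eventually.of_forall fun x => ?_)
  rw [Real.norm_of_nonneg (by positivity), norm_mul, Real.norm_of_nonneg (by positivity)]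
  calc (‖u x‖ ^ 2 * ‖u x j‖) ^ 2 ≤ (‖u x‖ ^ 2 * ‖u x‖) ^ 2 := by gcongr; exact norm_coord_le _ _
    _ = ‖u x‖ ^ 6 := by ring

/-- The four pieces of the first variation. -/
def Lvar (ε a : ℝ) (μ : E2 → ℝ) (f : E2 → E2) (u : E2 → E2) (φ : 𝓢(E2, ℝ)) (j : Fin 2) : ℝ :=
  (∫ x, pd u 0 j x * (∂_{e2basis 0} φ) x) + (∫ x, pd u 1 j x * (∂_{e2basis 1} φ) x)
    - (1/ε^2) * (∫ x, u x j * (μ x * φ x)) + (1/ε^2) * (∫ x, ‖u x‖ ^ 2 * u x j * φ x)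
    - (a/ε) * ∫ x, f x j * φ x

lemma four_pert {A B C t : ℝ} (hA : 0 ≤ A) (hC : 0 ≤ C) (h : B ^ 2 ≤ A * C) (ht : |t| ≤ 1) :
    (A + 2 * t * B + t ^ 2 * C) ^ 2 ≤ A ^ 2 + 4 * t * (A * B) + t ^ 2 * (8 * (A * C) + 3 * C ^ 2) := by
  have h1 : t ^ 2 ≤ 1 := by rw [← sq_abs]; exact pow_le_one₀ (abs_nonneg _) ht
  have h2 : 2 * t * (B * C) ≤ B ^ 2 + C ^ 2 := by nlinarith [sq_nonneg (t * B - C), sq_nonneg (B), sq_nonneg (t*B), mul_le_mul_of_nonneg_right h1 (sq_nonneg B)]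
  have h3 : t ^ 2 * C ^ 2 ≤ C ^ 2 := by nlinarith [sq_nonneg C]
  nlinarith [mul_le_mul_of_nonneg_left h2 (sq_nonneg t), mul_le_mul_of_nonneg_left h3 (sq_nonneg t),
    mul_le_mul_of_nonneg_left h (sq_nonneg t)]

lemma Coef.pert_le {μ : E2 → ℝ} {f : E2 → E2} {ε Cμ δ R : ℝ} (h : Coef μ f ε Cμ δ R) (a : ℝ)
    (φ : 𝓢(E2, ℝ)) (j : Fin 2) (M : ℝ) :
    ∃ K : ℝ, ∀ u, MemH1 u → (∫ x, ‖u x‖ ^ 2 + ‖fderiv ℝ u x‖ ^ 2) ≤ M → ∀ t : ℝ, |t| ≤ 1 →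
      energy ε a μ f (pert u φ j t) ≤ energy ε a μ f u + t * Lvar ε a μ f u φ j + t ^ 2 * K := by
  have hε := h.hε
  obtain ⟨B, hB0, hB⟩ := schwartz_le_wt φ
  have hB' : ∀ x, |φ x| ≤ B := fun x => (hB x).trans (mul_le_of_le_one_right hB0 (wt_le_one x))
  have hφ2 : ∀ x, φ x ^ 2 ≤ B ^ 2 := fun x => by rw [← sq_abs]; gcongr; exact hB' x
  set q0 : E2 → ℝ := fun x => ((∂_{e2basis 0} φ) x ^ 2 + (∂_{e2basis 1} φ) x ^ 2) +
    (Cμ / ε ^ 2 + B ^ 2 / ε ^ 2) * φ x ^ 2 with hq0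
  have iq0 : Integrable q0 :=
    ((sq_int (sch2 _)).add (sq_int (sch2 _))).add ((sq_int (sch2 φ)).const_mul _)
  refine ⟨(∫ x, q0 x) + 2 * B ^ 2 / ε ^ 2 * M, fun u hu hM t ht => ?_⟩
  have iu : Integrable (fun x => q0 x + 2 * B ^ 2 / ε ^ 2 * (‖u x‖ ^ 2 + ‖fderiv ℝ u x‖ ^ 2)) :=
    iq0.add ((hu.sq.add hu.dsq).const_mul _)
  have i1 : Integrable (fun x => pd u 0 j x * (∂_{e2basis 0} φ) x) := (hu.pd_memLp 0 j).integrable_mul (sch2 _)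
  have i2 : Integrable (fun x => pd u 1 j x * (∂_{e2basis 1} φ) x) := (hu.pd_memLp 1 j).integrable_mul (sch2 _)
  have i3 : Integrable (fun x => u x j * (μ x * φ x)) :=
    (coord_memLp hu.2.1 j).integrable_mul (bdd_mul_memLp h.hμ.continuous h.hμb (sch2 φ))
  have i4 : Integrable (fun x => ‖u x‖ ^ 2 * u x j * φ x) :=
    (cubic_memLp hu.2.1 hu.six j).integrable_mul (sch2 φ)
  have i5 : Integrable (fun x => f x j * φ x) := (coord_memLp h.hf2 j).integrable_mul (sch2 φ)
  set ell : E2 → ℝ := fun x => pd u 0 j x * (∂_{e2basis 0} φ) x + pd u 1 j x * (∂_{e2basis 1} φ) x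
    - (1/ε^2) * (u x j * (μ x * φ x)) + (1/ε^2) * (‖u x‖ ^ 2 * u x j * φ x)
    - (a/ε) * (f x j * φ x) with hell
  have j1 : Integrable (fun x => pd u 0 j x * (∂_{e2basis 0} φ) x + pd u 1 j x * (∂_{e2basis 1} φ) x) := i1.add i2
  have j2 : Integrable (fun x => pd u 0 j x * (∂_{e2basis 0} φ) x + pd u 1 j x * (∂_{e2basis 1} φ) x
    - (1/ε^2) * (u x j * (μ x * φ x))) := j1.sub (i3.const_mul _)
  have j3 : Integrable (fun x => pd u 0 j x * (∂_{e2basis 0} φ) x + pd u 1 j x * (∂_{e2basis 1} φ) x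
    - (1/ε^2) * (u x j * (μ x * φ x)) + (1/ε^2) * (‖u x‖ ^ 2 * u x j * φ x)) := j2.add (i4.const_mul _)
  have j4 : Integrable ell := j3.sub (i5.const_mul _)
  have hL : ∫ x, ell x = Lvar ε a μ f u φ j := by
    rw [hell, integral_sub j3 (i5.const_mul _), integral_add j2 (i4.const_mul _),
      integral_sub j1 (i3.const_mul _), integral_add i1 i2, integral_const_mul, integral_const_mul,
      integral_const_mul]
    rfl
  have hQ : ∫ x, q0 x + 2 * B ^ 2 / ε ^ 2 * (‖u x‖ ^ 2 + ‖fderiv ℝ u x‖ ^ 2) ≤ (∫ x, q0 x) + 2 * B ^ 2 / ε ^ 2 * M := by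
    have iud : Integrable (fun x => ‖u x‖ ^ 2 + ‖fderiv ℝ u x‖ ^ 2) := hu.sq.add hu.dsq
    rw [integral_add iq0 (iud.const_mul _), integral_const_mul]
    gcongr
  have k1 : Integrable (fun x => dens ε a μ f u x + t * ell x) := (h.dens_int hu).add (j4.const_mul t)
  have k2 : Integrable (fun x => dens ε a μ f u x + t * ell x +
      t ^ 2 * (q0 x + 2 * B ^ 2 / ε ^ 2 * (‖u x‖ ^ 2 + ‖fderiv ℝ u x‖ ^ 2))) := k1.add (iu.const_mul _)
  have main : energy ε a μ f (pert u φ j t) ≤ ∫ x, (dens ε a μ f u x + t * ell x +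
      t ^ 2 * (q0 x + 2 * B ^ 2 / ε ^ 2 * (‖u x‖ ^ 2 + ‖fderiv ℝ u x‖ ^ 2))) := by
    rw [energy_eq]
    refine integral_mono (h.dens_int (memH1_pert hu φ j t)) k2 fun x => ?_
    have g1 : gradSq (pert u φ j t) x = gradSq u x + 2 * t * (pd u 0 j x * (∂_{e2basis 0} φ) x
        + pd u 1 j x * (∂_{e2basis 1} φ) x) + t ^ 2 * ((∂_{e2basis 0} φ) x ^ 2 + (∂_{e2basis 1} φ) x ^ 2) := by
      simp only [gradSq, Fin.sum_univ_two, pert_fderiv hu.1, sq_pert, pd]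
      ring
    have g2 : ‖pert u φ j t x‖ ^ 2 = ‖u x‖ ^ 2 + 2 * t * (φ x * u x j) + t ^ 2 * φ x ^ 2 := by
      rw [pert, sq_pert]; ring
    have g3 : ‖pert u φ j t x‖ ^ 4 ≤ (‖u x‖ ^ 2) ^ 2 + 4 * t * (‖u x‖ ^ 2 * (φ x * u x j)) +
        t ^ 2 * (8 * (‖u x‖ ^ 2 * φ x ^ 2) + 3 * (φ x ^ 2) ^ 2) := by
      have : ‖pert u φ j t x‖ ^ 4 = (‖pert u φ j t x‖ ^ 2) ^ 2 := by ring
      rw [this, g2]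
      refine four_pert (by positivity) (by positivity) ?_ ht
      have : u x j ^ 2 ≤ ‖u x‖ ^ 2 := by rw [← sq_abs]; gcongr; exact norm_coord_le _ _
      nlinarith [sq_nonneg (φ x)]
    have g4 : (inner ℝ (f x) (pert u φ j t x) : ℝ) = inner ℝ (f x) (u x) + t * (f x j * φ x) := by
      rw [pert, inner_add_right, inner_smul_right]
      have : (inner ℝ (f x) (e2basis j) : ℝ) = f x j := by rw [inner_coord]; fin_cases j <;> simp [e2basis]
      rw [this]; ring
    have g5 : ‖u x‖ ^ 2 * φ x ^ 2 ≤ B ^ 2 * (‖u x‖ ^ 2 + ‖fderiv ℝ u x‖ ^ 2) := by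
      rw [mul_comm]
      exact mul_le_mul (hφ2 x) (by nlinarith [sq_nonneg ‖fderiv ℝ u x‖]) (by positivity) (by positivity)
    have g6 : (φ x ^ 2) ^ 2 ≤ B ^ 2 * φ x ^ 2 := by rw [sq (φ x ^ 2)]; exact mul_le_mul_of_nonneg_right (hφ2 x) (sq_nonneg _)
    have g7 : - μ x * φ x ^ 2 ≤ Cμ * φ x ^ 2 := by
      gcongr; exact (neg_le_abs _).trans (h.hμb x)
    simp only [dens, g1, g2, g4, hell, hq0]
    have e1 : (1/(4*ε^2)) * ‖pert u φ j t x‖ ^ 4 ≤ (1/(4*ε^2)) * ((‖u x‖ ^ 2) ^ 2 + 4 * t * (‖u x‖ ^ 2 * (φ x * u x j)) +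
        t ^ 2 * (8 * (B ^ 2 * (‖u x‖ ^ 2 + ‖fderiv ℝ u x‖ ^ 2)) + 3 * (B ^ 2 * φ x ^ 2))) := by
      gcongr
      refine g3.trans ?_
      gcongr
    have e2 : t ^ 2 * ((1/(2*ε^2)) * (- μ x * φ x ^ 2)) ≤ t ^ 2 * ((1/(2*ε^2)) * (Cμ * φ x ^ 2)) := by gcongr
    have hC : 0 ≤ Cμ := (abs_nonneg _).trans (h.hμb x)
    have e3 : 0 ≤ t ^ 2 * ((∂_{e2basis 0} φ) x ^ 2 + (∂_{e2basis 1} φ) x ^ 2) := by positivity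
    have e4 : 0 ≤ t ^ 2 * ((1/(2*ε^2)) * (Cμ * φ x ^ 2)) := by positivity
    have e5 : 0 ≤ t ^ 2 * ((1/(4*ε^2)) * (B ^ 2 * φ x ^ 2)) := by positivity
    have r1 : (1/ε^2) = 4 * (1/(4*ε^2)) := by field_simp
    have r2 : (1/(2*ε^2)) = 2 * (1/(4*ε^2)) := by field_simp; norm_num
    have r3 : Cμ / ε ^ 2 = 4 * (1/(4*ε^2)) * Cμ := by field_simp
    have r4 : B ^ 2 / ε ^ 2 = 4 * (1/(4*ε^2)) * B ^ 2 := by field_simp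
    have r5 : 2 * B ^ 2 / ε ^ 2 = 8 * (1/(4*ε^2)) * B ^ 2 := by field_simp; ring
    rw [r1, r3, r4, r5]
    rw [r2] at e2 e4 ⊢
    generalize (1/(4*ε^2)) = z at *
    have hn : ‖u x‖ ^ 4 = (‖u x‖ ^ 2) ^ 2 := by ring
    rw [hn]
    linarith
  refine main.trans ?_
  rw [integral_add k1 (iu.const_mul _), integral_add (h.dens_int hu) (j4.const_mul t),
    integral_const_mul, integral_const_mul, hL, ← energy_eq]
  gcongr


lemma cubic_diff (y z : E2) (j : Fin 2) :
    |‖y‖ ^ 2 * y j - ‖z‖ ^ 2 * z j| ≤ 2 * (‖y - z‖ * (‖y‖ ^ 2 + ‖z‖ ^ 2)) := by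
  have e : ‖y‖ ^ 2 * y j - ‖z‖ ^ 2 * z j = ‖y‖ ^ 2 * (y j - z j) + ((‖y‖ - ‖z‖) * (‖y‖ + ‖z‖)) * z j := by ring
  have h1 : |y j - z j| ≤ ‖y - z‖ := by simpa using norm_coord_le (y - z) j
  have h2 := abs_norm_sub_norm_le y z
  have h3 := norm_coord_le z j
  rw [e]
  refine (abs_add_le _ _).trans ?_
  rw [abs_mul, abs_mul, abs_mul, abs_of_nonneg (by positivity : 0 ≤ ‖y‖ ^ 2),
    abs_of_nonneg (by positivity : 0 ≤ ‖y‖ + ‖z‖)]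
  have k1 : ‖y‖ ^ 2 * |y j - z j| ≤ ‖y‖ ^ 2 * ‖y - z‖ := by gcongr
  have k2 : |‖y‖ - ‖z‖| * (‖y‖ + ‖z‖) * |z j| ≤ ‖y - z‖ * (‖y‖ + ‖z‖) * ‖z‖ := by gcongr
  have k3 : (‖y‖ + ‖z‖) * ‖z‖ ≤ ‖y‖ ^ 2 + 2 * ‖z‖ ^ 2 := by nlinarith [sq_nonneg (‖y‖ - ‖z‖), sq_nonneg ‖z‖]
  have k4 := mul_le_mul_of_nonneg_left k3 (norm_nonneg (y - z))
  nlinarith [norm_nonneg (y - z)]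

lemma sq_norm_memLp {u : E2 → E2} (hu : MemLp u 2 volume) (h4 : Integrable (fun x => ‖u x‖ ^ 4)) :
    MemLp (fun x => ‖u x‖ ^ 2) 2 volume := by
  have hm : AEStronglyMeasurable (fun x => ‖u x‖ ^ 2) volume := hu.1.norm.pow 2
  rw [memLp_two_iff_integrable_sq_norm hm]
  refine h4.congr (Eventually.of_forall fun x => ?_)
  simp only
  rw [Real.norm_of_nonneg (by positivity)]; ring

lemma wt_norm_memLp {u : E2 → E2} (hu : MemLp u 2 volume) : MemLp (fun x => wt x * ‖u x‖) 2 volume :=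
  bdd_mul_memLp wt_diff.continuous (C := 1)
    (fun x => by rw [abs_of_nonneg (wt_pos x).le]; exact wt_le_one x) hu.norm

lemma Lim.cubic {u : ℕ → E2 → E2} {M : ℝ} {U : E2 → E2} {p : Fin 2 → Fin 2 → E2 → ℝ} (h : Lim u M U p)
    (φ : 𝓢(E2, ℝ)) (j : Fin 2) : Tendsto (fun n => ∫ x, ‖u n x‖ ^ 2 * u n x j * φ x) atTop
      (𝓝 (∫ x, ‖U x‖ ^ 2 * U x j * φ x)) := by
  obtain ⟨C, hC0, hC⟩ := schwartz_le_wt φ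
  have hf : ∀ n, MemLp (fun x => wt x * ‖u n x - U x‖) 2 volume := fun n => wt_norm_memLp ((h.hu n).2.1.sub h.hU)
  have hg : ∀ n, MemLp (fun x => ‖u n x‖ ^ 2 + ‖U x‖ ^ 2) 2 volume := fun n =>
    (sq_norm_memLp (h.hu n).2.1 (h.hu n).four).add (sq_norm_memLp h.hU h.U4)
  have hb : ∀ n, ∫ x, (‖u n x‖ ^ 2 + ‖U x‖ ^ 2) ^ 2 ≤ 2 * (4 * M ^ 2) + 2 * ∫ x, ‖U x‖ ^ 4 := by
    intro n
    have i1 := (h.hu n).four.const_mul 2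
    have i2 := h.U4.const_mul 2
    refine (integral_mono (sq_int (hg n)) (i1.add i2) fun x => ?_).trans ?_
    · simp only [Pi.add_apply]
      nlinarith [sq_nonneg (‖u n x‖ ^ 2 - ‖U x‖ ^ 2)]
    · rw [integral_add' i1 i2, integral_const_mul, integral_const_mul]
      have := (H1_L4L6 (h.hu n) (h.hM n)).2.2.1
      linarith
  have hs : Tendsto (fun n => ∫ x, (wt x * ‖u n x - U x‖) ^ 2) atTop (𝓝 0) := by
    simpa only [mul_pow] using h.str
  have key := (cs_tendsto hf hg hb hs).const_mul (2 * C)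
  rw [mul_zero] at key
  rw [tendsto_iff_norm_sub_tendsto_zero]
  refine squeeze_zero (fun n => norm_nonneg _) (fun n => ?_) key
  have i1 : Integrable (fun x => ‖u n x‖ ^ 2 * u n x j * φ x) :=
    (cubic_memLp (h.hu n).2.1 (h.hu n).six j).integrable_mul (sch2 φ)
  have i2 : Integrable (fun x => ‖U x‖ ^ 2 * U x j * φ x) :=
    (cubic_memLp h.hU h.U6 j).integrable_mul (sch2 φ)
  rw [← integral_sub i1 i2, ← integral_const_mul]
  refine (norm_integral_le_integral_norm _).trans ?_
  refine integral_mono (i1.sub i2).norm (((hf n).integrable_mul (hg n)).norm.const_mul _) fun x => ?_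
  simp only [Pi.mul_apply]
  rw [← sub_mul, norm_mul, Real.norm_eq_abs, Real.norm_eq_abs]
  have hw := (wt_pos x).le
  rw [abs_of_nonneg (by positivity : 0 ≤ wt x * ‖u n x - U x‖ * (‖u n x‖ ^ 2 + ‖U x‖ ^ 2))]
  calc _ ≤ 2 * (‖u n x - U x‖ * (‖u n x‖ ^ 2 + ‖U x‖ ^ 2)) * (C * wt x) := by
        gcongr
        · exact cubic_diff _ _ _
        · exact hC x
    _ = _ := by ring

lemma Lim.var {u : ℕ → E2 → E2} {M : ℝ} {U : E2 → E2} {p : Fin 2 → Fin 2 → E2 → ℝ} (h : Lim u M U p)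
    {μ : E2 → ℝ} {f : E2 → E2} {ε Cμ δ R : ℝ} (hc : Coef μ f ε Cμ δ R) {a m : ℝ}
    (hm : ∀ w, MemH1 w → m ≤ energy ε a μ f w)
    (hE : Tendsto (fun n => energy ε a μ f (u n)) atTop (𝓝 m)) (φ : 𝓢(E2, ℝ)) (j : Fin 2) :
    (∫ x, p 0 j x * (∂_{e2basis 0} φ) x) + (∫ x, p 1 j x * (∂_{e2basis 1} φ) x)
    - (1/ε^2) * (∫ x, U x j * (μ x * φ x)) + (1/ε^2) * (∫ x, ‖U x‖ ^ 2 * U x j * φ x)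
    - (a/ε) * (∫ x, f x j * φ x) = 0 := by
  set L := (∫ x, p 0 j x * (∂_{e2basis 0} φ) x) + (∫ x, p 1 j x * (∂_{e2basis 1} φ) x)
    - (1/ε^2) * (∫ x, U x j * (μ x * φ x)) + (1/ε^2) * (∫ x, ‖U x‖ ^ 2 * U x j * φ x)
    - (a/ε) * (∫ x, f x j * φ x) with hL
  have hT : Tendsto (fun n => Lvar ε a μ f (u n) φ j) atTop (𝓝 L) := by
    refine Tendsto.sub (Tendsto.add (Tendsto.sub (Tendsto.add ?_ ?_) (Tendsto.const_mul _ ?_))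
      (Tendsto.const_mul _ ?_)) tendsto_const_nhds
    · exact h.wp 0 j _ (sch2 _)
    · exact h.wp 1 j _ (sch2 _)
    · exact h.wU j _ (bdd_mul_memLp hc.hμ.continuous hc.hμb (sch2 φ))
    · exact h.cubic φ j
  obtain ⟨K, hK⟩ := hc.pert_le a φ j M
  have key : ∀ t : ℝ, |t| ≤ 1 → 0 ≤ t * L + t ^ 2 * K := by
    intro t ht
    have h1 : Tendsto (fun n => energy ε a μ f (u n) + t * Lvar ε a μ f (u n) φ j + t ^ 2 * K) atTop
      (𝓝 (m + t * L + t ^ 2 * K)) := (hE.add (hT.const_mul t)).add_const _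
    have := ge_of_tendsto h1 (Eventually.of_forall fun n =>
      (hm _ (memH1_pert (h.hu n) φ j t)).trans (hK _ (h.hu n) (h.hM n) t ht))
    linarith
  have k2 : ∀ s : ℝ, 0 < s → s ≤ 1 → |L| ≤ s * K := by
    intro s hs hs1
    have a1 := key s (by rw [abs_of_pos hs]; exact hs1)
    have a2 := key (-s) (by rw [abs_neg, abs_of_pos hs]; exact hs1)
    rw [abs_le]
    constructor <;> nlinarith
  have k3 : |L| ≤ 0 := by
    have h1 : Tendsto (fun s : ℝ => s * K) (𝓝[>] 0) (𝓝 (0 * K)) :=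
      (tendsto_nhdsWithin_of_tendsto_nhds tendsto_id).mul_const K
    rw [zero_mul] at h1
    refine ge_of_tendsto h1 ?_
    filter_upwards [Ioc_mem_nhdsGT (show (0:ℝ) < 1 by norm_num)] with s hs using k2 s hs.1 hs.2
  exact abs_nonpos_iff.1 k3

lemma Lim.parts {u : ℕ → E2 → E2} {M : ℝ} {U : E2 → E2} {p : Fin 2 → Fin 2 → E2 → ℝ} (h : Lim u M U p)
    (φ : 𝓢(E2, ℝ)) (i j : Fin 2) : ∫ x, p i j x * φ x = - ∫ x, U x j * (∂_{e2basis i} φ) x := by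
  have h1 := h.wp i j φ (sch2 φ)
  have h2 := (h.wU j _ (sch2 (∂_{e2basis i} φ))).neg
  refine tendsto_nhds_unique h1 (h2.congr fun n => ?_)
  have := integral_mul_fderiv_eq_neg_fderiv_mul_of_integrable (μ := (volume : Measure E2)) (f := fun x => u n x j) (g := φ)
    (v := e2basis i) (by
      have := ((h.hu n).pd_memLp i j).integrable_mul (sch2 φ)
      refine this.congr (Eventually.of_forall fun x => ?_)
      simp only [Pi.mul_apply, pd_eq (h.hu n).1]) (by
      have := (coord_memLp (h.hu n).2.1 j).integrable_mul (sch2 (∂_{e2basis i} φ))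
      refine this.congr (Eventually.of_forall fun x => ?_)
      simp only [Pi.mul_apply, SchwartzMap.lineDerivOp_apply_eq_fderiv])
      ((coord_memLp (h.hu n).2.1 j).integrable_mul (sch2 φ)) (fun x _ => (h.hu n).coord_diff j x)
      (fun x _ => φ.differentiable x)
  simp only [pd_eq (h.hu n).1, SchwartzMap.lineDerivOp_apply_eq_fderiv]
  rw [this, neg_neg]

/-- The nonlinearity. -/
def Hn (ε a : ℝ) (μ : E2 → ℝ) (f : E2 → E2) (U : E2 → E2) (j : Fin 2) (x : E2) : ℝ :=
  (1/ε^2) * (μ x * U x j - ‖U x‖ ^ 2 * U x j) + (a/ε) * f x j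

lemma Hn_memLp {μ : E2 → ℝ} {f : E2 → E2} {ε Cμ δ R : ℝ} (hc : Coef μ f ε Cμ δ R) (a : ℝ)
    {U : E2 → E2} (hU : MemLp U 2 volume) (h6 : Integrable (fun x => ‖U x‖ ^ 6)) (j : Fin 2) :
    MemLp (Hn ε a μ f U j) 2 volume :=
  (((bdd_mul_memLp hc.hμ.continuous hc.hμb (coord_memLp hU j)).sub (cubic_memLp hU h6 j)).const_mul _).add
    ((coord_memLp hc.hf2 j).const_mul _)

lemma Lim.weakEq {u : ℕ → E2 → E2} {M : ℝ} {U : E2 → E2} {p : Fin 2 → Fin 2 → E2 → ℝ} (h : Lim u M U p)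
    {μ : E2 → ℝ} {f : E2 → E2} {ε Cμ δ R : ℝ} (hc : Coef μ f ε Cμ δ R) {a m : ℝ}
    (hm : ∀ w, MemH1 w → m ≤ energy ε a μ f w)
    (hE : Tendsto (fun n => energy ε a μ f (u n)) atTop (𝓝 m)) (φ : 𝓢(E2, ℝ)) (j : Fin 2) :
    ∫ x, U x j * ((∂_{e2basis 0} (∂_{e2basis 0} φ)) x + (∂_{e2basis 1} (∂_{e2basis 1} φ)) x) =
      - ∫ x, Hn ε a μ f U j x * φ x := by
  have h1 := h.var hc hm hE φ j
  rw [h.parts, h.parts] at h1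
  have i1 : Integrable (fun x => U x j * (∂_{e2basis 0} (∂_{e2basis 0} φ)) x) :=
    (coord_memLp h.hU j).integrable_mul (sch2 _)
  have i2 : Integrable (fun x => U x j * (∂_{e2basis 1} (∂_{e2basis 1} φ)) x) :=
    (coord_memLp h.hU j).integrable_mul (sch2 _)
  have i3 : Integrable (fun x => U x j * (μ x * φ x)) :=
    (coord_memLp h.hU j).integrable_mul (bdd_mul_memLp hc.hμ.continuous hc.hμb (sch2 φ))
  have i4 : Integrable (fun x => ‖U x‖ ^ 2 * U x j * φ x) :=
    (cubic_memLp h.hU h.U6 j).integrable_mul (sch2 φ)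
  have i5 : Integrable (fun x => f x j * φ x) := (coord_memLp hc.hf2 j).integrable_mul (sch2 φ)
  have e1 : ∀ x, Hn ε a μ f U j x * φ x = ((1/ε^2) * (U x j * (μ x * φ x)) - (1/ε^2) * (‖U x‖ ^ 2 * U x j * φ x))
      + (a/ε) * (f x j * φ x) := fun x => by unfold Hn; ring
  simp_rw [e1, mul_add]
  have i6 : Integrable (fun x => (1/ε^2) * (U x j * (μ x * φ x)) - (1/ε^2) * (‖U x‖ ^ 2 * U x j * φ x)) :=
    (i3.const_mul _).sub (i4.const_mul _)
  rw [integral_add i1 i2, integral_add i6 (i5.const_mul _), integral_sub (i3.const_mul _) (i4.const_mul _),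
    integral_const_mul, integral_const_mul, integral_const_mul]
  linarith


lemma Coef.mu_le {μ : E2 → ℝ} {f : E2 → E2} {ε Cμ δ R : ℝ} (hc : Coef μ f ε Cμ δ R) (x : E2) :
    μ x ≤ Cμ * (1 + R ^ 2) ^ 2 * wt x ^ 2 := by
  have hC : 0 ≤ Cμ := (abs_nonneg _).trans (hc.hμb x)
  have hw := wt_pos x
  by_cases hx : R ≤ ‖x‖
  · have := hc.hneg x hx
    have := hc.hδ
    have : 0 ≤ Cμ * (1 + R ^ 2) ^ 2 * wt x ^ 2 := by positivity
    linarith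
  · push Not at hx
    have h1 : ‖x‖ ^ 2 ≤ R ^ 2 := by gcongr
    have h2 : 1 ≤ (1 + R ^ 2) * wt x := by
      unfold wt
      rw [← div_eq_mul_inv, le_div_iff₀ (by positivity)]
      linarith
    have h3 : 1 ≤ ((1 + R ^ 2) * wt x) ^ 2 := one_le_pow₀ h2
    calc μ x ≤ Cμ := (le_abs_self _).trans (hc.hμb x)
      _ ≤ Cμ * ((1 + R ^ 2) * wt x) ^ 2 := le_mul_of_one_le_right hC h3
      _ = _ := by ring

lemma weak_diff {g : ℕ → E2 → ℝ} {G v k : E2 → ℝ} (hg : ∀ n, MemLp (g n) 2 volume)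
    (hv : MemLp v 2 volume) (hk : MemLp k 2 volume) (hG : v =ᵐ[volume] G)
    (hw : Tendsto (fun n => ∫ x, g n x * k x) atTop (𝓝 (∫ x, G x * k x))) :
    Tendsto (fun n => ∫ x, k x * (g n x - v x)) atTop (𝓝 0) := by
  have e : ∫ x, G x * k x = ∫ x, v x * k x := integral_congr_ae (by
    filter_upwards [hG] with x hx; rw [hx])
  rw [e] at hw
  have h2 := hw.sub_const (∫ x, v x * k x)
  rw [sub_self] at h2
  refine h2.congr fun n => ?_
  have i1 : Integrable (fun x => g n x * k x) := (hg n).integrable_mul hk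
  have i2 : Integrable (fun x => v x * k x) := hv.integrable_mul hk
  rw [← integral_sub i1 i2]
  refine integral_congr_ae (Eventually.of_forall fun x => ?_)
  simp only; ring

lemma Lim.lsc {u : ℕ → E2 → E2} {M : ℝ} {U : E2 → E2} {p : Fin 2 → Fin 2 → E2 → ℝ} (h : Lim u M U p)
    {μ : E2 → ℝ} {f : E2 → E2} {ε Cμ δ R : ℝ} (hc : Coef μ f ε Cμ δ R) {a m : ℝ}
    (hE : Tendsto (fun n => energy ε a μ f (u n)) atTop (𝓝 m)) {v : E2 → E2} (hv : MemH1 v)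
    (hvU : v =ᵐ[volume] U) (hvp : ∀ i j, pd v i j =ᵐ[volume] p i j) : energy ε a μ f v ≤ m := by
  have hε := hc.hε
  set K := Cμ * (1 + R ^ 2) ^ 2 / (2 * ε ^ 2) with hK
  have tp : ∀ i j, Tendsto (fun n => ∫ x, pd v i j x * (pd (u n) i j x - pd v i j x)) atTop (𝓝 0) :=
    fun i j => weak_diff (fun n => (h.hu n).pd_memLp i j) (hv.pd_memLp i j) (hv.pd_memLp i j) (hvp i j)
      (h.wp i j _ (hv.pd_memLp i j))
  have mH : ∀ j, MemLp (Hn ε a μ f v j) 2 volume := Hn_memLp hc a hv.2.1 hv.six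
  have tH : ∀ j, Tendsto (fun n => ∫ x, Hn ε a μ f v j x * (u n x j - v x j)) atTop (𝓝 0) :=
    fun j => weak_diff (fun n => coord_memLp (h.hu n).2.1 j) (coord_memLp hv.2.1 j) (mH j)
      (by filter_upwards [hvU] with x hx; rw [hx]) (h.wU j _ (mH j))
  have tS : Tendsto (fun n => ∫ x, wt x ^ 2 * ‖u n x - v x‖ ^ 2) atTop (𝓝 0) := by
    refine h.str.congr fun n => integral_congr_ae ?_
    filter_upwards [hvU] with x hx; rw [hx]
  have ip : ∀ n i j, Integrable (fun x => pd v i j x * (pd (u n) i j x - pd v i j x)) := fun n i j =>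
    (hv.pd_memLp i j).integrable_mul (((h.hu n).pd_memLp i j).sub (hv.pd_memLp i j))
  have iH : ∀ n j, Integrable (fun x => Hn ε a μ f v j x * (u n x j - v x j)) := fun n j =>
    (mH j).integrable_mul ((coord_memLp (h.hu n).2.1 j).sub (coord_memLp hv.2.1 j))
  have iS : ∀ n, Integrable (fun x => wt x ^ 2 * ‖u n x - v x‖ ^ 2) := fun n =>
    wt_mul_int ((memLp_two_iff_integrable_sq_norm ((h.hu n).2.1.sub hv.2.1).1).1 ((h.hu n).2.1.sub hv.2.1))
  have main : ∀ n, energy ε a μ f v + (((∫ x, pd v 0 0 x * (pd (u n) 0 0 x - pd v 0 0 x))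
      + (∫ x, pd v 0 1 x * (pd (u n) 0 1 x - pd v 0 1 x)))
      + ((∫ x, pd v 1 0 x * (pd (u n) 1 0 x - pd v 1 0 x))
      + (∫ x, pd v 1 1 x * (pd (u n) 1 1 x - pd v 1 1 x)))
      - ((∫ x, Hn ε a μ f v 0 x * (u n x 0 - v x 0)) + ∫ x, Hn ε a μ f v 1 x * (u n x 1 - v x 1))
      - K * ∫ x, wt x ^ 2 * ‖u n x - v x‖ ^ 2) ≤ energy ε a μ f (u n) := by
    intro n
    rw [← integral_add' (ip n 0 0) (ip n 0 1), ← integral_add' (ip n 1 0) (ip n 1 1),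
      ← integral_add' ((ip n 0 0).add (ip n 0 1)) ((ip n 1 0).add (ip n 1 1)),
      ← integral_add' (iH n 0) (iH n 1),
      ← integral_sub' (((ip n 0 0).add (ip n 0 1)).add ((ip n 1 0).add (ip n 1 1))) ((iH n 0).add (iH n 1)),
      ← integral_const_mul,
      ← integral_sub' ((((ip n 0 0).add (ip n 0 1)).add ((ip n 1 0).add (ip n 1 1))).sub ((iH n 0).add (iH n 1)))
        ((iS n).const_mul K), energy_eq,
      ← integral_add' (hc.dens_int hv) (((((ip n 0 0).add (ip n 0 1)).add ((ip n 1 0).add (ip n 1 1))).sub ((iH n 0).add (iH n 1))).sub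
        ((iS n).const_mul K)), energy_eq]
    refine integral_mono ((hc.dens_int hv).add (((((ip n 0 0).add (ip n 0 1)).add ((ip n 1 0).add (ip n 1 1))).sub
      ((iH n 0).add (iH n 1))).sub ((iS n).const_mul K))) (hc.dens_int (h.hu n)) fun x => ?_
    simp only [Pi.add_apply, Pi.sub_apply]
    have g1 : gradSq v x / 2 + ((pd v 0 0 x * (pd (u n) 0 0 x - pd v 0 0 x) + pd v 0 1 x * (pd (u n) 0 1 x - pd v 0 1 x))
        + (pd v 1 0 x * (pd (u n) 1 0 x - pd v 1 0 x) + pd v 1 1 x * (pd (u n) 1 1 x - pd v 1 1 x)))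
        ≤ gradSq (u n) x / 2 := by
      rw [gradSq_eq, gradSq_eq]
      nlinarith [sq_nonneg (pd (u n) 0 0 x - pd v 0 0 x), sq_nonneg (pd (u n) 0 1 x - pd v 0 1 x),
        sq_nonneg (pd (u n) 1 0 x - pd v 1 0 x), sq_nonneg (pd (u n) 1 1 x - pd v 1 1 x)]
    have g2 : ‖u n x - v x‖ ^ 2 = (u n x 0 - v x 0) ^ 2 + (u n x 1 - v x 1) ^ 2 := by
      rw [norm_sq_coord]; simp
    have g3 : (1/(2*ε^2)) * (μ x * ‖u n x - v x‖ ^ 2) ≤ K * (wt x ^ 2 * ‖u n x - v x‖ ^ 2) := by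
      have := mul_le_mul_of_nonneg_right (hc.mu_le x) (sq_nonneg ‖u n x - v x‖)
      have h2 := mul_le_mul_of_nonneg_left this (by positivity : 0 ≤ 1/(2*ε^2))
      refine h2.trans (le_of_eq ?_)
      rw [hK]; ring
    have n1 := norm_sq_coord (u n x)
    have n2 := norm_sq_coord (v x)
    have g4 : (‖v x‖ ^ 2) ^ 2 + 4 * (‖v x‖ ^ 2 * (v x 0 * (u n x 0 - v x 0) + v x 1 * (u n x 1 - v x 1)))
        ≤ (‖u n x‖ ^ 2) ^ 2 := by
      have hs : 2 * (v x 0 * (u n x 0 - v x 0) + v x 1 * (u n x 1 - v x 1)) ≤ ‖u n x‖ ^ 2 - ‖v x‖ ^ 2 := by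
        rw [n1, n2]
        nlinarith [sq_nonneg (u n x 0 - v x 0), sq_nonneg (u n x 1 - v x 1)]
      nlinarith [mul_le_mul_of_nonneg_left hs (sq_nonneg ‖v x‖), sq_nonneg (‖u n x‖ ^ 2 - ‖v x‖ ^ 2)]
    have g5 := mul_le_mul_of_nonneg_left g4 (by positivity : 0 ≤ 1/(4*ε^2))
    have q1 : ∀ y : ℝ, y ^ 4 = (y ^ 2) ^ 2 := fun y => by ring
    simp only [dens, Hn, inner_coord, q1]
    have r1 : (1/ε^2) = 4 * (1/(4*ε^2)) := by field_simp
    have r2 : (1/(2*ε^2)) = 2 * (1/(4*ε^2)) := by field_simp; norm_num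
    rw [r1, r2]
    rw [r2, g2] at g3
    rw [g2]
    generalize (1/(4*ε^2)) = z at *
    have g6 : z * (μ x * ‖u n x‖ ^ 2) = z * (μ x * (u n x 0 ^ 2 + u n x 1 ^ 2)) := by rw [n1]
    have g7 : z * (μ x * ‖v x‖ ^ 2) = z * (μ x * (v x 0 ^ 2 + v x 1 ^ 2)) := by rw [n2]
    linarith
  have lim := ((((tp 0 0).add (tp 0 1)).add ((tp 1 0).add (tp 1 1))).sub ((tH 0).add (tH 1))).sub (tS.const_mul K)
  have lim2 := lim.const_add (energy ε a μ f v)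
  have := le_of_tendsto_of_tendsto' lim2 hE main
  simpa using this


/-- Real part of a Schwartz function. -/
def reS (φ : 𝓢(E2, ℂ)) : 𝓢(E2, ℝ) := φ.postcompCLM (𝕜 := ℝ) Complex.reCLM

/-- Imaginary part of a Schwartz function. -/
def imS (φ : 𝓢(E2, ℂ)) : 𝓢(E2, ℝ) := φ.postcompCLM (𝕜 := ℝ) Complex.imCLM

lemma reS_apply (φ : 𝓢(E2, ℂ)) (x : E2) : reS φ x = (φ x).re := rfl
lemma imS_apply (φ : 𝓢(E2, ℂ)) (x : E2) : imS φ x = (φ x).im := rfl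

lemma reS_deriv (φ : 𝓢(E2, ℂ)) (m : E2) : ∂_{m} (reS φ) = reS (∂_{m} φ) := by
  ext x
  rw [reS_apply, SchwartzMap.lineDerivOp_apply_eq_fderiv, SchwartzMap.lineDerivOp_apply_eq_fderiv]
  have h1 : HasFDerivAt (reS φ) (Complex.reCLM.comp (fderiv ℝ φ x)) x :=
    Complex.reCLM.hasFDerivAt.comp x (φ.differentiable x).hasFDerivAt
  rw [h1.fderiv]; rfl

lemma imS_deriv (φ : 𝓢(E2, ℂ)) (m : E2) : ∂_{m} (imS φ) = imS (∂_{m} φ) := by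
  ext x
  rw [imS_apply, SchwartzMap.lineDerivOp_apply_eq_fderiv, SchwartzMap.lineDerivOp_apply_eq_fderiv]
  have h1 : HasFDerivAt (imS φ) (Complex.imCLM.comp (fderiv ℝ φ x)) x :=
    Complex.imCLM.hasFDerivAt.comp x (φ.differentiable x).hasFDerivAt
  rw [h1.fderiv]; rfl

lemma real_mul_int {w : E2 → ℝ} (hw : MemLp w 2 volume) (φ : 𝓢(E2, ℂ)) :
    Integrable (fun x => (w x : ℂ) * φ x) :=
  hw.ofReal.integrable_mul (φ.memLp 2 volume)

lemma int_split {w : E2 → ℝ} (hw : MemLp w 2 volume) (φ : 𝓢(E2, ℂ)) :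
    ∫ x, (w x : ℂ) * φ x = ((∫ x, w x * reS φ x : ℝ) : ℂ) + ((∫ x, w x * imS φ x : ℝ) : ℂ) * Complex.I := by
  have := integral_re_add_im (real_mul_int hw φ)
  rw [← this]
  simp [reS_apply, imS_apply]

lemma lap_sum (φ : 𝓢(E2, ℂ)) : Δ φ = ∂_{e2basis 0} (∂_{e2basis 0} φ) + ∂_{e2basis 1} (∂_{e2basis 1} φ) := by
  rw [SchwartzMap.laplacian_eq_sum (EuclideanSpace.basisFun (Fin 2) ℝ)]; simp [e2basis]

lemma cplx_weak {w H : E2 → ℝ} (hw : MemLp w 2 volume) (hH : MemLp H 2 volume)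
    (h : ∀ φ : 𝓢(E2, ℝ), ∫ x, w x * ((∂_{e2basis 0} (∂_{e2basis 0} φ)) x + (∂_{e2basis 1} (∂_{e2basis 1} φ)) x) =
      - ∫ x, H x * φ x) (φ : 𝓢(E2, ℂ)) :
    ∫ x, (w x : ℂ) * (Δ φ) x = - ∫ x, (H x : ℂ) * φ x := by
  rw [int_split hw, int_split hH]
  have e1 : ∀ x, reS (Δ φ) x = (∂_{e2basis 0} (∂_{e2basis 0} (reS φ))) x + (∂_{e2basis 1} (∂_{e2basis 1} (reS φ))) x := by
    intro x
    rw [lap_sum]; simp [reS_deriv, reS_apply]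
  have e2 : ∀ x, imS (Δ φ) x = (∂_{e2basis 0} (∂_{e2basis 0} (imS φ))) x + (∂_{e2basis 1} (∂_{e2basis 1} (imS φ))) x := by
    intro x
    rw [lap_sum]; simp [imS_deriv, imS_apply]
  simp_rw [e1, e2]
  rw [h, h]
  push_cast
  ring

lemma Lop_int {w : E2 → ℝ} (hw : MemLp w 2 volume) (φ : 𝓢(E2, ℂ)) :
    ∫ x, (w x : ℂ) * Lop φ x = (∫ x, (w x : ℂ) * φ x) - ((1 / (4 * π ^ 2) : ℝ) : ℂ) * ∫ x, (w x : ℂ) * (Δ φ) x := by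
  rw [← integral_const_mul, ← integral_sub (real_mul_int hw φ) ((real_mul_int hw (Δ φ)).const_mul _)]
  refine integral_congr_ae (Eventually.of_forall fun x => ?_)
  simp only [Lop, sub_apply, smul_apply, smul_eq_mul]
  ring

lemma first_reg {w H : E2 → ℝ} (hw : MemLp w 2 volume) (hH : MemLp H 2 volume)
    (h : ∀ φ : 𝓢(E2, ℂ), ∫ x, (w x : ℂ) * (Δ φ) x = - ∫ x, (H x : ℂ) * φ x) :
    ∃ v : E2 → ℝ, WK 0 (fun x => (v x : ℂ)) ∧ w =ᵐ[volume] v := by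
  have hwl : LocallyIntegrable (fun x => (w x : ℂ)) :=
    (hw.ofReal (K := ℂ)).locallyIntegrable (by norm_num)
  obtain ⟨W, hW, hae⟩ := gainL2 (G := fun x => (w x : ℂ) + ((1 / (4 * π ^ 2) : ℝ) : ℂ) * (H x : ℂ)) hwl
    (real_mul_int hw) ((hw.ofReal (K := ℂ)).add ((hH.ofReal (K := ℂ)).const_mul _)) (fun φ => by
      rw [Lop_int hw, h]
      simp_rw [add_mul, mul_assoc]
      rw [integral_add (real_mul_int hw φ) ((real_mul_int hH φ).const_mul _), integral_const_mul]
      ring)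
  have e : (fun x => ((W x).re : ℂ)) = W := by
    have : (fun x => ((W x).re : ℂ)) =ᵐ[volume] W := by
      filter_upwards [hae] with x hx
      rw [← hx]; simp
    exact MeasureTheory.Measure.eq_of_ae_eq this
      (Complex.continuous_ofReal.comp (Complex.continuous_re.comp hW.continuous)) hW.continuous
  refine ⟨fun x => (W x).re, by rw [e]; exact hW, ?_⟩
  filter_upwards [hae] with x hx
  rw [← hx]; simp


/-- Product of Schwartz functions. -/
def mulS (χ φ : 𝓢(E2, ℂ)) : 𝓢(E2, ℂ) := SchwartzMap.smulLeftCLM ℂ χ φ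

lemma mulS_apply (χ φ : 𝓢(E2, ℂ)) (x : E2) : mulS χ φ x = χ x * φ x := by
  unfold mulS
  rw [SchwartzMap.smulLeftCLM_apply_apply χ.hasTemperateGrowth]; rfl

lemma mulS_deriv (χ φ : 𝓢(E2, ℂ)) (m x : E2) :
    (∂_{m} (mulS χ φ)) x = (∂_{m} χ) x * φ x + χ x * (∂_{m} φ) x := by
  simp only [SchwartzMap.lineDerivOp_apply_eq_fderiv]
  have h1 : HasFDerivAt (mulS χ φ) (χ x • fderiv ℝ φ x + φ x • fderiv ℝ χ x) x := by
    have := (χ.differentiable x).hasFDerivAt.mul (φ.differentiable x).hasFDerivAt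
    refine this.congr_of_eventuallyEq (Eventually.of_forall fun y => ?_)
    simp [mulS_apply]
  rw [h1.fderiv]
  simp; ring

lemma mulS_deriv' (χ φ : 𝓢(E2, ℂ)) (m : E2) :
    ∂_{m} (mulS χ φ) = mulS (∂_{m} χ) φ + mulS χ (∂_{m} φ) := by
  ext x
  rw [mulS_deriv]; simp [mulS_apply]

lemma mulS_lap (χ φ : 𝓢(E2, ℂ)) (x : E2) :
    (Δ (mulS χ φ)) x = χ x * (Δ φ) x + (Δ χ) x * φ x +
      2 * ((∂_{e2basis 0} χ) x * (∂_{e2basis 0} φ) x + (∂_{e2basis 1} χ) x * (∂_{e2basis 1} φ) x) := by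
  rw [lap_sum, lap_sum, lap_sum]
  simp only [mulS_deriv', LineDeriv.lineDerivOp_add, add_apply, mulS_apply]
  ring

lemma supp_deriv {χ : 𝓢(E2, ℂ)} (h : HasCompactSupport χ) (m : E2) : HasCompactSupport (∂_{m} χ : 𝓢(E2, ℂ)) := by
  have := h.fderiv_apply (𝕜 := ℝ) m
  have e : (fun x => fderiv ℝ χ x m) = (∂_{m} χ : 𝓢(E2, ℂ)) := by
    ext x; rw [SchwartzMap.lineDerivOp_apply_eq_fderiv]
  rw [← e]; exact this

lemma supp_lap {χ : 𝓢(E2, ℂ)} (h : HasCompactSupport χ) : HasCompactSupport (Δ χ : 𝓢(E2, ℂ)) := by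
  rw [lap_sum]
  exact (supp_deriv (supp_deriv h _) _).add (supp_deriv (supp_deriv h _) _)

/-- Local version of the Wiener regularity class. -/
def Loc (k : ℕ) (g : E2 → ℂ) : Prop :=
  ∀ χ : 𝓢(E2, ℂ), HasCompactSupport χ → WK k (fun x => χ x * g x)

lemma Loc.add {k : ℕ} {g h : E2 → ℂ} (hg : Loc k g) (hh : Loc k h) : Loc k (fun x => g x + h x) := by
  intro χ hχ
  have := (hg χ hχ).add (hh χ hχ)
  simpa only [mul_add] using this

lemma Loc.const_mul {k : ℕ} {g : E2 → ℂ} (hg : Loc k g) (c : ℂ) : Loc k (fun x => c * g x) := by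
  intro χ hχ
  have := (hg χ hχ).const_mul c
  simpa only [mul_left_comm] using this

lemma cutoff {K : Set E2} (hK : IsCompact K) : ∃ χ : 𝓢(E2, ℂ), HasCompactSupport χ ∧ ∀ x ∈ K, χ x = 1 := by
  obtain ⟨r, hr⟩ := hK.isBounded.subset_closedBall 0
  let b : ContDiffBump (0 : E2) := ⟨max r 1, max r 1 + 1, by positivity, by linarith⟩
  have h1 : HasCompactSupport (fun x => (b x : ℂ)) := b.hasCompactSupport.comp_left (g := fun y : ℝ => (y : ℂ)) (by simp)
  have h2 : ContDiff ℝ (⊤ : ℕ∞) (fun x => (b x : ℂ)) := Complex.ofRealCLM.contDiff.comp b.contDiff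
  refine ⟨h1.toSchwartzMap h2, h1, fun x hx => ?_⟩
  have : b x = 1 := b.one_of_mem_closedBall (Metric.closedBall_subset_closedBall (le_max_left _ _) (hr hx))
  change (b x : ℂ) = 1
  rw [this]; simp

lemma Loc.mul {k : ℕ} {g h : E2 → ℂ} (hg : Loc k g) (hh : Loc k h) : Loc k (fun x => g x * h x) := by
  intro χ hχ
  obtain ⟨χ', h1, h2⟩ := cutoff hχ
  have := (hg χ hχ).mul (hh χ' h1)
  refine (congrArg (WK k) (funext fun x => ?_)).mp this
  by_cases hx : x ∈ tsupport χ
  · rw [h2 x hx]; ring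
  · rw [image_eq_zero_of_notMem_tsupport hx]; ring

lemma Loc.smooth (k : ℕ) {g : E2 → ℂ} (hg : ContDiff ℝ (⊤ : ℕ∞) g) : Loc k g := by
  intro χ hχ
  have h1 : HasCompactSupport (fun x => χ x * g x) := hχ.mul_right
  have h2 : ContDiff ℝ (⊤ : ℕ∞) (fun x => χ x * g x) := (χ.smooth _).mul hg
  exact WK.schwartz k (h1.toSchwartzMap h2)

lemma Loc.contDiff {k : ℕ} {g : E2 → ℂ} (hg : Loc k g) : ContDiff ℝ k g := by
  rw [contDiff_iff_contDiffAt]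
  intro x
  obtain ⟨χ, h1, h2⟩ := cutoff (isCompact_closedBall x 1)
  refine (hg χ h1).contDiff.contDiffAt.congr_of_eventuallyEq ?_
  filter_upwards [Metric.closedBall_mem_nhds x one_pos] with y hy
  rw [h2 y hy, one_mul]

lemma boot {w H : E2 → ℝ} (hw : MemLp w 2 volume) (hH : MemLp H 2 volume)
    (h : ∀ φ : 𝓢(E2, ℂ), ∫ x, (w x : ℂ) * (Δ φ) x = - ∫ x, (H x : ℂ) * φ x) (hwc : Continuous w)
    {k : ℕ} (h1 : Loc k (fun x => (w x : ℂ))) (h2 : Loc k (fun x => (H x : ℂ))) :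
    Loc (k + 1) (fun x => (w x : ℂ)) := by
  intro χ hχ
  set c : ℂ := ((1 / (4 * π ^ 2) : ℝ) : ℂ) with hc
  have hcont : Continuous (fun x => χ x * (w x : ℂ)) := χ.continuous.mul (Complex.continuous_ofReal.comp hwc)
  have ii : ∀ (ζ φ : 𝓢(E2, ℂ)), Integrable (fun x => (w x : ℂ) * (ζ x * φ x)) := fun ζ φ => by
    simpa only [mulS_apply] using real_mul_int hw (mulS ζ φ)
  have iH : ∀ (ζ φ : 𝓢(E2, ℂ)), Integrable (fun x => (H x : ℂ) * (ζ x * φ x)) := fun ζ φ => by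
    simpa only [mulS_apply] using real_mul_int hH (mulS ζ φ)
  obtain ⟨W, hW, hae⟩ := gain (k := k) (w := fun x => χ x * (w x : ℂ))
    (G0 := fun x => (χ x * (w x : ℂ) + c * (χ x * (H x : ℂ))) + c * ((Δ χ) x * (w x : ℂ)))
    (G := fun i x => 2 * c * ((∂_{e2basis i} χ) x * (w x : ℂ))) hcont.locallyIntegrable
    (fun φ => (ii χ φ).congr (Eventually.of_forall fun x => by simp only; ring))
    (((h1 χ hχ).add ((h2 χ hχ).const_mul c)).add ((h1 (Δ χ) (supp_lap hχ)).const_mul c))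
    (fun i => (h1 _ (supp_deriv hχ _)).const_mul (2 * c)) (fun φ => by
      have hh := h (mulS χ φ)
      simp only [mulS_lap, mulS_apply] at hh
      have e1 : ∀ x, (w x : ℂ) * (χ x * (Δ φ) x + (Δ χ) x * φ x +
          2 * ((∂_{e2basis 0} χ) x * (∂_{e2basis 0} φ) x + (∂_{e2basis 1} χ) x * (∂_{e2basis 1} φ) x)) =
          (w x : ℂ) * (χ x * (Δ φ) x) + (w x : ℂ) * ((Δ χ) x * φ x) +
          (2 * ((w x : ℂ) * ((∂_{e2basis 0} χ) x * (∂_{e2basis 0} φ) x)) +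
            2 * ((w x : ℂ) * ((∂_{e2basis 1} χ) x * (∂_{e2basis 1} φ) x))) := fun x => by ring
      simp_rw [e1] at hh
      have j1 : Integrable (fun x => (w x : ℂ) * (χ x * (Δ φ) x) + (w x : ℂ) * ((Δ χ) x * φ x)) :=
        (ii _ _).add (ii _ _)
      have j2 : Integrable (fun x => 2 * ((w x : ℂ) * ((∂_{e2basis 0} χ) x * (∂_{e2basis 0} φ) x)) +
            2 * ((w x : ℂ) * ((∂_{e2basis 1} χ) x * (∂_{e2basis 1} φ) x))) :=
        ((ii _ _).const_mul 2).add ((ii _ _).const_mul 2)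
      rw [integral_add j1 j2, integral_add (ii _ _) (ii _ _), integral_add ((ii _ _).const_mul 2) ((ii _ _).const_mul 2),
        integral_const_mul, integral_const_mul] at hh
      have e2 : ∀ x, χ x * (w x : ℂ) * Lop φ x = (w x : ℂ) * (χ x * φ x) - c * ((w x : ℂ) * (χ x * (Δ φ) x)) := by
        intro x
        simp only [Lop, sub_apply, smul_apply, smul_eq_mul]
        ring
      have e3 : ∀ x, ((χ x * (w x : ℂ) + c * (χ x * (H x : ℂ))) + c * ((Δ χ) x * (w x : ℂ))) * φ x =
          ((w x : ℂ) * (χ x * φ x) + c * ((H x : ℂ) * (χ x * φ x))) + c * ((w x : ℂ) * ((Δ χ) x * φ x)) :=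
        fun x => by ring
      have e4 : ∀ (i : Fin 2) x, 2 * c * ((∂_{e2basis i} χ) x * (w x : ℂ)) * (∂_{e2basis i} φ) x =
          2 * c * ((w x : ℂ) * ((∂_{e2basis i} χ) x * (∂_{e2basis i} φ) x)) := fun i x => by ring
      have j3 : Integrable (fun x => (w x : ℂ) * (χ x * φ x) + c * ((H x : ℂ) * (χ x * φ x))) :=
        (ii _ _).add ((iH _ _).const_mul c)
      simp_rw [e2, e3, e4, Fin.sum_univ_two]
      rw [integral_sub (ii _ _) ((ii _ _).const_mul c), integral_add j3 ((ii _ _).const_mul c),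
        integral_add (ii _ _) ((iH _ _).const_mul c), integral_const_mul, integral_const_mul,
        integral_const_mul, integral_const_mul, integral_const_mul]
      linear_combination (-c) * hh)
  have e : (fun x => χ x * (w x : ℂ)) = W := MeasureTheory.Measure.eq_of_ae_eq hae hcont hW.continuous
  rw [e]; exact hW


lemma supp_deriv_real {χ : 𝓢(E2, ℝ)} (h : HasCompactSupport χ) (m : E2) :
    HasCompactSupport (∂_{m} χ : 𝓢(E2, ℝ)) := by
  have := h.fderiv_apply (𝕜 := ℝ) m
  have e : (fun x => fderiv ℝ χ x m) = (∂_{m} χ : 𝓢(E2, ℝ)) := by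
    ext x; rw [SchwartzMap.lineDerivOp_apply_eq_fderiv]
  rw [← e]; exact this

lemma cont_mul_int {F : E2 → ℝ} (hF : Continuous F) {φ : 𝓢(E2, ℝ)} (h : HasCompactSupport φ) :
    Integrable (fun x => F x * φ x) :=
  (hF.mul φ.continuous).integrable_of_hasCompactSupport h.mul_left

lemma ibp {F : E2 → ℝ} (hF : ContDiff ℝ 1 F) {φ : 𝓢(E2, ℝ)} (h : HasCompactSupport φ) (m : E2) :
    ∫ x, F x * (∂_{m} φ) x = - ∫ x, fderiv ℝ F x m * φ x := by
  have hd : Continuous (fun x => fderiv ℝ F x m) := (hF.continuous_fderiv one_ne_zero).clm_apply continuous_const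
  have := integral_mul_fderiv_eq_neg_fderiv_mul_of_integrable (μ := (volume : Measure E2)) (f := F) (g := φ)
    (v := m) (cont_mul_int hd h) (by
      have := cont_mul_int hF.continuous (supp_deriv_real h m)
      simpa only [SchwartzMap.lineDerivOp_apply_eq_fderiv] using this) (cont_mul_int hF.continuous h)
    (fun x _ => hF.differentiable one_ne_zero x) (fun x _ => φ.differentiable x)
  simp only [SchwartzMap.lineDerivOp_apply_eq_fderiv]
  exact this

lemma ae_eq_test {F G : E2 → ℝ} (hF : LocallyIntegrable F) (hG : LocallyIntegrable G)
    (h : ∀ φ : 𝓢(E2, ℝ), HasCompactSupport φ → ∫ x, F x * φ x = ∫ x, G x * φ x) : F =ᵐ[volume] G := by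
  refine ae_eq_of_integral_contDiff_smul_eq hF hG fun g hg hs => ?_
  have := h (hs.toSchwartzMap hg) hs
  have e : ∀ x, (hs.toSchwartzMap hg) x = g x := fun x => rfl
  simp_rw [e] at this
  simp_rw [smul_eq_mul, mul_comm (g _)]
  exact this

lemma loc_Hn {ε a : ℝ} {μ : E2 → ℝ} {f v : E2 → E2} (hμ : ContDiff ℝ (⊤ : ℕ∞) μ) (hf : ContDiff ℝ (⊤ : ℕ∞) f)
    {k : ℕ} (h : ∀ j, Loc k (fun x => (v x j : ℂ))) (j : Fin 2) :
    Loc k (fun x => (Hn ε a μ f v j x : ℂ)) := by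
  have hμ' : Loc k (fun x => (μ x : ℂ)) := Loc.smooth k (Complex.ofRealCLM.contDiff.comp hμ)
  have hf' : Loc k (fun x => (f x j : ℂ)) :=
    Loc.smooth k (Complex.ofRealCLM.contDiff.comp ((EuclideanSpace.proj j : E2 →L[ℝ] ℝ).contDiff.comp hf))
  have h1 := (((hμ'.mul (h j)).add (((((h 0).mul (h 0)).add ((h 1).mul (h 1))).mul (h j)).const_mul (-1))).const_mul
    ((1/ε^2 : ℝ) : ℂ)).add (hf'.const_mul ((a/ε : ℝ) : ℂ))
  refine (congrArg (Loc k) (funext fun x => ?_)).mp h1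
  unfold Hn
  rw [norm_sq_coord]
  push_cast
  ring

lemma main_lim {u : ℕ → E2 → E2} {M : ℝ} {U : E2 → E2} {p : Fin 2 → Fin 2 → E2 → ℝ} (h : Lim u M U p)
    {μ : E2 → ℝ} {f : E2 → E2} {ε Cμ δ R : ℝ} (hc : Coef μ f ε Cμ δ R) {a m : ℝ}
    (hm : ∀ w, MemH1 w → m ≤ energy ε a μ f w)
    (hE : Tendsto (fun n => energy ε a μ f (u n)) atTop (𝓝 m)) :
    ∃ v : E2 → E2, ContDiff ℝ (⊤ : ℕ∞) v ∧
      (∀ x : E2, ε^2 • lap v x + μ x • v x - ‖v x‖^2 • v x + (ε*a) • f x = 0) ∧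
      Tendsto v (Filter.cocompact E2) (𝓝 0) ∧ MemH1 v ∧ energy ε a μ f v ≤ m ∧ v =ᵐ[volume] U := by
  have hε := hc.hε
  have mHU := Hn_memLp hc a h.hU h.U6
  have hex : ∀ j, ∃ v : E2 → ℝ, WK 0 (fun x => (v x : ℂ)) ∧ (fun x => U x j) =ᵐ[volume] v := fun j =>
    first_reg (coord_memLp h.hU j) (mHU j)
      (cplx_weak (coord_memLp h.hU j) (mHU j) fun φ => h.weakEq hc hm hE φ j)
  choose vc hvc hvae using hex
  set v : E2 → E2 := fun x => WithLp.toLp 2 (fun j => vc j x) with hv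
  have hvj : ∀ x j, v x j = vc j x := fun x j => rfl
  have hvU : v =ᵐ[volume] U := by
    filter_upwards [hvae 0, hvae 1] with x h0 h1
    ext j
    rw [hvj]
    fin_cases j
    · exact h0.symm
    · exact h1.symm
  have hv2 : MemLp v 2 volume := (memLp_congr_ae hvU).2 h.hU
  have hv6 : Integrable (fun x => ‖v x‖ ^ 6) := h.U6.congr (by
    filter_upwards [hvU] with x hx; rw [hx])
  have mH := Hn_memLp hc a hv2 hv6
  have hHae : ∀ j, Hn ε a μ f v j =ᵐ[volume] Hn ε a μ f U j := fun j => by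
    filter_upwards [hvU] with x hx
    unfold Hn; rw [hx]
  have weakR : ∀ (φ : 𝓢(E2, ℝ)) (j : Fin 2),
      ∫ x, v x j * ((∂_{e2basis 0} (∂_{e2basis 0} φ)) x + (∂_{e2basis 1} (∂_{e2basis 1} φ)) x) =
      - ∫ x, Hn ε a μ f v j x * φ x := by
    intro φ j
    have := h.weakEq hc hm hE φ j
    rw [integral_congr_ae (g := fun x => U x j * ((∂_{e2basis 0} (∂_{e2basis 0} φ)) x + (∂_{e2basis 1} (∂_{e2basis 1} φ)) x))
      (by filter_upwards [hvU] with x hx; rw [hx]), this,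
      integral_congr_ae (f := fun x => Hn ε a μ f v j x * φ x) (g := fun x => Hn ε a μ f U j x * φ x)
      (by filter_upwards [hHae j] with x hx; rw [hx])]
  have weakC : ∀ j, ∀ φ : 𝓢(E2, ℂ), ∫ x, (v x j : ℂ) * (Δ φ) x = - ∫ x, (Hn ε a μ f v j x : ℂ) * φ x :=
    fun j => cplx_weak (coord_memLp hv2 j) (mH j) fun φ => weakR φ j
  have hcj : ∀ j, Continuous (fun x => v x j) := fun j => by
    have := Complex.continuous_re.comp (hvc j).continuous
    exact this
  have hLoc : ∀ k : ℕ, ∀ j, Loc k (fun x => (v x j : ℂ)) := by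
    intro k
    induction k with
    | zero => exact fun j χ hχ => (WK.schwartz 0 χ).mul (hvc j)
    | succ k ih =>
      exact fun j => boot (coord_memLp hv2 j) (mH j) (weakC j) (hcj j) (ih j) (loc_Hn hc.hμ hc.hf ih j)
  have hsj : ∀ j, ContDiff ℝ (⊤ : ℕ∞) (fun x => v x j) := by
    intro j
    rw [contDiff_infty]
    intro k
    have := Complex.reCLM.contDiff.comp (hLoc k j).contDiff
    exact this
  have hs : ContDiff ℝ (⊤ : ℕ∞) v := by
    rw [contDiff_euclidean]
    exact hsj
  have hd : Differentiable ℝ v := hs.differentiable (by simp)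
  have hpdfun : ∀ i j, pd v i j = fun x => fderiv ℝ (fun y => v y j) x (e2basis i) := fun i j =>
    funext fun x => pd_eq hd i j x
  have hpds : ∀ i j, ContDiff ℝ (⊤ : ℕ∞) (pd v i j) := by
    intro i j
    rw [hpdfun]
    exact ((hsj j).fderiv_right (m := ((⊤ : ℕ∞) : WithTop ℕ∞)) (by simp)).clm_apply contDiff_const
  have hle : (1 : WithTop ℕ∞) ≤ ((⊤ : ℕ∞) : WithTop ℕ∞) := by exact_mod_cast (le_top : (1 : ℕ∞) ≤ ⊤)
  have hpp : ∀ i j, pd v i j =ᵐ[volume] p i j := by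
    intro i j
    refine ae_eq_test (hpds i j).continuous.locallyIntegrable ((h.hp i j).locallyIntegrable (by norm_num))
      fun φ hφ => ?_
    have e : ∫ x, U x j * (∂_{e2basis i} φ : 𝓢(E2, ℝ)) x = ∫ x, v x j * (∂_{e2basis i} φ : 𝓢(E2, ℝ)) x :=
      integral_congr_ae (by filter_upwards [hvU] with x hx; rw [hx])
    rw [h.parts, e, ibp ((hsj j).of_le hle) hφ, neg_neg, hpdfun]
  have hpm : ∀ i j, MemLp (pd v i j) 2 volume := fun i j => (memLp_congr_ae (hpp i j)).2 (h.hp i j)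
  have hH1 : MemH1 v := by
    refine ⟨hd, hv2, ?_⟩
    have hm' : AEStronglyMeasurable (fun x => fderiv ℝ v x) volume := (measurable_fderiv ℝ v).aestronglyMeasurable
    rw [memLp_two_iff_integrable_sq_norm hm']
    have i1 := ((sq_int (hpm 0 0)).add (sq_int (hpm 0 1))).add ((sq_int (hpm 1 0)).add (sq_int (hpm 1 1)))
    refine i1.mono' (hm'.norm.pow 2) (Eventually.of_forall fun x => ?_)
    rw [Real.norm_of_nonneg (by positivity)]
    refine (fderiv_sq_le v x).trans (le_of_eq ?_)
    simp only [gradSq_eq, Pi.add_apply]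
  refine ⟨v, hs, ?_, ?_, hH1, h.lsc hc hE hH1 hvU hpp, hvU⟩
  · have hHc : ∀ j, Continuous (Hn ε a μ f v j) := by
      intro j
      have := (EuclideanSpace.proj j : E2 →L[ℝ] ℝ).continuous.comp hc.hf.continuous
      exact (continuous_const.mul ((hc.hμ.continuous.mul (hcj j)).sub ((hs.continuous.norm.pow 2).mul (hcj j)))).add
        (continuous_const.mul this)
    have hdd : ∀ i j, Continuous (fun x => fderiv ℝ (pd v i j) x (e2basis i)) := fun i j =>
      ((hpds i j).continuous_fderiv (by simp)).clm_apply continuous_const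
    have key : ∀ j, (fun x => fderiv ℝ (pd v 0 j) x (e2basis 0) + fderiv ℝ (pd v 1 j) x (e2basis 1)) =
        fun x => - Hn ε a μ f v j x := by
      intro j
      refine MeasureTheory.Measure.eq_of_ae_eq (μ := (volume : Measure E2)) ?_ ((hdd 0 j).add (hdd 1 j)) (hHc j).neg
      refine ae_eq_test ((hdd 0 j).add (hdd 1 j)).locallyIntegrable (hHc j).neg.locallyIntegrable fun φ hφ => ?_
      have w1 := weakR φ j
      have tw : ∀ i, ∫ x, v x j * (∂_{e2basis i} (∂_{e2basis i} φ)) x = ∫ x, fderiv ℝ (pd v i j) x (e2basis i) * φ x := by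
        intro i
        rw [ibp ((hsj j).of_le hle) (supp_deriv_real hφ _)]
        have e : ∀ x, fderiv ℝ (fun y => v y j) x (e2basis i) = pd v i j x := fun x => (pd_eq hd i j x).symm
        simp_rw [e]
        have := ibp ((hpds i j).of_le hle) hφ (e2basis i)
        rw [this, neg_neg]
      simp_rw [mul_add] at w1
      rw [integral_add (cont_mul_int (hcj j) (supp_deriv_real (supp_deriv_real hφ _) _))
        (cont_mul_int (hcj j) (supp_deriv_real (supp_deriv_real hφ _) _)), tw, tw] at w1
      simp_rw [add_mul, neg_mul]
      rw [integral_add (cont_mul_int (hdd 0 j) hφ) (cont_mul_int (hdd 1 j) hφ), integral_neg, w1]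
    intro x
    have hlap : ∀ j, lap v x j = - Hn ε a μ f v j x := by
      intro j
      rw [← congrFun (key j) x]
      simp only [lap, Fin.sum_univ_two, PiLp.add_apply]
      have hi : ∀ i, fderiv ℝ (pd v i j) x (e2basis i) = fderiv ℝ (fun y => fderiv ℝ v y (e2basis i)) x (e2basis i) j := by
        intro i
        have hdi : Differentiable ℝ (fun y => fderiv ℝ v y (e2basis i)) :=
          ((hs.fderiv_right (m := ((⊤ : ℕ∞) : WithTop ℕ∞)) (by simp)).clm_apply contDiff_const).differentiable (by simp)
        exact (pd_eq hdi i j x).symm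
      rw [hi, hi]
    ext j
    simp only [PiLp.add_apply, PiLp.sub_apply, PiLp.smul_apply, smul_eq_mul, PiLp.zero_apply, hlap j]
    unfold Hn
    field_simp
    ring
  · rw [tendsto_zero_iff_norm_tendsto_zero]
    have h0 := ((hvc 0).tendsto.norm).add ((hvc 1).tendsto.norm)
    rw [norm_zero, add_zero] at h0
    refine squeeze_zero (fun x => norm_nonneg _) (fun x => ?_) h0
    rw [Complex.norm_real, Complex.norm_real, Real.norm_eq_abs, Real.norm_eq_abs]
    refine abs_le_of_sq_le_sq' ?_ (by positivity) |>.2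
    rw [norm_sq_coord, hvj, hvj, ← sq_abs (vc 0 x), ← sq_abs (vc 1 x)]
    nlinarith [abs_nonneg (vc 0 x), abs_nonneg (vc 1 x), mul_nonneg (abs_nonneg (vc 0 x)) (abs_nonneg (vc 1 x))]

lemma memH1_zero : MemH1 (fun _ => (0 : E2)) := by
  refine ⟨differentiable_const _, ?_, ?_⟩
  · exact MemLp.zero'
  · have e : (fun x => fderiv ℝ (fun _ : E2 => (0 : E2)) x) = (fun _ => (0 : E2 →L[ℝ] E2)) := by
      funext x; simp
    rw [e]
    exact MeasureTheory.memLp_const_iff (by norm_num) (by norm_num) |>.2 (Or.inl rfl)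

lemma final_result {μ : E2 → ℝ} {f : E2 → E2} {ε Cμ δ R : ℝ} (hc : Coef μ f ε Cμ δ R) (a : ℝ) :
    (∃ v : E2 → E2, IsMinimizer ε a μ f v) ∧
    (∀ v : E2 → E2, IsMinimizer ε a μ f v →
      ContDiff ℝ (⊤ : ℕ∞) v ∧
      (∀ x : E2, ε^2 • lap v x + μ x • v x - ‖v x‖^2 • v x + (ε*a) • f x = 0) ∧
      Tendsto v (Filter.cocompact E2) (𝓝 0)) := by
  obtain ⟨κ, K, hκ, hco⟩ := hc.coercive a
  have bound : ∀ u, MemH1 u → ∀ B, energy ε a μ f u ≤ B →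
      ∫ x, ‖u x‖ ^ 2 + ‖fderiv ℝ u x‖ ^ 2 ≤ (B + K) / κ := by
    intro u hu B hB
    rw [le_div_iff₀ hκ, mul_comm]
    exact (hco u hu).trans (by linarith)
  constructor
  · set S : Set ℝ := {y | ∃ u, MemH1 u ∧ energy ε a μ f u = y} with hS
    have hne : S.Nonempty := by
      exact ⟨_, (fun _ => 0 : E2 → E2), memH1_zero, rfl⟩
    have hbd : BddBelow S := by
      refine ⟨-K, ?_⟩
      rintro y ⟨u, hu, rfl⟩
      have h1 : 0 ≤ ∫ x, ‖u x‖ ^ 2 + ‖fderiv ℝ u x‖ ^ 2 := integral_nonneg fun x => by positivity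
      have h2 := hco u hu
      nlinarith
    have hm : ∀ w, MemH1 w → sInf S ≤ energy ε a μ f w := fun w hw => csInf_le hbd ⟨w, hw, rfl⟩
    have hseq : ∀ n : ℕ, ∃ u, MemH1 u ∧ energy ε a μ f u < sInf S + 1 / ((n : ℝ) + 1) := by
      intro n
      obtain ⟨y, ⟨u, hu, rfl⟩, hy⟩ := exists_lt_of_csInf_lt hne
        (show sInf S < sInf S + 1 / ((n : ℝ) + 1) by linarith [Nat.one_div_pos_of_nat (α := ℝ) (n := n)])
      exact ⟨u, hu, hy⟩
    choose u hu hlt using hseq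
    have hE : Tendsto (fun n => energy ε a μ f (u n)) atTop (𝓝 (sInf S)) := by
      have h1 : Tendsto (fun n : ℕ => sInf S + 1 / ((n : ℝ) + 1)) atTop (𝓝 (sInf S)) := by
        simpa using tendsto_one_div_add_atTop_nhds_zero_nat.const_add (sInf S)
      exact tendsto_of_tendsto_of_tendsto_of_le_of_le tendsto_const_nhds h1 (fun n => hm _ (hu n)) fun n => (hlt n).le
    have hM : ∀ n, ∫ x, ‖u n x‖ ^ 2 + ‖fderiv ℝ (u n) x‖ ^ 2 ≤ (sInf S + 1 + K) / κ := by
      intro n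
      refine bound _ (hu n) _ ((hlt n).le.trans ?_)
      have : 1 / ((n : ℝ) + 1) ≤ 1 := by
        rw [div_le_one (by positivity)]; linarith [Nat.cast_nonneg (α := ℝ) n]
      linarith
    obtain ⟨s, hs, U, p, hL⟩ := lim_exists hu hM
    obtain ⟨v, -, -, -, hv1, hv2, -⟩ := main_lim hL hc hm (hE.comp hs.tendsto_atTop)
    exact ⟨v, hv1, fun w hw => hv2.trans (hm w hw)⟩
  · intro v0 hv0
    obtain ⟨s, hs, U, p, hL⟩ := lim_exists (u := fun _ => v0) (fun _ => hv0.1)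
      (fun _ => bound v0 hv0.1 _ le_rfl)
    obtain ⟨v, h1, h2, h3, -, -, h4⟩ := main_lim hL hc hv0.2 tendsto_const_nhds
    have hz : ∫ x, wt x ^ 2 * ‖v0 x - U x‖ ^ 2 = 0 := tendsto_nhds_unique tendsto_const_nhds hL.str
    have hi : Integrable (fun x => wt x ^ 2 * ‖v0 x - U x‖ ^ 2) :=
      wt_mul_int ((memLp_two_iff_integrable_sq_norm (hv0.1.2.1.sub hL.hU).1).1 (hv0.1.2.1.sub hL.hU))
    have hae := (integral_eq_zero_iff_of_nonneg (fun x => by positivity) hi).1 hz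
    have hev : v0 =ᵐ[volume] v := by
      filter_upwards [hae, h4] with x hx hx4
      have hw := wt_pos x
      simp only [Pi.zero_apply, mul_eq_zero] at hx
      rcases hx with hx | hx
      · exact absurd hx (by positivity)
      · rw [hx4]
        exact sub_eq_zero.1 (norm_eq_zero.1 (pow_eq_zero_iff (two_ne_zero) |>.1 hx))
    have : v0 = v := MeasureTheory.Measure.eq_of_ae_eq hev hv0.1.1.continuous h1.continuous
    rw [this]
    exact ⟨h1, h2, h3⟩

end

/-- existence of a global minimizer of `E` in `H¹(ℝ²,ℝ²)`; any global
minimizer is a smooth classical solution of the Euler–Lagrange equation and tends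
to `0` at infinity. -/
theorem statement0
    (μ : E2 → ℝ) (μrad : ℝ → ℝ) (ρ : ℝ) (f : E2 → E2) (frad : ℝ → ℝ)
    (hμ : MuHyp μ μrad ρ) (hf : FHyp f frad)
    (ε a : ℝ) (hε : 0 < ε) (ha : 0 ≤ a) :
    (∃ v : E2 → E2, IsMinimizer ε a μ f v) ∧
    (∀ v : E2 → E2, IsMinimizer ε a μ f v →
      ContDiff ℝ (⊤ : ℕ∞) v ∧
      (∀ x : E2, ε^2 • lap v x + μ x • v x - ‖v x‖^2 • v x + (ε*a) • f x = 0) ∧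
      Tendsto v (Filter.cocompact E2) (𝓝 0)) := by
  obtain ⟨Cμ, δ, R, hc⟩ := coef_exists hμ hf hε
  exact final_result hc a
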